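/- Let X be a locally compact CAT(0) space that is a homology manifold of dimension n ≥ 3, and let E ⊂ X be a locally finite Isom(X)-invariant subset such that X \ E is a connected topological manifold. If Isom(X) contains a subgroup isomorphic to the p-adic integers ℤ_p acting effectively by isometries, then HD(X \ E) ≥ n + 2, contradicting HD(X \ E) ≤ HD(X) = n; hence Isom(X) contains no copy of ℤ_p and is therefore a Lie group. -/

import Mathlib

open Set
open scoped ENNReal

/-- A metric space is CAT(0) if midpoints exist and the CN-inequality of Bruhat–Tits holds. -/
def IsCAT0 (X : Type*) [MetricSpace X] : Prop :=
  (∀ x y : X, ∃ m : X, dist x m = dist x y / 2 ∧ dist m y = dist x y / 2) ∧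
  ∀ x y z m : X, dist y m = dist y z / 2 → dist m z = dist y z / 2 →
    dist x m ^ 2 ≤ (dist x y ^ 2 + dist x z ^ 2) / 2 - dist y z ^ 2 / 4

/-- The isometry group with the topology of pointwise convergence (equivalently, the
compact-open topology for isometries of proper spaces). -/
instance isomTopology (X : Type*) [MetricSpace X] : TopologicalSpace (X ≃ᵢ X) :=
  TopologicalSpace.induced (fun g : X ≃ᵢ X => ⇑g) inferInstance

/-- A topological group has no small subgroups: some neighbourhood of the identity contains
no nontrivial subgroup.  By Gleason–Yamabe, a locally compact group is a Lie group iff it has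
no small subgroups. -/
def HasNoSmallSubgroups (G : Type*) [Group G] [TopologicalSpace G] : Prop :=
  ∃ U ∈ nhds (1 : G), ∀ H : Subgroup G, (H : Set G) ⊆ U → H = ⊥

open MeasureTheory Topology Filter
open scoped ContDiff

set_option linter.unusedSectionVars false

section DegreeA
variable {E : Type*} [NormedAddCommGroup E] [InnerProductSpace ℝ E] [FiniteDimensional ℝ E]
  {ι : Type*} [Fintype ι] [DecidableEq ι]

theorem dg_cramer (b : Module.Basis ι ℝ E) (c : ι → E) (v : E) :
    ∑ k, b.det (Function.update c k v) • c k = b.det c • v := by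
  apply b.repr.injective
  ext i
  have h := congrFun (Matrix.mulVec_cramer (b.toMatrix c) (b.repr v)) i
  simp only [Matrix.mulVec, dotProduct, Matrix.cramer_apply, Pi.smul_apply, smul_eq_mul] at h
  simp only [map_sum, map_smul, Finsupp.coe_finsetSum, Finset.sum_apply, Finsupp.smul_apply,
    smul_eq_mul, b.det_apply, Module.Basis.toMatrix_update]
  rw [← h]
  refine Finset.sum_congr rfl fun k _ => ?_
  rw [mul_comm]; rfl

/-- the determinant form as a continuous multilinear map -/
noncomputable def dgOm (b : Module.Basis ι ℝ E) : ContinuousMultilinearMap ℝ (fun _ : ι => E) ℝ :=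
  ⟨b.det.toMultilinearMap, by
    change Continuous fun c : ι → E => b.det c
    simp only [b.det_apply]
    refine Continuous.matrix_det ?_
    refine continuous_matrix fun i j => ?_
    have h : Continuous (b.coord i) := LinearMap.continuous_of_finiteDimensional _
    exact h.comp (continuous_apply j)⟩

@[simp] theorem dgOm_apply (b : Module.Basis ι ℝ E) (c : ι → E) : dgOm b c = b.det c := rfl

theorem dg_det (b : Module.Basis ι ℝ E) (A : E →L[ℝ] E) : A.det = dgOm b (fun j => A (b j)) := by
  have := b.det_comp (A : E →ₗ[ℝ] E) b
  rw [b.det_self, mul_one] at this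
  rw [dgOm_apply]
  exact this.symm

theorem dg_antisymm (b : Module.Basis ι ℝ E) (c : ι → E) (v : E) (S : ι → ι → E)
    (hS : ∀ k l, S k l = S l k) :
    ∑ k, ∑ l ∈ Finset.univ.erase k,
      b.det (Function.update (Function.update c k v) l (S k l)) = 0 := by
  have h1 : ∀ k l, l ≠ k → b.det (Function.update (Function.update c k v) l (S k l)) =
     - b.det (Function.update (Function.update c l v) k (S l k)) := by
    intro k l hkl
    rw [← AlternatingMap.map_swap _ _ hkl, hS]
    congr 1
    ext1 i
    by_cases hi : i = k
    · subst hi; simp [Function.update_of_ne hkl.symm, Function.update_of_ne hkl]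
    · by_cases hi' : i = l
      · subst hi'; simp [hi]
      · simp [hi, hi', Equiv.swap_apply_of_ne_of_ne hi' hi]
  set T : ℝ := ∑ k, ∑ l ∈ Finset.univ.erase k,
      b.det (Function.update (Function.update c k v) l (S k l)) with hT
  have : T = -T := by
    conv_lhs => rw [hT]
    rw [Finset.sum_comm' (t' := Finset.univ) (s' := fun l => Finset.univ.erase l)
      (by intro x y; simp [eq_comm])]
    rw [hT, ← Finset.sum_neg_distrib]
    refine Finset.sum_congr rfl fun l _ => ?_
    rw [← Finset.sum_neg_distrib]
    refine Finset.sum_congr rfl fun k hk => ?_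
    exact h1 k l (Finset.ne_of_mem_erase hk).symm
  linarith

theorem dg_div (b : Module.Basis ι ℝ E) {F v : E → E} {η : E → ℝ} (hF : ContDiff ℝ ∞ F)
    (hv : ContDiff ℝ ∞ v) (hη : ContDiff ℝ ∞ η) (x : E) :
    ∑ k, fderiv ℝ (fun x => η (F x) *
      dgOm b (fun j => Function.update (fun j => fderiv ℝ F x (b j)) k (v x) j)) x (b k) =
    fderiv ℝ η (F x) (v x) * dgOm b (fun j => fderiv ℝ F x (b j)) +
      η (F x) * ∑ k, dgOm b (Function.update (fun j => fderiv ℝ F x (b j)) k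
        (fderiv ℝ v x (b k))) := by
  set c : ι → E := fun j => fderiv ℝ F x (b j) with hc
  set S : ι → ι → E := fun k l => fderiv ℝ (fderiv ℝ F) x (b k) (b l) with hS
  have hsymm : ∀ k l, S k l = S l k := by
    intro k l
    have : IsSymmSndFDerivAt ℝ F x := by
      apply ContDiffAt.isSymmSndFDerivAt (n := ∞) hF.contDiffAt
      simp only [minSmoothness_of_isRCLikeNormedField]
      exact WithTop.coe_le_coe.2 le_top
    exact this _ _
  have hF1 : ContDiff ℝ ∞ (fderiv ℝ F) := hF.fderiv_right (by simp)
  have hdF : HasFDerivAt (fderiv ℝ F) (fderiv ℝ (fderiv ℝ F) x) x :=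
    (hF1.differentiable (by simp) x).hasFDerivAt
  have key : ∀ k, fderiv ℝ (fun x => η (F x) *
      dgOm b (fun j => Function.update (fun j => fderiv ℝ F x (b j)) k (v x) j)) x (b k) =
      fderiv ℝ η (F x) (c k) * dgOm b (Function.update c k (v x)) +
      η (F x) * (dgOm b (Function.update c k (fderiv ℝ v x (b k))) +
        ∑ l ∈ Finset.univ.erase k,
          dgOm b (Function.update (Function.update c k (v x)) l (S k l))) := by
    intro k
    have h1 : HasFDerivAt (fun x => η (F x)) ((fderiv ℝ η (F x)).comp (fderiv ℝ F x)) x :=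
      (hη.differentiable (by simp) (F x)).hasFDerivAt.comp x
        (hF.differentiable (by simp) x).hasFDerivAt
    have h2 : ∀ j, HasFDerivAt
        (fun x => Function.update (fun j => fderiv ℝ F x (b j)) k (v x) j)
        (if j = k then fderiv ℝ v x else
          (ContinuousLinearMap.apply ℝ E (b j)).comp (fderiv ℝ (fderiv ℝ F) x)) x := by
      intro j
      by_cases hj : j = k
      · subst hj
        simp only [Function.update_self, if_true]
        exact (hv.differentiable (by simp) x).hasFDerivAt
      · simp only [Function.update_of_ne hj, if_neg hj]
        exact ((ContinuousLinearMap.apply ℝ E (b j)).hasFDerivAt).comp x hdF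
    have h3 := HasFDerivAt.multilinear_comp (f := dgOm b) h2
    rw [(h1.fun_mul h3).fderiv]
    simp only [ContinuousLinearMap.add_apply, ContinuousLinearMap.smul_apply,
      ContinuousLinearMap.sum_apply, ContinuousLinearMap.comp_apply, smul_eq_mul]
    rw [add_comm]
    congr 1
    · rw [mul_comm]
    · congr 1
      rw [← Finset.add_sum_erase _ _ (Finset.mem_univ k)]
      congr 1
      · simp [ContinuousMultilinearMap.toContinuousLinearMap, c]
      · refine Finset.sum_congr rfl fun l hl => ?_
        simp [ContinuousMultilinearMap.toContinuousLinearMap, c, S, Finset.ne_of_mem_erase hl]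
  rw [Finset.sum_congr rfl fun k _ => key k]
  rw [Finset.sum_add_distrib, ← Finset.mul_sum, Finset.sum_add_distrib]
  have h0 := dg_antisymm b c (v x) S hsymm
  simp only [dgOm_apply] at *
  rw [h0, add_zero]
  congr 1
  have := congrArg (fderiv ℝ η (F x)) (dg_cramer b c (v x))
  simp only [map_sum, map_smul, smul_eq_mul] at this
  rw [mul_comm, ← this]
  exact Finset.sum_congr rfl fun k _ => mul_comm _ _

end DegreeA

open MeasureTheory Topology Filter
open scoped ContDiff
set_option linter.unusedSectionVars false

section DegreeB
variable {E : Type*} [NormedAddCommGroup E] [InnerProductSpace ℝ E] [FiniteDimensional ℝ E]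
  [MeasurableSpace E] [BorelSpace E]

theorem dg_int_zero {X : E → ℝ} (hX : ContDiff ℝ ∞ X) {D K : Set E} (hD : IsOpen D)
    (hK : IsCompact K) (hKD : K ⊆ D) (h0 : ∀ x ∈ D, x ∉ K → X x = 0) (w : E) :
    ∫ x in D, fderiv ℝ X x w = 0 := by
  have hY : ContDiff ℝ 1 (D.indicator X) := by
    rw [contDiff_iff_contDiffAt]
    intro x
    by_cases hx : x ∈ K
    · have : D.indicator X =ᶠ[𝓝 x] X := by
        filter_upwards [hD.mem_nhds (hKD hx)] with y hy
        simp [hy]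
      exact ((hX.of_le (by simp)).contDiffAt).congr_of_eventuallyEq this
    · have : D.indicator X =ᶠ[𝓝 x] fun _ => 0 := by
        filter_upwards [hK.isClosed.isOpen_compl.mem_nhds hx] with y hy
        by_cases hyD : y ∈ D
        · simp [hyD, h0 y hyD hy]
        · simp [hyD]
      exact contDiffAt_const.congr_of_eventuallyEq this
  have hsupp : HasCompactSupport (D.indicator X) := by
    apply HasCompactSupport.intro hK
    intro x hx
    by_cases hxD : x ∈ D
    · simp [hxD, h0 x hxD hx]
    · simp [hxD]
  have hfd : ∀ x, fderiv ℝ (D.indicator X) x w = D.indicator (fun x => fderiv ℝ X x w) x := by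
    intro x
    by_cases hx : x ∈ D
    · have : D.indicator X =ᶠ[𝓝 x] X := by
        filter_upwards [hD.mem_nhds hx] with y hy
        simp [hy]
      rw [this.fderiv_eq]
      simp [hx]
    · have : D.indicator X =ᶠ[𝓝 x] fun _ => 0 := by
        filter_upwards [hK.isClosed.isOpen_compl.mem_nhds (fun h => hx (hKD h))] with y hy
        by_cases hyD : y ∈ D
        · simp [hyD, h0 y hyD hy]
        · simp [hyD]
      rw [this.fderiv_eq]
      simp [hx]
  rw [← integral_indicator hD.measurableSet]
  rw [← integral_congr_ae (Eventually.of_forall hfd)]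
  have hint : Integrable (fun x => fderiv ℝ (D.indicator X) x w) := by
    apply Continuous.integrable_of_hasCompactSupport
    · exact (hY.continuous_fderiv (by simp)).clm_apply continuous_const
    · exact (hsupp.fderiv_apply ℝ w)
  have := integral_mul_fderiv_eq_neg_fderiv_mul_of_integrable (μ := (volume : Measure E))
    (f := D.indicator X) (g := fun _ => (1 : ℝ)) (v := w) (by simpa using hint) (by simp)
    (by simpa using hY.continuous.integrable_of_hasCompactSupport hsupp)
    (fun x _ => hY.differentiable (by simp) x) (fun x _ => by simp)
  simp at this
  simpa using this

/-- the degree integral -/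
noncomputable def degInt (η : E → ℝ) (f : E → E) (D : Set E) : ℝ :=
  ∫ x in D, η (f x) * (fderiv ℝ f x).det

theorem degInt_homotopy {η : E → ℝ} {f v : E → E} {D : Set E} (hη : ContDiff ℝ ∞ η)
    (hf : ContDiff ℝ ∞ f) (hv : ContDiff ℝ ∞ v) (hD : IsOpen D) (hDb : Bornology.IsBounded D)
    (hfr : ∀ τ ∈ Set.Icc (0 : ℝ) 1, ∀ x ∈ frontier D, f x + τ • v x ∉ tsupport η) :
    degInt η f D = degInt η (fun x => f x + v x) D := by
  classical
  let b := (stdOrthonormalBasis ℝ E).toBasis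
  have hcl : IsCompact (closure D) := hDb.isCompact_closure
  -- notations
  let F : ℝ → E → E := fun τ x => f x + τ • v x
  have hF : ∀ τ, ContDiff ℝ ∞ (F τ) := fun τ => hf.add (contDiff_const.smul hv)
  have hFd : ∀ τ x, fderiv ℝ (F τ) x = fderiv ℝ f x + τ • fderiv ℝ v x := by
    intro τ x
    have h1 := (hf.differentiable (by simp) x).hasFDerivAt
    have h2 := (hv.differentiable (by simp) x).hasFDerivAt
    exact (h1.add (h2.const_smul τ)).fderiv
  let c : ℝ → E → Fin (Module.finrank ℝ E) → E :=
    fun τ x j => fderiv ℝ f x (b j) + τ • fderiv ℝ v x (b j)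
  have hc : ∀ τ x, (fun j => fderiv ℝ (F τ) x (b j)) = c τ x := by
    intro τ x; ext1 j; rw [hFd]; rfl
  let Q : ℝ → E → ℝ := fun τ x => fderiv ℝ η (F τ x) (v x) * dgOm b (c τ x) +
      η (F τ x) * ∑ k, dgOm b (Function.update (c τ x) k (fderiv ℝ v x (b k)))
  have hcf : Continuous (fderiv ℝ f) := hf.continuous_fderiv (by simp)
  have hcv : Continuous (fderiv ℝ v) := hv.continuous_fderiv (by simp)
  have hcη : Continuous (fderiv ℝ η) := hη.continuous_fderiv (by simp)
  have hFc : Continuous (fun q : ℝ × E => F q.1 q.2) :=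
    (hf.continuous.comp continuous_snd).add
      (continuous_fst.smul (hv.continuous.comp continuous_snd))
  have hcc : Continuous (fun q : ℝ × E => c q.1 q.2) := by
    refine continuous_pi fun j => ?_
    exact ((hcf.comp continuous_snd).clm_apply continuous_const).add
      (continuous_fst.smul ((hcv.comp continuous_snd).clm_apply continuous_const))
  have hQc : Continuous (fun q : ℝ × E => Q q.1 q.2) := by
    refine Continuous.add (Continuous.mul ?_ ?_) (Continuous.mul ?_ ?_)
    · exact (hcη.comp hFc).clm_apply (hv.continuous.comp continuous_snd)
    · exact (dgOm b).cont.comp hcc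
    · exact hη.continuous.comp hFc
    · refine continuous_finsetSum _ fun k _ => ?_
      exact (dgOm b).cont.comp
        (hcc.update k ((hcv.comp continuous_snd).clm_apply continuous_const))
  let P : ℝ → E → ℝ := fun τ x => η (F τ x) * dgOm b (c τ x)
  have hPd : ∀ τ x, HasDerivAt (fun τ => P τ x) (Q τ x) τ := by
    intro τ x
    have hFτ : HasDerivAt (fun τ => F τ x) (v x) τ := by
      have := ((hasDerivAt_id' τ).smul_const (v x)).const_add (f x)
      rwa [one_smul] at this
    have h1 : HasDerivAt (fun τ => η (F τ x)) (fderiv ℝ η (F τ x) (v x)) τ :=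
      (hη.differentiable (by simp) (F τ x)).hasFDerivAt.comp_hasDerivAt τ hFτ
    have h2 : ∀ j, HasFDerivAt (fun τ => c τ x j)
        (ContinuousLinearMap.toSpanSingleton ℝ (fderiv ℝ v x (b j))) τ := by
      intro j
      have : HasDerivAt (fun τ => c τ x j) (fderiv ℝ v x (b j)) τ := by
        have := ((hasDerivAt_id' τ).smul_const (fderiv ℝ v x (b j))).const_add
          (fderiv ℝ f x (b j))
        rwa [one_smul] at this
      exact this.hasFDerivAt
    have h3 := (HasFDerivAt.multilinear_comp (f := dgOm b) h2).hasDerivAt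
    have h4 := h1.fun_mul h3
    refine h4.congr_deriv ?_
    symm
    change fderiv ℝ η (F τ x) (v x) * dgOm b (c τ x) +
      η (F τ x) * ∑ k, dgOm b (Function.update (c τ x) k (fderiv ℝ v x (b k))) = _
    congr 1
    congr 1
    simp [ContinuousMultilinearMap.toContinuousLinearMap]
  have hdiv : ∀ τ ∈ Set.Icc (0:ℝ) 1, ∫ x in D, Q τ x = 0 := by
    intro τ hτ
    let X : Fin (Module.finrank ℝ E) → E → ℝ := fun k x => η (F τ x) *
      dgOm b (fun j => Function.update (fun j => fderiv ℝ (F τ) x (b j)) k (v x) j)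
    have hX : ∀ k, ContDiff ℝ ∞ (X k) := by
      intro k
      refine (hη.comp (hF τ)).mul ?_
      refine (dgOm b).contDiff.comp ?_
      refine contDiff_pi.2 fun j => ?_
      by_cases hj : j = k
      · subst hj; simpa using hv
      · simp only [Function.update_of_ne hj]
        exact ((hF τ).fderiv_right (m := ∞) (by simp)).clm_apply contDiff_const
    have hQ : ∀ x, Q τ x = ∑ k, fderiv ℝ (X k) x (b k) := by
      intro x
      have := dg_div b (hF τ) hv hη x
      simp only [X]
      rw [this]
      simp only [hc, Q]
    let K := closure D ∩ (F τ) ⁻¹' (tsupport η)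
    have hK : IsCompact K := hcl.inter_right ((isClosed_tsupport η).preimage (hF τ).continuous)
    have hKD : K ⊆ D := by
      intro x hx
      by_contra hxD
      refine hfr τ hτ x ?_ hx.2
      rw [frontier, hD.interior_eq]
      exact ⟨hx.1, hxD⟩
    simp only [hQ]
    rw [integral_finsetSum]
    · refine Finset.sum_eq_zero fun k _ => dg_int_zero (hX k) hD hK hKD ?_ _
      intro x hx hxK
      have : F τ x ∉ tsupport η := fun h => hxK ⟨subset_closure hx, h⟩
      simp [X, image_eq_zero_of_notMem_tsupport this]
    · intro k _
      have : Continuous fun x => fderiv ℝ (X k) x (b k) :=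
        ((hX k).continuous_fderiv (by simp)).clm_apply continuous_const
      exact (this.continuousOn.integrableOn_compact hcl).mono_set subset_closure
  have hPint : ∀ τ, IntegrableOn (P τ) D := by
    intro τ
    have hPc : Continuous (P τ) := by
      have h1 : Continuous fun x : E => (τ, x) := by fun_prop
      exact (hη.continuous.comp (hFc.comp h1)).mul ((dgOm b).cont.comp (hcc.comp h1))
    exact (hPc.continuousOn.integrableOn_compact hcl).mono_set subset_closure
  have e0 : degInt η f D = ∫ x in D, P 0 x := by
    simp [degInt, P, F, c, dg_det b]
  have e1 : degInt η (fun x => f x + v x) D = ∫ x in D, P 1 x := by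
    have : ∀ x, (fderiv ℝ (fun x => f x + v x) x) = fderiv ℝ f x + fderiv ℝ v x := by
      intro x
      have := hFd 1 x
      simpa [F] using this
    simp [degInt, P, F, c, dg_det b, this]
  have hftc : ∀ x, P 1 x - P 0 x = ∫ τ in Set.Ioc (0:ℝ) 1, Q τ x := by
    intro x
    rw [← intervalIntegral.integral_of_le zero_le_one]
    symm
    apply intervalIntegral.integral_eq_sub_of_hasDerivAt (f := fun τ => P τ x)
    · intro τ _; exact hPd τ x
    · apply Continuous.intervalIntegrable
      have h1 : Continuous fun τ : ℝ => (τ, x) := by fun_prop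
      exact hQc.comp h1
  have hsw : ∫ x in D, ∫ τ in Set.Ioc (0:ℝ) 1, Q τ x = ∫ τ in Set.Ioc (0:ℝ) 1, ∫ x in D, Q τ x := by
    apply integral_integral_swap (f := fun x τ => Q τ x)
    rw [Measure.prod_restrict]
    have : Continuous (Function.uncurry fun x τ => Q τ x) := by
      have h1 : Continuous fun q : E × ℝ => (q.2, q.1) := by fun_prop
      exact hQc.comp h1
    exact (this.continuousOn.integrableOn_compact (hcl.prod (isCompact_Icc (a := (0:ℝ)) (b := 1)))).mono_set
      (Set.prod_mono subset_closure Set.Ioc_subset_Icc_self)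
  have : (∫ x in D, P 1 x) - ∫ x in D, P 0 x = 0 := by
    rw [← integral_sub (hPint 1) (hPint 0)]
    simp only [hftc]
    rw [hsw]
    rw [setIntegral_congr_fun measurableSet_Ioc (g := fun _ => (0:ℝ))]
    · simp
    · intro τ hτ; exact hdiv τ (Set.Ioc_subset_Icc_self hτ)
  rw [e0, e1]; linarith
end DegreeB

open MeasureTheory Topology Filter
open scoped ContDiff
set_option linter.unusedSectionVars false

section DegreeC
variable {E : Type*} [NormedAddCommGroup E] [InnerProductSpace ℝ E] [FiniteDimensional ℝ E]
  [MeasurableSpace E] [BorelSpace E]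

/-- unnormalised radial bump -/
noncomputable def dgBump (x : E) : ℝ := Real.smoothTransition (1 - ‖x‖ ^ 2)

theorem dgBump_contDiff : ContDiff ℝ ∞ (dgBump : E → ℝ) :=
  Real.smoothTransition.contDiff.comp (contDiff_const.sub (contDiff_norm_sq ℝ))

theorem dgBump_zero {x : E} (hx : 1 ≤ ‖x‖) : dgBump x = 0 := by
  apply Real.smoothTransition.zero_of_nonpos
  nlinarith

theorem dgBump_compact : HasCompactSupport (dgBump : E → ℝ) := by
  apply HasCompactSupport.intro (isCompact_closedBall (0 : E) 1)
  intro x hx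
  apply dgBump_zero
  simp only [Metric.mem_closedBall, dist_zero_right, not_le] at hx
  exact hx.le

theorem dgBump_int_pos : 0 < ∫ x : E, dgBump x := by
  apply Continuous.integral_pos_of_hasCompactSupport_nonneg_nonzero
    dgBump_contDiff.continuous dgBump_compact (x := 0)
  · intro x; exact Real.smoothTransition.nonneg _
  · simp [dgBump]

/-- normalised radial bump -/
noncomputable def dgEta (x : E) : ℝ := (∫ x : E, dgBump x)⁻¹ * dgBump x

theorem dgEta_contDiff : ContDiff ℝ ∞ (dgEta : E → ℝ) := contDiff_const.mul dgBump_contDiff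

theorem dgEta_zero {x : E} (hx : 1 ≤ ‖x‖) : dgEta x = 0 := by simp [dgEta, dgBump_zero hx]

theorem dgEta_norm {x y : E} (h : ‖x‖ = ‖y‖) : dgEta x = dgEta y := by simp [dgEta, dgBump, h]

theorem dgEta_int : ∫ x : E, dgEta x = 1 := by
  simp only [dgEta]
  rw [integral_const_mul, inv_mul_cancel₀ dgBump_int_pos.ne']

theorem dgEta_tsupport : tsupport (dgEta : E → ℝ) ⊆ Metric.closedBall 0 1 := by
  apply closure_minimal _ Metric.isClosed_closedBall
  intro x hx
  by_contra h
  simp only [Metric.mem_closedBall, dist_zero_right, not_le] at h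
  exact hx (dgEta_zero h.le)

/-- smooth approximation on compact sets -/
theorem dg_approx {K : Set E} (hK : IsCompact K) {f : E → E} (hf : ContinuousOn f K) {ε : ℝ}
    (hε : 0 < ε) : ∃ g : E → E, ContDiff ℝ ∞ g ∧ ∀ x ∈ K, ‖g x - f x‖ < ε := by
  obtain ⟨F, hF⟩ := ContinuousMap.exists_restrict_eq hK.isClosed
    (⟨K.domRestrict f, hf.domRestrict⟩ : C(K, E))
  obtain ⟨g, hg, hgF, -⟩ := F.continuous.exists_contDiff_approx (⊤ : ℕ∞)
    (ε := fun _ => ε) continuous_const (fun _ => hε)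
  refine ⟨g, hg, fun x hx => ?_⟩
  have := congrArg (fun h : C(K, E) => h ⟨x, hx⟩) hF
  have this : F x = f x := this
  rw [← this, ← dist_eq_norm]
  exact hgF x

/-- `d` is the degree of `f` on `D` at `0` -/
def HasDeg (f : E → E) (D : Set E) (d : ℝ) : Prop :=
  ∃ R₀ : ℝ, ∀ R, R₀ ≤ R → ∀ g : E → E, ContDiff ℝ ∞ g →
    (∀ x ∈ frontier D, ‖g x - R • f x‖ ≤ 1) → degInt dgEta g D = d

open Classical in
/-- the degree of `f` on `D` at `0` -/
noncomputable def deg (f : E → E) (D : Set E) : ℝ :=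
  if h : ∃ d, HasDeg f D d then h.choose else 0

theorem degInt_eq_of_segment {g g' : E → E} (hg : ContDiff ℝ ∞ g) (hg' : ContDiff ℝ ∞ g')
    {D : Set E} (hD : IsOpen D) (hDb : Bornology.IsBounded D)
    (h : ∀ τ ∈ Set.Icc (0 : ℝ) 1, ∀ x ∈ frontier D, 1 < ‖g x + τ • (g' x - g x)‖) :
    degInt dgEta g D = degInt dgEta g' D := by
  rw [degInt_homotopy dgEta_contDiff hg (hg'.sub hg) hD hDb]
  · simp
  · intro τ hτ x hx hmem
    have := dgEta_tsupport hmem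
    simp only [Metric.mem_closedBall, dist_zero_right] at this
    exact absurd (h τ hτ x hx) (not_lt.2 this)

theorem dg_frontier_compact {D : Set E} (hDb : Bornology.IsBounded D) : IsCompact (frontier D) :=
  hDb.isCompact_closure.of_isClosed_subset isClosed_frontier frontier_subset_closure

theorem dg_lower {K : Set E} (hK : IsCompact K) {f : E → E} (hf : ContinuousOn f K)
    (h0 : ∀ x ∈ K, f x ≠ 0) : ∃ m > 0, ∀ x ∈ K, m ≤ ‖f x‖ := by
  rcases K.eq_empty_or_nonempty with rfl | hne
  · exact ⟨1, one_pos, by simp⟩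
  · obtain ⟨x, hx, hmin⟩ := hK.exists_isMinOn hne hf.norm
    exact ⟨‖f x‖, norm_pos_iff.2 (h0 x hx), fun y hy => hmin hy⟩

/-- segments between scaled approximations stay away from the unit ball -/
theorem dg_seg_aux {a b a' b' : E} {R m τ : ℝ} (hτ : τ ∈ Set.Icc (0 : ℝ) 1)
    (ha : ‖a - R • a'‖ ≤ 1) (hb : ‖b - R • b'‖ ≤ 1) (hm : m ≤ ‖a' + τ • (b' - a')‖)
    (hR : 3 ≤ R * m) (hR0 : 0 ≤ R) : 1 < ‖a + τ • (b - a)‖ := by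
  have e : a + τ • (b - a) = R • (a' + τ • (b' - a')) +
      ((1 - τ) • (a - R • a') + τ • (b - R • b')) := by
    module
  have h1 : ‖(1 - τ) • (a - R • a') + τ • (b - R • b')‖ ≤ 1 := by
    refine (norm_add_le _ _).trans ?_
    rw [norm_smul, norm_smul, Real.norm_of_nonneg hτ.1, Real.norm_of_nonneg (sub_nonneg.2 hτ.2)]
    have := hτ.1; have := hτ.2
    nlinarith [norm_nonneg (a - R • a'), norm_nonneg (b - R • b')]
  have h2 : 3 ≤ ‖R • (a' + τ • (b' - a'))‖ := by
    rw [norm_smul, Real.norm_of_nonneg hR0]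
    nlinarith
  rw [e]
  have := norm_sub_le_norm_add (R • (a' + τ • (b' - a'))) ((1 - τ) • (a - R • a') + τ • (b - R • b'))
  linarith

theorem hasDeg_deg {f : E → E} {D : Set E} (hD : IsOpen D) (hDb : Bornology.IsBounded D)
    (hf : ContinuousOn f (frontier D)) (h0 : ∀ x ∈ frontier D, f x ≠ 0) :
    HasDeg f D (deg f D) := by
  have hex : ∃ d, HasDeg f D d := by
    have hK := dg_frontier_compact hDb
    obtain ⟨m, hm, hfm⟩ := dg_lower hK hf h0
    obtain ⟨g, hg, hgf⟩ := dg_approx hK (f := fun x => (3 / m) • f x)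
      (continuousOn_const.smul hf) one_pos
    refine ⟨degInt dgEta g D, 3 / m, fun R hR g' hg' hgf' => ?_⟩
    have hm3 : 0 < 3 / m := by positivity
    have e : 3 / m * m = 3 := by field_simp
    apply degInt_eq_of_segment hg' hg hD hDb
    intro τ hτ x hx
    refine dg_seg_aux (R := 1) (m := 3) hτ (a' := R • f x) (b' := (3 / m) • f x) ?_ ?_ ?_
      (by norm_num) (by norm_num)
    · simpa using hgf' x hx
    · simpa using (hgf x hx).le
    · have : R • f x + τ • ((3 / m) • f x - R • f x) = ((1 - τ) * R + τ * (3 / m)) • f x := by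
        module
      rw [this, norm_smul]
      have h1 := hτ.1
      have h2 := hτ.2
      have : 3 / m ≤ (1 - τ) * R + τ * (3 / m) := by nlinarith
      rw [Real.norm_of_nonneg (hm3.le.trans this)]
      calc (3 : ℝ) = 3 / m * m := e.symm
        _ ≤ _ := mul_le_mul this (hfm x hx) hm.le (hm3.le.trans this)
  rw [deg, dif_pos hex]
  exact hex.choose_spec

theorem deg_homotopy {f f' : E → E} {D : Set E} (hD : IsOpen D) (hDb : Bornology.IsBounded D)
    (hf : ContinuousOn f (frontier D)) (hf' : ContinuousOn f' (frontier D))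
    (h0 : ∀ τ ∈ Set.Icc (0 : ℝ) 1, ∀ x ∈ frontier D, f x + τ • (f' x - f x) ≠ 0) :
    deg f D = deg f' D := by
  have hK := dg_frontier_compact hDb
  obtain ⟨R₁, h1⟩ := hasDeg_deg hD hDb hf (fun x hx => by simpa using h0 0 (by simp) x hx)
  obtain ⟨R₂, h2⟩ := hasDeg_deg hD hDb hf' (fun x hx => by simpa using h0 1 (by simp) x hx)
  have : ∃ m > 0, ∀ τ ∈ Set.Icc (0 : ℝ) 1, ∀ x ∈ frontier D, m ≤ ‖f x + τ • (f' x - f x)‖ := by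
    have hc : IsCompact (Set.Icc (0 : ℝ) 1 ×ˢ frontier D) := isCompact_Icc.prod hK
    have hcont : ContinuousOn (fun q : ℝ × E => ‖f q.2 + q.1 • (f' q.2 - f q.2)‖)
        (Set.Icc (0 : ℝ) 1 ×ˢ frontier D) := by
      have a1 : ContinuousOn (fun q : ℝ × E => f q.2) (Set.Icc (0 : ℝ) 1 ×ˢ frontier D) :=
        hf.comp continuousOn_snd (fun q hq => hq.2)
      have a2 : ContinuousOn (fun q : ℝ × E => f' q.2) (Set.Icc (0 : ℝ) 1 ×ˢ frontier D) :=
        hf'.comp continuousOn_snd (fun q hq => hq.2)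
      exact (a1.add (continuousOn_fst.smul (a2.sub a1))).norm
    rcases (Set.Icc (0 : ℝ) 1 ×ˢ frontier D).eq_empty_or_nonempty with he | hne
    · refine ⟨1, one_pos, fun τ hτ x hx => ?_⟩
      have : (τ, x) ∈ (Set.Icc (0 : ℝ) 1 ×ˢ frontier D) := ⟨hτ, hx⟩
      rw [he] at this
      exact this.elim
    · obtain ⟨q, hq, hmin⟩ := hc.exists_isMinOn hne hcont
      refine ⟨_, norm_pos_iff.2 (h0 q.1 hq.1 q.2 hq.2), fun τ hτ x hx => ?_⟩
      exact hmin (show (τ, x) ∈ _ from ⟨hτ, hx⟩)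
  obtain ⟨m, hm, hfm⟩ := this
  let R := max (max R₁ R₂) (3 / m)
  have hR3 : 3 / m ≤ R := le_max_right _ _
  obtain ⟨g, hg, hgf⟩ := dg_approx hK (f := fun x => R • f x) (continuousOn_const.smul hf) one_pos
  obtain ⟨g', hg', hgf'⟩ := dg_approx hK (f := fun x => R • f' x)
    (continuousOn_const.smul hf') one_pos
  rw [← h1 R ((le_max_left _ _).trans (le_max_left _ _)) g hg (fun x hx => (hgf x hx).le),
    ← h2 R ((le_max_right _ _).trans (le_max_left _ _)) g' hg' (fun x hx => (hgf' x hx).le)]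
  apply degInt_eq_of_segment hg hg' hD hDb
  intro τ hτ x hx
  refine dg_seg_aux hτ (hgf x hx).le (hgf' x hx).le (hfm τ hτ x hx) ?_ ?_
  · rwa [div_le_iff₀ hm] at hR3
  · exact le_trans (by positivity) hR3

theorem deg_congr {f f' : E → E} {D : Set E} (hD : IsOpen D) (hDb : Bornology.IsBounded D)
    (hf : ContinuousOn f (frontier D)) (h0 : ∀ x ∈ frontier D, f x ≠ 0)
    (h : ∀ x ∈ frontier D, f x = f' x) : deg f D = deg f' D := by
  apply deg_homotopy hD hDb hf (hf.congr fun x hx => (h x hx).symm)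
  intro τ _ x hx
  rw [h x hx]
  simpa using (h x hx) ▸ h0 x hx

theorem deg_add {f : E → E} {D D₁ D₂ : Set E} (hD : IsOpen D) (hDb : Bornology.IsBounded D)
    (hD₁ : IsOpen D₁) (hD₂ : IsOpen D₂) (h₁ : D₁ ⊆ D) (h₂ : D₂ ⊆ D) (hdisj : Disjoint D₁ D₂)
    (hf : ContinuousOn f (closure D))
    (h0 : ∀ x ∈ closure D, x ∉ D₁ → x ∉ D₂ → f x ≠ 0) :
    deg f D = deg f D₁ + deg f D₂ := by
  have hcl := hDb.isCompact_closure
  let K := closure D \ (D₁ ∪ D₂)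
  have hK : IsCompact K := hcl.diff (hD₁.union hD₂)
  obtain ⟨m, hm, hfm⟩ := dg_lower hK (hf.mono Set.sdiff_subset)
    (fun x hx => h0 x hx.1 (fun h => hx.2 (Or.inl h)) (fun h => hx.2 (Or.inr h)))
  have hfr : frontier D ⊆ K := by
    intro x hx
    rw [frontier, hD.interior_eq] at hx
    exact ⟨hx.1, fun h => hx.2 (h.elim (fun h => h₁ h) (fun h => h₂ h))⟩
  have hfr₁ : frontier D₁ ⊆ K := by
    intro x hx
    rw [frontier, hD₁.interior_eq] at hx
    refine ⟨closure_mono h₁ hx.1, fun h => h.elim hx.2 fun h => ?_⟩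
    exact Set.disjoint_left.1 (hdisj.closure_left hD₂) hx.1 h
  have hfr₂ : frontier D₂ ⊆ K := by
    intro x hx
    rw [frontier, hD₂.interior_eq] at hx
    refine ⟨closure_mono h₂ hx.1, fun h => h.elim (fun h => ?_) hx.2⟩
    exact Set.disjoint_left.1 (hdisj.symm.closure_left hD₁) hx.1 h
  have hne : ∀ x ∈ K, f x ≠ 0 := fun x hx => norm_pos_iff.1 (hm.trans_le (hfm x hx))
  have hfK : ContinuousOn f K := hf.mono Set.sdiff_subset
  obtain ⟨R₀, g0⟩ := hasDeg_deg hD hDb (hfK.mono hfr) (fun x hx => hne x (hfr hx))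
  obtain ⟨R₁, g1⟩ := hasDeg_deg hD₁ (hDb.subset h₁) (hfK.mono hfr₁) (fun x hx => hne x (hfr₁ hx))
  obtain ⟨R₂, g2⟩ := hasDeg_deg hD₂ (hDb.subset h₂) (hfK.mono hfr₂) (fun x hx => hne x (hfr₂ hx))
  let R := max (max R₀ (max R₁ R₂)) (3 / m)
  have hR3 : 3 / m ≤ R := le_max_right _ _
  have hRpos : 0 ≤ R := le_trans (by positivity) hR3
  rw [div_le_iff₀ hm] at hR3
  obtain ⟨g, hg, hgf⟩ := dg_approx hcl (f := fun x => R • f x) (continuousOn_const.smul hf) one_pos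
  rw [← g0 R ((le_max_left _ _).trans (le_max_left _ _)) g hg
      (fun x hx => (hgf x (hfr hx).1).le),
    ← g1 R (((le_max_left _ _).trans (le_max_right _ _)).trans (le_max_left _ _)) g hg
      (fun x hx => (hgf x (hfr₁ hx).1).le),
    ← g2 R (((le_max_right _ _).trans (le_max_right _ _)).trans (le_max_left _ _)) g hg
      (fun x hx => (hgf x (hfr₂ hx).1).le)]
  have hint : IntegrableOn (fun x => dgEta (g x) * (fderiv ℝ g x).det) (closure D) := by
    refine ContinuousOn.integrableOn_compact hcl ?_
    apply Continuous.continuousOn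
    exact (dgEta_contDiff.continuous.comp hg.continuous).mul
      (ContinuousLinearMap.continuous_det.comp (hg.continuous_fderiv (by simp)))
  unfold degInt
  rw [← setIntegral_union hdisj hD₂.measurableSet
    (hint.mono_set (h₁.trans subset_closure)) (hint.mono_set (h₂.trans subset_closure))]
  apply setIntegral_eq_of_subset_of_forall_sdiff_eq_zero hD.measurableSet (Set.union_subset h₁ h₂)
  intro x hx
  have hxK : x ∈ K := ⟨subset_closure hx.1, hx.2⟩
  rw [dgEta_zero, zero_mul]
  have a1 := hgf x hxK.1
  have a2 : 3 ≤ ‖R • f x‖ := by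
    rw [norm_smul, Real.norm_of_nonneg hRpos]
    exact hR3.trans (mul_le_mul_of_nonneg_left (hfm x hxK) hRpos)
  have a3 := norm_le_norm_add_norm_sub' (R • f x) (g x)
  rw [norm_sub_rev] at a3
  linarith

theorem deg_empty (f : E → E) : deg f (∅ : Set E) = 0 := by
  have := hasDeg_deg (f := f) (D := ∅) isOpen_empty (by simp) (by simp) (by simp)
  obtain ⟨R, h⟩ := this
  rw [← h R le_rfl (fun _ => 0) contDiff_const (by simp)]
  simp [degInt]

theorem deg_excision {f : E → E} {D D₁ : Set E} (hD : IsOpen D) (hDb : Bornology.IsBounded D)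
    (hD₁ : IsOpen D₁) (h₁ : D₁ ⊆ D) (hf : ContinuousOn f (closure D))
    (h0 : ∀ x ∈ closure D, x ∉ D₁ → f x ≠ 0) : deg f D = deg f D₁ := by
  rw [deg_add hD hDb hD₁ isOpen_empty h₁ (by simp) (by simp) hf (fun x hx h _ => h0 x hx h),
    deg_empty, add_zero]

theorem deg_exists_zero {f : E → E} {D : Set E} (hD : IsOpen D) (hDb : Bornology.IsBounded D)
    (hf : ContinuousOn f (closure D)) (h : deg f D ≠ 0) : ∃ x ∈ closure D, f x = 0 := by
  by_contra hcon
  push Not at hcon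
  apply h
  rw [deg_excision hD hDb isOpen_empty (by simp) hf (fun x hx _ => hcon x hx), deg_empty]

theorem deg_sub_const {D : Set E} (hD : IsOpen D) (hDb : Bornology.IsBounded D) {y : E}
    (hy : y ∈ D) : deg (fun x => x - y) D = 1 := by
  have hne : ∀ x ∈ frontier D, x - y ≠ 0 := by
    intro x hx h
    rw [frontier, hD.interior_eq] at hx
    exact hx.2 ((sub_eq_zero.1 h).symm ▸ hy)
  obtain ⟨R₀, h0⟩ := hasDeg_deg (f := fun x => x - y) hD hDb (by fun_prop) hne
  obtain ⟨δ, hδ, hball⟩ := Metric.isOpen_iff.1 hD y hy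
  let R := max R₀ (1 / δ)
  have hR : 1 / δ ≤ R := le_max_right _ _
  have hRpos : 0 < R := lt_of_lt_of_le (by positivity) hR
  rw [← h0 R (le_max_left _ _) (fun x => R • (x - y)) (contDiff_const.smul
    (contDiff_id.sub contDiff_const)) (by simp)]
  have hfd : ∀ x, (fderiv ℝ (fun x => R • (x - y)) x).det = R ^ Module.finrank ℝ E := by
    intro x
    have : HasFDerivAt (fun x => R • (x - y)) (R • ContinuousLinearMap.id ℝ E) x :=
      ((hasFDerivAt_id x).sub_const y).const_smul R
    rw [this.fderiv]
    simp [ContinuousLinearMap.det]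
  unfold degInt
  simp only [hfd]
  have : ∫ x in D, dgEta (R • (x - y)) * R ^ Module.finrank ℝ E =
      ∫ x, dgEta (R • (x - y)) * R ^ Module.finrank ℝ E := by
    apply setIntegral_eq_integral_of_forall_compl_eq_zero
    intro x hx
    rw [dgEta_zero, zero_mul]
    rw [norm_smul, Real.norm_of_nonneg hRpos.le]
    have : δ ≤ ‖x - y‖ := by
      by_contra hlt
      push Not at hlt
      exact hx (hball (by rwa [Metric.mem_ball, dist_eq_norm]))
    rw [div_le_iff₀ hδ] at hR
    nlinarith
  rw [this, integral_mul_const, integral_sub_right_eq_self (fun x => dgEta (R • x)) y,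
    Measure.integral_comp_smul, dgEta_int]
  rw [abs_of_nonneg (by positivity)]
  simp only [smul_eq_mul, mul_one]
  exact inv_mul_cancel₀ (by positivity)

end DegreeC

open MeasureTheory Topology Filter
open scoped ContDiff
set_option linter.unusedSectionVars false

section DegreeD
variable {E : Type*} [NormedAddCommGroup E] [InnerProductSpace ℝ E] [FiniteDimensional ℝ E]
  [MeasurableSpace E] [BorelSpace E]

theorem deg_isom {S : E →L[ℝ] E} (hS : ∀ y, ‖S y‖ = ‖y‖) {f : E → E} {D : Set E}
    (hD : IsOpen D) (hDb : Bornology.IsBounded D) (hf : ContinuousOn f (frontier D))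
    (h0 : ∀ x ∈ frontier D, f x ≠ 0) : deg (fun x => S (f x)) D = S.det * deg f D := by
  obtain ⟨R₁, h1⟩ := hasDeg_deg hD hDb hf h0
  obtain ⟨R₂, h2⟩ := hasDeg_deg (f := fun x => S (f x)) hD hDb (S.continuous.comp_continuousOn hf)
    (fun x hx => by
      rw [← norm_ne_zero_iff, hS, norm_ne_zero_iff]; exact h0 x hx)
  let R := max R₁ R₂
  obtain ⟨g, hg, hgf⟩ := dg_approx (dg_frontier_compact hDb) (f := fun x => R • f x)
    (continuousOn_const.smul hf) one_pos
  rw [← h1 R (le_max_left _ _) g hg (fun x hx => (hgf x hx).le),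
    ← h2 R (le_max_right _ _) (fun x => S (g x)) (S.contDiff.comp hg) (fun x hx => by
      rw [← map_smul, ← map_sub, hS]; exact (hgf x hx).le)]
  unfold degInt
  rw [← integral_const_mul]
  congr 1
  ext x
  have : fderiv ℝ (fun x => S (g x)) x = S.comp (fderiv ℝ g x) :=
    (S.hasFDerivAt.comp x (hg.differentiable (by simp) x).hasFDerivAt).fderiv
  rw [this, dgEta_norm (hS (g x))]
  have : (S.comp (fderiv ℝ g x)).det = S.det * (fderiv ℝ g x).det := by
    simp only [ContinuousLinearMap.det, ContinuousLinearMap.toLinearMap_comp, LinearMap.det_comp]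
  rw [this]; ring

/-- the sign of a real as a real -/
noncomputable def sg (x : ℝ) : ℝ := (SignType.sign x : ℝ)

theorem sg_mul (x y : ℝ) : sg (x * y) = sg x * sg y := by
  simp [sg, sign_mul]

theorem sg_one : sg 1 = 1 := by simp [sg]

theorem sg_prod {ι : Type*} (s : Finset ι) (d : ι → ℝ) : sg (∏ i ∈ s, d i) = ∏ i ∈ s, sg (d i) := by
  classical
  induction s using Finset.induction_on with
  | empty => simp [sg_one]
  | insert a s ha ih => rw [Finset.prod_insert ha, Finset.prod_insert ha, sg_mul, ih]

theorem sg_cases {x : ℝ} (hx : x ≠ 0) : (0 < x ∧ sg x = 1) ∨ (x < 0 ∧ sg x = -1) := by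
  rcases lt_or_gt_of_ne hx with h | h
  · right; exact ⟨h, by simp [sg, sign_neg h]⟩
  · left; exact ⟨h, by simp [sg, sign_pos h]⟩

theorem sg_sg {x : ℝ} (hx : x ≠ 0) : sg (sg x) = sg x := by
  rcases sg_cases hx with ⟨_, h⟩ | ⟨_, h⟩
  · rw [h]; simp [sg]
  · rw [h]; simp [sg]

theorem dg_toLin_ne {ι : Type*} [Fintype ι] [DecidableEq ι] (b : Module.Basis ι ℝ E)
    {M : Matrix ι ι ℝ} (hM : M.det ≠ 0) {y : E} (hy : y ≠ 0) : Matrix.toLin b b M y ≠ 0 := by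
  have : IsUnit M.det := isUnit_iff_ne_zero.2 hM
  intro h
  apply hy
  have h2 := congrArg (Matrix.toLin b b M⁻¹) h
  rw [← LinearMap.comp_apply, ← Matrix.toLin_mul b b b, Matrix.nonsing_inv_mul _ this,
    Matrix.toLin_one] at h2
  simpa using h2

theorem deg_matrix (M : Matrix (Fin (Module.finrank ℝ E)) (Fin (Module.finrank ℝ E)) ℝ)
    (hM : M.det ≠ 0) : ∀ (f : E → E) (D : Set E), IsOpen D → Bornology.IsBounded D →
      ContinuousOn f (frontier D) → (∀ x ∈ frontier D, f x ≠ 0) →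
      deg (fun x => Matrix.toLin (stdOrthonormalBasis ℝ E).toBasis
        (stdOrthonormalBasis ℝ E).toBasis M (f x)) D = sg M.det * deg f D := by
  classical
  let b := (stdOrthonormalBasis ℝ E).toBasis
  have hrepr : ∀ d y i, b.repr (Matrix.toLin b b (Matrix.diagonal d) y) i = d i * b.repr y i := by
    intro d y i
    have := congrFun (LinearMap.toMatrix_mulVec_repr b b (Matrix.toLin b b (Matrix.diagonal d)) y) i
    rw [← this, LinearMap.toMatrix_toLin, Matrix.mulVec_diagonal]
  have hcont : ∀ N : Matrix (Fin (Module.finrank ℝ E)) (Fin (Module.finrank ℝ E)) ℝ,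
      Continuous (Matrix.toLin b b N) := fun N => LinearMap.continuous_of_finiteDimensional _
  refine Matrix.diagonal_transvection_induction_of_det_ne_zero (fun M =>
    ∀ (f : E → E) (D : Set E), IsOpen D → Bornology.IsBounded D →
      ContinuousOn f (frontier D) → (∀ x ∈ frontier D, f x ≠ 0) →
      deg (fun x => Matrix.toLin b b M (f x)) D = sg M.det * deg f D) M hM ?_ ?_ ?_
  · intro d hd
    intro f D hD hDb hf h0
    have hdi : ∀ i, d i ≠ 0 := by
      intro i hi
      apply hd
      rw [Matrix.det_diagonal]
      exact Finset.prod_eq_zero (Finset.mem_univ i) hi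
    let s := fun i => sg (d i)
    have hs : ∀ i, s i ^ 2 = 1 := by
      intro i
      rcases sg_cases (hdi i) with ⟨_, h⟩ | ⟨_, h⟩ <;> simp [s, h]
    have e1 : deg (fun x => Matrix.toLin b b (Matrix.diagonal d) (f x)) D =
        deg (fun x => Matrix.toLin b b (Matrix.diagonal s) (f x)) D := by
      apply deg_homotopy hD hDb ((hcont _).comp_continuousOn hf) ((hcont _).comp_continuousOn hf)
      intro τ hτ x hx hz
      apply h0 x hx
      apply b.repr.injective
      ext i
      have hz : Matrix.toLin b b (Matrix.diagonal d) (f x) + τ • (Matrix.toLin b b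
        (Matrix.diagonal s) (f x) - Matrix.toLin b b (Matrix.diagonal d) (f x)) = 0 := hz
      have := congrArg (fun y => b.repr y i) hz
      simp only [map_add, map_smul, map_sub, Finsupp.add_apply, Finsupp.smul_apply,
        Finsupp.sub_apply, hrepr, map_zero, Finsupp.zero_apply, smul_eq_mul] at this ⊢
      have h2 : ((1 - τ) * d i + τ * s i) * b.repr (f x) i = 0 := by linarith
      rcases mul_eq_zero.1 h2 with h3 | h3
      · exfalso
        have t0 := hτ.1
        have t1 := hτ.2
        rcases sg_cases (hdi i) with ⟨h4, h⟩ | ⟨h4, h⟩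
        · simp only [s, h] at h3
          have h5 := mul_nonneg (sub_nonneg.2 t1) h4.le
          have h6 : τ = 0 := by linarith
          rw [h6] at h3
          linarith
        · simp only [s, h] at h3
          have h5 := mul_nonneg (sub_nonneg.2 t1) (neg_nonneg.2 h4.le)
          have h6 : τ = 0 := by linarith
          rw [h6] at h3
          linarith
      · exact h3
    change deg (fun x => Matrix.toLin b b (Matrix.diagonal d) (f x)) D = _
    rw [e1]
    let S : E →L[ℝ] E := LinearMap.toContinuousLinearMap (Matrix.toLin b b (Matrix.diagonal s))
    have hS : ∀ y, ‖S y‖ = ‖y‖ := by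
      intro y
      have hn : ∀ z : E, ‖z‖ ^ 2 = ∑ i, (b.repr z i) ^ 2 := by
        intro z
        rw [← (stdOrthonormalBasis ℝ E).repr.norm_map z, EuclideanSpace.norm_sq_eq]
        simp [b]
      have : ‖S y‖ ^ 2 = ‖y‖ ^ 2 := by
        rw [hn, hn]
        refine Finset.sum_congr rfl fun i _ => ?_
        change (b.repr (Matrix.toLin b b (Matrix.diagonal s) y) i) ^ 2 = _
        rw [hrepr, mul_pow, hs, one_mul]
      exact (pow_left_inj₀ (norm_nonneg _) (norm_nonneg _) two_ne_zero).1 this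
    have := deg_isom hS hD hDb hf h0
    have hdet : S.det = sg (Matrix.diagonal d).det := by
      change LinearMap.det (Matrix.toLin b b (Matrix.diagonal s)) = _
      rw [LinearMap.det_toLin, Matrix.det_diagonal, Matrix.det_diagonal, sg_prod]
    rw [← hdet, ← this]
    rfl
  · intro t
    intro f D hD hDb hf h0
    rw [Matrix.TransvectionStruct.det, sg_one, one_mul]
    symm
    apply deg_homotopy hD hDb hf ((hcont _).comp_continuousOn hf)
    intro τ hτ x hx
    have e : f x + τ • (Matrix.toLin b b t.toMatrix (f x) - f x) =
        Matrix.toLin b b (Matrix.transvection t.i t.j (τ * t.c)) (f x) := by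
      rw [Matrix.TransvectionStruct.toMatrix, Matrix.transvection, Matrix.transvection, map_add,
        map_add, Matrix.toLin_one]
      simp only [LinearMap.add_apply, LinearMap.id_apply, add_sub_cancel_left]
      congr 1
      rw [show Matrix.single t.i t.j (τ * t.c) = τ • Matrix.single t.i t.j t.c by
        rw [Matrix.smul_single, smul_eq_mul], map_smul, LinearMap.smul_apply]
    change f x + τ • (Matrix.toLin b b t.toMatrix (f x) - f x) ≠ 0
    rw [e]
    apply dg_toLin_ne b _ (h0 x hx)
    rw [Matrix.det_transvection_of_ne _ _ t.hij]
    exact one_ne_zero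
  · intro A B hA hB ihA ihB
    intro f D hD hDb hf h0
    have h1 := ihB f D hD hDb hf h0
    have h2 := ihA (fun x => Matrix.toLin b b B (f x)) D hD hDb
      ((hcont _).comp_continuousOn hf) (fun x hx => dg_toLin_ne b hB (h0 x hx))
    rw [Matrix.det_mul, sg_mul, mul_assoc, ← h1, ← h2]
    congr 1
    ext x
    rw [Matrix.toLin_mul b b b]
    rfl

theorem deg_linear {A : E →L[ℝ] E} (hA : A.det ≠ 0) {f : E → E} {D : Set E}
    (hD : IsOpen D) (hDb : Bornology.IsBounded D) (hf : ContinuousOn f (frontier D))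
    (h0 : ∀ x ∈ frontier D, f x ≠ 0) : deg (fun x => A (f x)) D = sg A.det * deg f D := by
  classical
  let b := (stdOrthonormalBasis ℝ E).toBasis
  let M := LinearMap.toMatrix b b (A : E →ₗ[ℝ] E)
  have hM : M.det = A.det := LinearMap.det_toMatrix b _
  have := deg_matrix M (by rwa [hM]) f D hD hDb hf h0
  rw [hM] at this
  rw [← this]
  congr 1
  ext x
  change _ = Matrix.toLin b b M (f x)
  rw [Matrix.toLin_toMatrix]
  rfl
end DegreeD

open MeasureTheory Topology Filter
open scoped ContDiff
set_option linter.unusedSectionVars false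

section DegreeE
variable {E : Type*} [NormedAddCommGroup E] [InnerProductSpace ℝ E] [FiniteDimensional ℝ E]
  [MeasurableSpace E] [BorelSpace E]

theorem dg_sard {g : E → E} (hg : ContDiff ℝ ∞ g) {ε : ℝ} (hε : 0 < ε) :
    ∃ c : E, ‖c‖ < ε ∧ ∀ x, g x = c → (fderiv ℝ g x).det ≠ 0 := by
  have h0 : volume (g '' {x | (fderiv ℝ g x).det = 0}) = 0 := by
    refine addHaar_image_eq_zero_of_det_fderivWithin_eq_zero volume
      (f' := fun x => fderiv ℝ g x) (fun x _ => ?_) (fun x hx => hx)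
    exact ((hg.differentiable (by simp)).differentiableAt.hasFDerivAt).hasFDerivWithinAt
  have h1 : ¬ Metric.ball (0 : E) ε ⊆ g '' {x | (fderiv ℝ g x).det = 0} := by
    intro h
    have := Metric.measure_ball_pos (volume : Measure E) 0 hε
    exact absurd (measure_mono_null h h0) this.ne'
  obtain ⟨c, hc, hc'⟩ := Set.not_subset.1 h1
  refine ⟨c, by simpa using hc, fun x hx hd => hc' ⟨x, hd, hx⟩⟩

theorem dg_det_lower {A : E →L[ℝ] E} (hA : A.det ≠ 0) : ∃ c > 0, ∀ v, c * ‖v‖ ≤ ‖A v‖ := by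
  have hu : IsUnit A.det := isUnit_iff_ne_zero.2 hA
  have hinj : Function.Injective A := by
    have : LinearMap.ker (A : E →ₗ[ℝ] E) = ⊥ := by
      by_contra h
      exact hA (LinearMap.det_eq_zero_iff_ker_ne_bot.2 h)
    exact LinearMap.ker_eq_bot.1 this
  obtain ⟨K, hK, hKA⟩ := (A : E →ₗ[ℝ] E).exists_antilipschitzWith (LinearMap.ker_eq_bot.2 hinj)
  refine ⟨(K : ℝ)⁻¹, by positivity, fun v => ?_⟩
  have := hKA.le_mul_dist v 0
  simp at this
  rw [inv_mul_le_iff₀ (by positivity)]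
  exact this

theorem deg_lin {g h : E → E} {x : E} {A : E →L[ℝ] E} {r₀ : ℝ} (hr₀ : 0 < r₀)
    (hgc : Continuous g) (hg : HasFDerivAt g A (h x)) (hgx : g (h x) = 0) (hA : A.det ≠ 0)
    (hh : ContinuousOn h (Metric.closedBall x r₀)) (hi : Set.InjOn h (Metric.closedBall x r₀)) :
    ∀ᶠ r in 𝓝[>] (0 : ℝ), deg (fun u => g (h u)) (Metric.ball x r) =
      sg A.det * deg (fun u => h u - h x) (Metric.ball x r) := by
  obtain ⟨c, hc, hcA⟩ := dg_det_lower hA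
  have h1 : ∀ᶠ y in 𝓝 (h x), ‖g y - g (h x) - A (y - h x)‖ ≤ c / 2 * ‖y - h x‖ :=
    hg.isLittleO.def (half_pos hc)
  have hcx : ContinuousAt h x := hh.continuousAt (Metric.closedBall_mem_nhds x hr₀)
  have h2 := hcx.eventually h1
  obtain ⟨r₁, hr₁, h3⟩ := Metric.eventually_nhds_iff_ball.1 h2
  filter_upwards [Ioo_mem_nhdsGT (lt_min hr₀ hr₁)] with r hr
  have hrpos := hr.1
  have hr0 : r < r₀ := hr.2.trans_le (min_le_left _ _)
  have hr1 : r < r₁ := hr.2.trans_le (min_le_right _ _)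
  have hfr : ∀ u ∈ frontier (Metric.ball x r), u ∈ Metric.closedBall x r₀ ∧ u ∈ Metric.ball x r₁
      ∧ h u - h x ≠ 0 := by
    intro u hu
    have hu' : dist u x = r := Metric.frontier_ball_subset_sphere hu
    have hm : u ∈ Metric.closedBall x r₀ := by
      rw [Metric.mem_closedBall, hu']; exact hr0.le
    refine ⟨hm, by rw [Metric.mem_ball, hu']; exact hr1, fun h0 => ?_⟩
    have := hi hm (Metric.mem_closedBall_self hr₀.le) (sub_eq_zero.1 h0)
    rw [this, dist_self] at hu'
    exact hrpos.ne hu'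
  have hcf : ContinuousOn (fun u => h u - h x) (frontier (Metric.ball x r)) :=
    (hh.mono fun u hu => (hfr u hu).1).sub continuousOn_const
  rw [← deg_linear hA Metric.isOpen_ball Metric.isBounded_ball hcf (fun u hu => (hfr u hu).2.2)]
  symm
  refine deg_homotopy Metric.isOpen_ball Metric.isBounded_ball (A.continuous.comp_continuousOn hcf)
    (hgc.comp_continuousOn (hh.mono fun u hu => (hfr u hu).1)) ?_
  intro τ hτ u hu h0
  obtain ⟨_, hu1, hu2⟩ := hfr u hu
  have h4 := h3 u hu1
  rw [hgx, sub_zero] at h4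
  have h5 := hcA (h u - h x)
  have h6 : A (h u - h x) = -(τ • (g (h u) - A (h u - h x))) := by
    rw [eq_neg_iff_add_eq_zero]; exact h0
  have h7 : ‖A (h u - h x)‖ ≤ c / 2 * ‖h u - h x‖ := by
    rw [h6, norm_neg, norm_smul, Real.norm_of_nonneg hτ.1]
    calc τ * ‖_‖ ≤ 1 * ‖g (h u) - A (h u - h x)‖ := by gcongr; exact hτ.2
      _ ≤ _ := by rw [one_mul]; exact h4
  have h8 : 0 < ‖h u - h x‖ := norm_pos_iff.2 hu2
  nlinarith

theorem deg_sum {f : E → E} (d : E → ℝ) (S : Finset E) : ∀ {D : Set E} (_ : IsOpen D)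
    (_ : Bornology.IsBounded D) (_ : ContinuousOn f (closure D)) (_ : ∀ x ∈ S, x ∈ D)
    (_ : ∀ x ∈ closure D, f x = 0 → x ∈ S)
    (_ : ∀ x ∈ S, ∀ᶠ r in 𝓝[>] (0 : ℝ), deg f (Metric.ball x r) = d x),
    deg f D = ∑ x ∈ S, d x := by
  classical
  induction S using Finset.induction_on with
  | empty =>
    intro D hD hDb hf _ h0 _
    simp only [Finset.sum_empty]
    by_contra h
    obtain ⟨x, hx, hx0⟩ := deg_exists_zero hD hDb hf h
    simpa using h0 x hx hx0
  | insert a S ha ih =>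
    intro D hD hDb hf hS h0 hd
    rw [Finset.sum_insert ha]
    have hopen : IsOpen (D ∩ (↑S : Set E)ᶜ) := hD.inter (S.finite_toSet.isClosed.isOpen_compl)
    obtain ⟨r₀, hr₀, hr₀'⟩ := Metric.isOpen_iff.1 hopen a ⟨hS a (by simp), by simpa using ha⟩
    obtain ⟨r, hr, hr2⟩ := ((hd a (by simp)).and (Ioo_mem_nhdsGT hr₀)).exists
    have hcb : Metric.closedBall a r ⊆ D ∩ (↑S : Set E)ᶜ :=
      (Metric.closedBall_subset_ball hr2.2).trans hr₀'
    have hD2 : IsOpen (D \ Metric.closedBall a r) := hD.sdiff Metric.isClosed_closedBall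
    have hcl : closure (D \ Metric.closedBall a r) ⊆ closure D := closure_mono Set.sdiff_subset
    rw [deg_add hD hDb Metric.isOpen_ball hD2
      (Metric.ball_subset_closedBall.trans (hcb.trans Set.inter_subset_left)) Set.sdiff_subset
      (Set.disjoint_left.2 fun x hx hx' => hx'.2 (Metric.ball_subset_closedBall hx)) hf, hr]
    · congr 1
      refine ih hD2 (hDb.subset Set.sdiff_subset) (hf.mono hcl) (fun x hx => ⟨hS x (by simp [hx]),
        fun hx' => (hcb hx').2 hx⟩) (fun x hx hx0 => ?_) (fun x hx => hd x (by simp [hx]))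
      have := h0 x (hcl hx) hx0
      rcases Finset.mem_insert.1 this with rfl | h
      · exfalso
        obtain ⟨y, hy1, hy2⟩ := mem_closure_iff.1 hx _ Metric.isOpen_ball
          (Metric.mem_ball_self hr2.1)
        exact hy2.2 (Metric.ball_subset_closedBall hy1)
      · exact h
    · intro x hx hx1 hx2 hx0
      rcases Finset.mem_insert.1 (h0 x hx hx0) with rfl | h
      · exact hx1 (Metric.mem_ball_self hr2.1)
      · exact hx2 ⟨hS x (by simp [h]), fun hx' => (hcb hx').2 h⟩

theorem dg_finite_zeros {g : E → E} (hg : ContDiff ℝ ∞ g)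
    (hr : ∀ x, g x = 0 → (fderiv ℝ g x).det ≠ 0) {K : Set E} (hK : IsCompact K) :
    {x ∈ K | g x = 0}.Finite := by
  by_contra h
  obtain ⟨x, hx, hacc⟩ := Set.Infinite.exists_accPt_of_subset_isCompact h hK (fun x hx => hx.1)
  have hfr := accPt_iff_frequently.1 hacc
  have hx0 : g x = 0 := by
    have hcl : IsClosed {x | g x = 0} := isClosed_eq hg.continuous continuous_const
    exact hcl.mem_of_frequently_of_tendsto (hfr.mono fun y hy => hy.2.2) tendsto_id
  obtain ⟨c, hc, hcA⟩ := dg_det_lower (hr x hx0)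
  have hd : HasFDerivAt g (fderiv ℝ g x) x :=
    (hg.differentiable (by simp)).differentiableAt.hasFDerivAt
  have h1 : ∀ᶠ y in 𝓝 x, ‖g y - g x - fderiv ℝ g x (y - x)‖ ≤ c / 2 * ‖y - x‖ :=
    hd.isLittleO.def (half_pos hc)
  obtain ⟨y, ⟨hne, _, hy0⟩, hy⟩ := (hfr.and_eventually h1).exists
  rw [hy0, hx0, sub_zero, zero_sub, norm_neg] at hy
  have h2 := hcA (y - x)
  have h3 : 0 < ‖y - x‖ := norm_pos_iff.2 (sub_ne_zero.2 hne)
  nlinarith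

theorem local_deg_indep {h : E → E} {Ω : Set E} (hc : ContinuousOn h Ω) (hi : Set.InjOn h Ω)
    {x : E} {r r' : ℝ} (hr : 0 < r) (hrr : r ≤ r') (hr' : Metric.closedBall x r' ⊆ Ω) :
    deg (fun u => h u - h x) (Metric.ball x r') = deg (fun u => h u - h x) (Metric.ball x r) := by
  have hcl : closure (Metric.ball x r') ⊆ Ω := Metric.closure_ball_subset_closedBall.trans hr'
  refine deg_excision Metric.isOpen_ball Metric.isBounded_ball Metric.isOpen_ball
    (Metric.ball_subset_ball hrr) ((hc.mono hcl).sub continuousOn_const) (fun u hu hu' h0 => hu' ?_)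
  have := hi (hcl hu) (hr' (Metric.mem_closedBall_self (hr.le.trans hrr))) (sub_eq_zero.1 h0)
  rw [this]; exact Metric.mem_ball_self hr

theorem local_deg_near {h : E → E} {Ω : Set E} (hc : ContinuousOn h Ω)
    (hi : Set.InjOn h Ω) {x : E} {R : ℝ} (hR : 0 < R) (hRΩ : Metric.closedBall x R ⊆ Ω) :
    ∀ᶠ x' in 𝓝 x, ∀ r > 0, ∀ r' > 0, Metric.closedBall x r ⊆ Ω → Metric.closedBall x' r' ⊆ Ω →
    deg (fun u => h u - h x) (Metric.ball x r) = deg (fun u => h u - h x') (Metric.ball x' r') := by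
  have hfr : ∀ u ∈ frontier (Metric.ball x R), u ∈ Ω ∧ h u - h x ≠ 0 := by
    intro u hu
    have hu' : dist u x = R := Metric.frontier_ball_subset_sphere hu
    have hm : u ∈ Ω := hRΩ (by rw [Metric.mem_closedBall, hu'])
    refine ⟨hm, fun h0 => ?_⟩
    have := hi hm (hRΩ (Metric.mem_closedBall_self hR.le)) (sub_eq_zero.1 h0)
    rw [this, dist_self] at hu'
    exact hR.ne hu'
  have hcx : ContinuousAt h x :=
    hc.continuousAt (mem_of_superset (Metric.closedBall_mem_nhds x hR) hRΩ)
  have hcf : ∀ y, ContinuousOn (fun u => h u - y) (frontier (Metric.ball x R)) := fun y =>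
    (hc.mono fun u hu => (hfr u hu).1).sub continuousOn_const
  obtain ⟨m, hm, hml⟩ := dg_lower (dg_frontier_compact Metric.isBounded_ball) (hcf (h x))
    (fun u hu => (hfr u hu).2)
  have h1 : ∀ᶠ x' in 𝓝 x, dist (h x') (h x) < m := hcx.eventually (Metric.ball_mem_nhds _ hm)
  filter_upwards [h1, Metric.ball_mem_nhds x (half_pos hR)] with x' hx' hx'R r hr r' hr' hrΩ hr'Ω
  have hxx : dist x' x < R / 2 := hx'R
  have e1 : deg (fun u => h u - h x) (Metric.ball x r) =
      deg (fun u => h u - h x) (Metric.ball x R) := by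
    rcases le_total r R with h | h
    · exact (local_deg_indep hc hi hr h hRΩ).symm
    · exact local_deg_indep hc hi hR h hrΩ
  have hsub : Metric.closedBall x' (R / 2) ⊆ Ω := by
    refine (Metric.closedBall_subset_closedBall' ?_).trans hRΩ
    linarith
  have e2 : deg (fun u => h u - h x') (Metric.ball x' r') =
      deg (fun u => h u - h x') (Metric.ball x' (R / 2)) := by
    rcases le_total r' (R / 2) with h | h
    · exact (local_deg_indep hc hi hr' h hsub).symm
    · exact local_deg_indep hc hi (half_pos hR) h hr'Ω
  rw [e1, e2]
  have e3 : deg (fun u => h u - h x) (Metric.ball x R) =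
      deg (fun u => h u - h x') (Metric.ball x R) := by
    refine deg_homotopy Metric.isOpen_ball Metric.isBounded_ball (hcf _) (hcf _) ?_
    intro τ hτ u hu h0
    have h2 := hml u hu
    have h3 : h u - h x = τ • (h x' - h x) := by
      rw [← sub_eq_zero, ← h0]
      simp only [smul_sub]; abel
    rw [h3, norm_smul, Real.norm_of_nonneg hτ.1, ← dist_eq_norm] at h2
    nlinarith [hτ.1, hτ.2, dist_nonneg (x := h x') (y := h x)]
  rw [e3]
  have hcl : closure (Metric.ball x R) ⊆ Ω := Metric.closure_ball_subset_closedBall.trans hRΩ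
  refine deg_excision Metric.isOpen_ball Metric.isBounded_ball Metric.isOpen_ball
    (Metric.ball_subset_ball' (by linarith)) ((hc.mono hcl).sub continuousOn_const)
    (fun u hu hu' h0 => hu' ?_)
  have := hi (hcl hu) (hsub (Metric.mem_closedBall_self (half_pos hR).le)) (sub_eq_zero.1 h0)
  rw [this]; exact Metric.mem_ball_self (half_pos hR)

theorem local_deg_one {h : E → E} {Ω W : Set E} (hΩ : IsOpen Ω) (hΩc : IsPreconnected Ω)
    (hc : ContinuousOn h Ω) (hi : Set.InjOn h Ω) (hW : IsOpen W) (hWΩ : W ⊆ Ω) (hWn : W.Nonempty)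
    (hid : ∀ x ∈ W, h x = x) {x : E} {r : ℝ} (hr : 0 < r) (hrΩ : Metric.closedBall x r ⊆ Ω) :
    deg (fun u => h u - h x) (Metric.ball x r) = 1 := by
  let P : E → Prop := fun x => ∀ r > 0, Metric.closedBall x r ⊆ Ω →
    deg (fun u => h u - h x) (Metric.ball x r) = 1
  have hball : ∀ x ∈ Ω, ∃ R > 0, Metric.closedBall x R ⊆ Ω := fun x hx =>
    Metric.nhds_basis_closedBall.mem_iff.1 (hΩ.mem_nhds hx)
  have hnear : ∀ x ∈ Ω, ∀ᶠ x' in 𝓝 x, x' ∈ Ω ∧ (P x ↔ P x') := by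
    intro x hx
    obtain ⟨R, hR, hRΩ⟩ := hball x hx
    filter_upwards [local_deg_near hc hi hR hRΩ, hΩ.mem_nhds hx] with x' h1 hx'
    obtain ⟨R', hR', hRΩ'⟩ := hball x' hx'
    refine ⟨hx', fun hP r' hr' hrΩ' => ?_, fun hP r hr hrΩ => ?_⟩
    · rw [← h1 R hR r' hr' hRΩ hrΩ']; exact hP R hR hRΩ
    · rw [h1 r hr R' hR' hrΩ hRΩ']; exact hP R' hR' hRΩ'
  have hsub := hΩc.subset_left_of_subset_union (u := {x | x ∈ Ω ∧ P x}) (v := {x | x ∈ Ω ∧ ¬ P x})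
    (isOpen_iff_mem_nhds.2 fun x hx => by
      filter_upwards [hnear x hx.1] with y hy using ⟨hy.1, hy.2.1 hx.2⟩)
    (isOpen_iff_mem_nhds.2 fun x hx => by
      filter_upwards [hnear x hx.1] with y hy using ⟨hy.1, fun h => hx.2 (hy.2.2 h)⟩)
    (Set.disjoint_left.2 fun x hx hx' => hx'.2 hx.2)
    (fun x hx => by by_cases h : P x; exacts [Or.inl ⟨hx, h⟩, Or.inr ⟨hx, h⟩]) ?_
  · exact (hsub (hrΩ (Metric.mem_closedBall_self hr.le))).2 r hr hrΩ
  · obtain ⟨w, hw⟩ := hWn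
    refine ⟨w, hWΩ hw, hWΩ hw, fun r hr hrΩ => ?_⟩
    obtain ⟨R, hR, hRW⟩ := Metric.nhds_basis_closedBall.mem_iff.1 (hW.mem_nhds hw)
    have hm : 0 < min r R := lt_min hr hR
    have hmW : Metric.closedBall w (min r R) ⊆ W :=
      (Metric.closedBall_subset_closedBall (min_le_right _ _)).trans hRW
    rw [local_deg_indep hc hi hm (min_le_left _ _) hrΩ,
      ← deg_sub_const Metric.isOpen_ball Metric.isBounded_ball (Metric.mem_ball_self hm (x := w))]
    have hsub : frontier (Metric.ball w (min r R)) ⊆ Metric.closedBall w (min r R) :=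
      frontier_subset_closure.trans Metric.closure_ball_subset_closedBall
    refine deg_congr Metric.isOpen_ball Metric.isBounded_ball
      ((hc.mono ((hsub.trans hmW).trans hWΩ)).sub continuousOn_const) (fun u hu => ?_) (fun u hu => ?_)
    · rw [hid w hw, hid u (hmW (hsub hu))]
      intro h0
      have hu' : dist u w = _ := Metric.frontier_ball_subset_sphere hu
      rw [sub_eq_zero.1 h0, dist_self] at hu'
      exact hm.ne hu'
    · rw [hid w hw, hid u (hmW (hsub hu))]

/-- approximating a continuous map by a smooth one with regular zeros. -/
theorem dg_approx_regular {K : Set E} (hK : IsCompact K) {f : E → E} (hf : ContinuousOn f K) {ε : ℝ}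
    (hε : 0 < ε) : ∃ g : E → E, ContDiff ℝ ∞ g ∧ (∀ x ∈ K, ‖g x - f x‖ < ε) ∧
      ∀ x, g x = 0 → (fderiv ℝ g x).det ≠ 0 := by
  obtain ⟨g, hg, hgf⟩ := dg_approx hK hf (half_pos hε)
  obtain ⟨c, hc, hgc⟩ := dg_sard hg (half_pos hε)
  refine ⟨fun x => g x - c, hg.sub contDiff_const, fun x hx => ?_, fun x hx => ?_⟩
  · have := hgf x hx
    calc ‖g x - c - f x‖ = ‖(g x - f x) - c‖ := by congr 1; abel
      _ ≤ ‖g x - f x‖ + ‖c‖ := norm_sub_le _ _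
      _ < ε := by linarith
  · have := hgc x (sub_eq_zero.1 hx)
    rwa [fderiv_sub_const]

theorem deg_close {f f' : E → E} {D : Set E} {m : ℝ} (hD : IsOpen D) (hDb : Bornology.IsBounded D)
    (hf : ContinuousOn f (frontier D)) (hf' : ContinuousOn f' (frontier D))
    (hm : ∀ x ∈ frontier D, m ≤ ‖f x‖) (hc : ∀ x ∈ frontier D, ‖f' x - f x‖ < m) :
    deg f D = deg f' D := by
  refine deg_homotopy hD hDb hf hf' fun τ hτ x hx h0 => ?_
  have h1 := hm x hx
  have h2 := hc x hx
  rw [eq_neg_of_add_eq_zero_left h0, norm_neg, norm_smul, Real.norm_of_nonneg hτ.1] at h1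
  nlinarith [hτ.1, hτ.2, norm_nonneg (f' x - f x)]

theorem deg_comp {h F : E → E} {Ω W B : Set E} (hΩ : IsOpen Ω) (hΩc : IsPreconnected Ω)
    (hc : ContinuousOn h Ω) (hi : Set.InjOn h Ω) (hW : IsOpen W) (hWΩ : W ⊆ Ω) (hWn : W.Nonempty)
    (hid : ∀ x ∈ W, h x = x) (hB : IsOpen B) (hBb : Bornology.IsBounded B) (hBΩ : closure B ⊆ Ω)
    (hhB : IsOpen (h '' B)) (hF : ContinuousOn F (h '' closure B))
    (hF0 : ∀ x ∈ frontier B, F (h x) ≠ 0) :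
    ∃ n : ℤ, deg (fun u => F (h u)) B = n ∧ deg F (h '' B) = n := by
  classical
  have hKc : IsCompact (h '' closure B) := hBb.isCompact_closure.image_of_continuousOn (hc.mono hBΩ)
  have hcl : closure (h '' B) ⊆ h '' closure B :=
    closure_minimal (Set.image_mono subset_closure) hKc.isClosed
  have hfr : frontier (h '' B) ⊆ h '' frontier B := by
    intro y hy
    rw [hhB.frontier_eq] at hy
    obtain ⟨x, hx, rfl⟩ := hcl hy.1
    refine ⟨x, ?_, rfl⟩
    rw [hB.frontier_eq]
    exact ⟨hx, fun h' => hy.2 ⟨x, h', rfl⟩⟩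
  have hhBb : Bornology.IsBounded (h '' B) := hKc.isBounded.subset (Set.image_mono subset_closure)
  have hFh : ContinuousOn (fun u => F (h u)) (closure B) :=
    hF.comp (hc.mono hBΩ) (Set.mapsTo_image _ _)
  obtain ⟨m, hm, hml⟩ := dg_lower (dg_frontier_compact hBb) (hFh.mono frontier_subset_closure) hF0
  obtain ⟨g, hg, hgF, hreg⟩ := dg_approx_regular hKc hF hm
  have e1 : deg (fun u => F (h u)) B = deg (fun u => g (h u)) B :=
    deg_close hB hBb (hFh.mono frontier_subset_closure)
      (hg.continuous.comp_continuousOn (hc.mono (frontier_subset_closure.trans hBΩ))) hml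
      (fun x hx => hgF _ ⟨x, frontier_subset_closure hx, rfl⟩)
  have e2 : deg F (h '' B) = deg g (h '' B) := by
    refine deg_close (m := m) hhB hhBb (hF.mono (frontier_subset_closure.trans hcl))
      hg.continuous.continuousOn (fun y hy => ?_) (fun y hy => ?_)
    · obtain ⟨x, hx, rfl⟩ := hfr hy
      exact hml x hx
    · exact hgF y (hcl (frontier_subset_closure hy))
  have hg0 : ∀ x ∈ closure B, g (h x) = 0 → x ∈ B := by
    intro x hx hx0
    by_contra hxB
    have hxf : x ∈ frontier B := by rw [hB.frontier_eq]; exact ⟨hx, hxB⟩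
    have h1 := hml x hxf
    have h2 := hgF _ ⟨x, hx, rfl⟩
    rw [hx0, zero_sub, norm_neg] at h2
    linarith
  have hfin := dg_finite_zeros hg hreg hKc
  have hinj : Set.InjOn h (h ⁻¹' {y ∈ h '' closure B | g y = 0} ∩ closure B) :=
    hi.mono (Set.inter_subset_right.trans hBΩ)
  have hfin' : (h ⁻¹' {y ∈ h '' closure B | g y = 0} ∩ closure B).Finite := by
    refine Set.Finite.of_finite_image (f := h) (hfin.subset ?_) hinj
    rintro _ ⟨x, hx, rfl⟩
    exact hx.1
  let S : Finset E := hfin'.toFinset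
  have hS : ∀ x, x ∈ S ↔ x ∈ closure B ∧ g (h x) = 0 := by
    intro x
    simp only [S, Set.Finite.mem_toFinset, Set.mem_inter_iff, Set.mem_preimage, Set.mem_setOf_eq]
    exact ⟨fun h => ⟨h.2, h.1.2⟩, fun h => ⟨⟨⟨x, h.1, rfl⟩, h.2⟩, h.1⟩⟩
  have hder : ∀ y, HasFDerivAt g (fderiv ℝ g y) y := fun y =>
    (hg.differentiable (by simp)).differentiableAt.hasFDerivAt
  have s1 : deg (fun u => g (h u)) B = ∑ x ∈ S, sg (fderiv ℝ g (h x)).det := by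
    refine deg_sum (fun x => sg (fderiv ℝ g (h x)).det) S hB hBb
      (hg.continuous.comp_continuousOn (hc.mono hBΩ))
      (fun x hx => hg0 x ((hS x).1 hx).1 ((hS x).1 hx).2)
      (fun x hx hx0 => (hS x).2 ⟨hx, hx0⟩) (fun x hx => ?_)
    obtain ⟨hxB, hx0⟩ := (hS x).1 hx
    obtain ⟨R, hR, hRΩ⟩ := Metric.nhds_basis_closedBall.mem_iff.1 (hΩ.mem_nhds (hBΩ hxB))
    filter_upwards [deg_lin hR hg.continuous (hder (h x)) hx0 (hreg _ hx0) (hc.mono hRΩ)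
      (hi.mono hRΩ), Ioo_mem_nhdsGT hR] with r hr hrR
    rw [hr, local_deg_one hΩ hΩc hc hi hW hWΩ hWn hid hrR.1
      ((Metric.closedBall_subset_closedBall hrR.2.le).trans hRΩ), mul_one]
  have s2 : deg g (h '' B) = ∑ y ∈ S.image h, sg (fderiv ℝ g y).det := by
    refine deg_sum (fun x => sg (fderiv ℝ g x).det) (S.image h) hhB hhBb hg.continuous.continuousOn
      (fun y hy => ?_) (fun y hy hy0 => ?_) (fun y hy => ?_)
    · obtain ⟨x, hx, rfl⟩ := Finset.mem_image.1 hy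
      exact ⟨x, hg0 x ((hS x).1 hx).1 ((hS x).1 hx).2, rfl⟩
    · obtain ⟨x, hx, rfl⟩ := hcl hy
      exact Finset.mem_image.2 ⟨x, (hS x).2 ⟨hx, hy0⟩, rfl⟩
    · obtain ⟨x, hx, rfl⟩ := Finset.mem_image.1 hy
      have hx0 := ((hS x).1 hx).2
      filter_upwards [deg_lin (h := fun u => u) one_pos hg.continuous (hder (h x)) hx0
        (hreg _ hx0) continuousOn_id Function.injective_id.injOn, self_mem_nhdsWithin] with r hr hr0
      rw [hr, deg_sub_const Metric.isOpen_ball Metric.isBounded_ball (Metric.mem_ball_self hr0),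
        mul_one]
  refine ⟨∑ x ∈ S, (SignType.sign (fderiv ℝ g (h x)).det : ℤ), ?_, ?_⟩
  · rw [e1, s1]; push_cast; rfl
  · rw [e2, s2, Finset.sum_image (hi.mono fun x hx => hBΩ ((hS x).1 hx).1)]; push_cast; rfl

end DegreeE

open MeasureTheory Topology Filter
set_option linter.unusedSectionVars false

section PartB
variable {X : Type*} [MetricSpace X]

theorem cat_ball_mid (hX : IsCAT0 X) {u c y m : X} {r : ℝ} (hc : dist c u ≤ r)
    (hy : dist y u ≤ r) (h1 : dist c m = dist c y / 2) (h2 : dist m y = dist c y / 2) :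
    dist m u ≤ r := by
  have h := hX.2 u c y m h1 h2
  rw [dist_comm] at hc hy
  rw [dist_comm]
  have hr : 0 ≤ r := dist_nonneg.trans hc
  refine abs_le_of_sq_le_sq' ?_ hr |>.2
  nlinarith [sq_nonneg (dist c y), dist_nonneg (x := u) (y := c), dist_nonneg (x := u) (y := y)]

/-- the radius function of the orbit. -/
noncomputable def orbRad (H : Subgroup (X ≃ᵢ X)) (u y : X) : ℝ := ⨆ h : H, dist y ((h : X ≃ᵢ X) u)

variable {H : Subgroup (X ≃ᵢ X)}

theorem orbRad_bdd {u : X} {ε : ℝ} (hu : ∀ h ∈ H, dist (h u) u ≤ ε) (y : X) :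
    BddAbove (Set.range fun h : H => dist y ((h : X ≃ᵢ X) u)) := by
  refine ⟨dist y u + ε, ?_⟩
  rintro _ ⟨h, rfl⟩
  have := dist_triangle_right y ((h : X ≃ᵢ X) u) u
  have := hu h h.2
  linarith

theorem le_orbRad {u : X} {ε : ℝ} (hu : ∀ h ∈ H, dist (h u) u ≤ ε) (y : X) {h : X ≃ᵢ X}
    (hh : h ∈ H) : dist y (h u) ≤ orbRad H u y :=
  le_ciSup (orbRad_bdd hu y) ⟨h, hh⟩

theorem orbRad_le {u y : X} {r : ℝ} (hr : ∀ h ∈ H, dist y (h u) ≤ r) : orbRad H u y ≤ r :=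
  ciSup_le fun h => hr h h.2

theorem orbRad_nonneg (u y : X) : 0 ≤ orbRad H u y := Real.iSup_nonneg fun _ => dist_nonneg

theorem orbRad_lip {u : X} {ε : ℝ} (hu : ∀ h ∈ H, dist (h u) u ≤ ε) (y y' : X) :
    orbRad H u y ≤ orbRad H u y' + dist y y' := by
  refine orbRad_le fun h hh => ?_
  have := le_orbRad hu y' hh
  have := dist_triangle y y' (h u)
  linarith

theorem orbRad_lip' {u u' : X} {ε : ℝ} (hu : ∀ h ∈ H, dist (h u) u ≤ ε) (y : X) :
    orbRad H u' y ≤ orbRad H u y + dist u u' := by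
  refine orbRad_le fun h hh => ?_
  have := le_orbRad hu y hh
  have h1 := dist_triangle y (h u) (h u')
  rw [h.dist_eq] at h1
  linarith

theorem circumcenter (hX : IsCAT0 X) {u : X} {ε : ℝ} (hε : 0 < ε)
    (hu : ∀ h ∈ H, dist (h u) u ≤ ε) (hK : IsCompact (Metric.closedBall u (2 * ε))) :
    ∃ c : X, orbRad H u c ≤ ε ∧ (∀ y, dist y u ≤ 2 * ε → orbRad H u c ≤ orbRad H u y) ∧
      ∀ y, dist y u ≤ 2 * ε → dist c y ^ 2 ≤ 2 * (orbRad H u y ^ 2 - orbRad H u c ^ 2) := by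
  have hcont : Continuous (orbRad H u) := by
    refine (LipschitzWith.of_le_add fun y y' => ?_).continuous (K := 1)
    exact orbRad_lip hu y y'
  obtain ⟨c, hc, hmin⟩ := hK.exists_isMinOn ⟨u, Metric.mem_closedBall_self (by positivity)⟩
    hcont.continuousOn
  have hmin' : ∀ y, dist y u ≤ 2 * ε → orbRad H u c ≤ orbRad H u y := fun y hy => hmin hy
  refine ⟨c, ?_, hmin', fun y hy => ?_⟩
  · refine (hmin' u (by simp; positivity)).trans (orbRad_le fun h hh => ?_)
    rw [dist_comm]; exact hu h hh
  · obtain ⟨m, h1, h2⟩ := hX.1 c y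
    have hm := hmin' m (cat_ball_mid hX hc hy h1 h2)
    have h3 : orbRad H u m ≤ Real.sqrt ((orbRad H u c ^ 2 + orbRad H u y ^ 2) / 2 -
        dist c y ^ 2 / 4) := by
      refine orbRad_le fun h hh => Real.le_sqrt_of_sq_le ?_
      have h4 := hX.2 (h u) c y m h1 h2
      have h5 := le_orbRad hu c hh
      have h6 := le_orbRad hu y hh
      rw [dist_comm] at h5 h6
      rw [dist_comm]
      nlinarith [dist_nonneg (x := h u) (y := c), dist_nonneg (x := h u) (y := y)]
    have h4 := hm.trans h3
    by_cases hneg : 0 ≤ (orbRad H u c ^ 2 + orbRad H u y ^ 2) / 2 - dist c y ^ 2 / 4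
    · have := (Real.le_sqrt (orbRad_nonneg u c) hneg).1 h4
      linarith
    · push Not at hneg
      rw [Real.sqrt_eq_zero_of_nonpos hneg.le] at h4
      have hc0 : orbRad H u c = 0 := le_antisymm h4 (orbRad_nonneg u c)
      have e1 := le_orbRad hu c H.one_mem
      have h5 := h3
      rw [Real.sqrt_eq_zero_of_nonpos hneg.le] at h5
      have e2 := (le_orbRad hu m H.one_mem).trans h5
      have e3 : c = m := by
        rw [hc0] at e1
        have := dist_triangle_right c m ((1 : X ≃ᵢ X) u)
        exact dist_le_zero.1 (by linarith)
      rw [e3, dist_self] at h1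
      rw [e3, ← e3]
      have : dist c y = 0 := by rw [e3] at *; linarith
      rw [this, hc0]; nlinarith [orbRad_nonneg (H := H) u y]

theorem circumcenter_map (hX : IsCAT0 X) {Z : Set X} {ε : ℝ} (hε : 0 < ε)
    (hu : ∀ u ∈ Z, ∀ h ∈ H, dist (h u) u ≤ ε)
    (hK : ∀ u ∈ Z, IsCompact (Metric.closedBall u (2 * ε))) :
    ∃ c : X → X, ContinuousOn c Z ∧ ∀ u ∈ Z, dist (c u) u ≤ ε ∧ ∀ h ∈ H, h (c u) = c u := by
  choose! c hc1 hc2 hc3 using fun u (hZ : u ∈ Z) => circumcenter hX hε (hu u hZ) (hK u hZ)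
  have hcd : ∀ u ∈ Z, dist (c u) u ≤ ε := fun u hZ =>
    (le_orbRad (hu u hZ) (c u) H.one_mem).trans (hc1 u hZ)
  refine ⟨c, ?_, fun u hZ => ⟨hcd u hZ, fun h hh => ?_⟩⟩
  · intro u hZ
    rw [ContinuousWithinAt, tendsto_iff_dist_tendsto_zero]
    have hlim : Tendsto (fun u' => Real.sqrt (16 * ε * dist u u')) (𝓝[Z] u) (𝓝 0) := by
      have : Continuous fun u' => Real.sqrt (16 * ε * dist u u') := by fun_prop
      have h2 := this.tendsto u
      simp only [dist_self, mul_zero, Real.sqrt_zero] at h2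
      exact h2.mono_left nhdsWithin_le_nhds
    refine squeeze_zero' (Eventually.of_forall fun _ => dist_nonneg) ?_ hlim
    have hev : ∀ᶠ u' in 𝓝[Z] u, dist u' u < ε :=
      nhdsWithin_le_nhds (Metric.ball_mem_nhds u hε)
    filter_upwards [hev, self_mem_nhdsWithin] with u' hd hZ'
    refine Real.le_sqrt_of_sq_le ?_
    have d1 : dist (c u') u ≤ 2 * ε := by
      have := dist_triangle (c u') u' u
      have := hcd u' hZ'
      linarith
    have d2 : dist (c u) u' ≤ 2 * ε := by
      have := dist_triangle_right (c u) u' u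
      have := hcd u hZ
      linarith
    have h1 := hc3 u hZ (c u') d1
    have h2 := orbRad_lip' (u' := u) (hu u' hZ') (c u')
    have h3 := hc2 u' hZ' (c u) d2
    have h4 := orbRad_lip' (u' := u') (hu u hZ) (c u)
    have h5 := hc1 u hZ
    have h6 := orbRad_nonneg (H := H) u (c u)
    have h7 := orbRad_nonneg (H := H) u (c u')
    rw [dist_comm u' u] at h2
    rw [dist_comm u' u] at hd
    rw [dist_comm]
    have h8 : orbRad H u (c u') ≤ orbRad H u (c u) + 2 * dist u u' := by linarith
    have h9 : orbRad H u (c u') ^ 2 ≤ (orbRad H u (c u) + 2 * dist u u') ^ 2 := by gcongr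
    nlinarith [dist_nonneg (x := u) (y := u')]
  · have e : orbRad H u (h (c u)) ≤ orbRad H u (c u) := by
      refine orbRad_le fun k hk => ?_
      have := le_orbRad (hu u hZ) (c u) (H.mul_mem (H.inv_mem hh) hk)
      rw [← h.dist_eq] at this
      simpa using this
    have d : dist (h (c u)) u ≤ 2 * ε := by
      have h1 := (le_orbRad (hu u hZ) (h (c u)) H.one_mem).trans (e.trans (hc1 u hZ))
      have h2 : dist (h (c u)) u ≤ ε := h1
      linarith
    have h3 := hc3 u hZ _ d
    have h4 : orbRad H u (h (c u)) ^ 2 ≤ orbRad H u (c u) ^ 2 := by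
      have := orbRad_nonneg (H := H) u (h (c u))
      gcongr
    have h5 : dist (c u) (h (c u)) ^ 2 ≤ 0 := by linarith
    have h6 : dist (c u) (h (c u)) = 0 := by
      nlinarith [dist_nonneg (x := c u) (y := h (c u))]
    exact (dist_eq_zero.1 h6).symm

theorem continuousOn_invFunOn_compact {α β : Type*} [TopologicalSpace α] [TopologicalSpace β]
    [T2Space β] [Nonempty α] {K : Set α} (hK : IsCompact K) {f : α → β} (hf : ContinuousOn f K)
    (hi : Set.InjOn f K) : ContinuousOn (Function.invFunOn f K) (f '' K) := by
  rw [continuousOn_iff_isClosed]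
  intro t ht
  refine ⟨f '' (K ∩ t), ((hK.inter_right ht).image_of_continuousOn
    (hf.mono Set.inter_subset_left)).isClosed, ?_⟩
  ext y
  constructor
  · rintro ⟨h1, h2⟩
    exact ⟨⟨_, ⟨Function.invFunOn_mem h2, h1⟩, Function.invFunOn_eq h2⟩, h2⟩
  · rintro ⟨⟨x, ⟨hx, hxt⟩, rfl⟩, h2⟩
    refine ⟨?_, h2⟩
    change Function.invFunOn f K (f x) ∈ t
    rwa [hi.leftInvOn_invFunOn hx]

variable {E : Type*} [NormedAddCommGroup E] [InnerProductSpace ℝ E] [FiniteDimensional ℝ E]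

theorem small_group_fix (hX : IsCAT0 X) {x : X} {s : ℝ} (hs : 0 < s)
    (hK : IsCompact (Metric.closedBall x s)) {φ : X → E}
    (hφ : ContinuousOn φ (Metric.closedBall x s)) (hφi : Set.InjOn φ (Metric.closedBall x s))
    (hφn : φ '' Metric.closedBall x (s / 2) ∈ 𝓝 (φ x)) :
    ∃ ε > 0, ∃ O ∈ 𝓝 x, ∀ H : Subgroup (X ≃ᵢ X),
      (∀ h ∈ H, ∀ u ∈ Metric.closedBall x s, dist (h u) u ≤ ε) → ∀ h ∈ H, ∀ u ∈ O, h u = u := by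
  letI : MeasurableSpace E := borel E
  haveI : BorelSpace E := ⟨rfl⟩
  haveI : Nonempty X := ⟨x⟩
  obtain ⟨τ, hτ, hτs⟩ := Metric.nhds_basis_closedBall.mem_iff.1 hφn
  obtain ⟨ε₀, hε₀, hunif⟩ := Metric.uniformContinuousOn_iff.1
    (hK.uniformContinuousOn_of_continuous hφ) (τ / 2) (half_pos hτ)
  have hhalf : Metric.closedBall x (s / 2) ⊆ Metric.closedBall x s :=
    Metric.closedBall_subset_closedBall (by linarith)
  refine ⟨min (ε₀ / 2) (s / 8), by positivity,
    Metric.closedBall x s ∩ φ ⁻¹' Metric.ball (φ x) (τ / 2), ?_, ?_⟩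
  · exact inter_mem (Metric.closedBall_mem_nhds x hs)
      ((hφ.continuousAt (Metric.closedBall_mem_nhds x hs)).preimage_mem_nhds
        (Metric.ball_mem_nhds _ (half_pos hτ)))
  intro H hH
  set ε := min (ε₀ / 2) (s / 8) with hεd
  have hε : 0 < ε := by positivity
  have hε1 : ε < ε₀ := (min_le_left _ _).trans_lt (by linarith)
  have hε2 : ε ≤ s / 8 := min_le_right _ _
  obtain ⟨c, hcc, hc⟩ := circumcenter_map (H := H) hX (Z := Metric.closedBall x (s / 2)) hε
    (fun u hu h hh => hH h hh u (hhalf hu)) (fun u hu => by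
      refine hK.of_isClosed_subset Metric.isClosed_closedBall
        (Metric.closedBall_subset_closedBall' ?_)
      have : dist u x ≤ s / 2 := hu
      linarith)
  set ψ := Function.invFunOn φ (Metric.closedBall x s) with hψd
  have hψc := continuousOn_invFunOn_compact hK hφ hφi
  have hψl := hφi.leftInvOn_invFunOn
  have hψs : ∀ w ∈ Metric.closedBall (φ x) τ, ψ w ∈ Metric.closedBall x (s / 2) ∧ φ (ψ w) = w := by
    intro w hw
    obtain ⟨u, hu, rfl⟩ := hτs hw
    have : ψ (φ u) = u := hψl (hhalf hu)
    rw [this]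
    exact ⟨hu, rfl⟩
  have hcs : ∀ u ∈ Metric.closedBall x (s / 2), c u ∈ Metric.closedBall x s := by
    intro u hu
    have h1 := (hc u hu).1
    have h2 : dist u x ≤ s / 2 := hu
    have h3 := dist_triangle (c u) u x
    rw [Metric.mem_closedBall]
    linarith
  have hfc : ContinuousOn (fun w => φ (c (ψ w))) (Metric.closedBall (φ x) τ) := by
    refine hφ.comp (hcc.comp (hψc.mono fun w hw => ?_) fun w hw => (hψs w hw).1)
      fun w hw => hcs _ (hψs w hw).1
    exact Set.image_mono hhalf (hτs hw)
  have hfd : ∀ w ∈ Metric.closedBall (φ x) τ, ‖φ (c (ψ w)) - w‖ < τ / 2 := by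
    intro w hw
    obtain ⟨h1, h2⟩ := hψs w hw
    have := hunif (c (ψ w)) (hcs _ h1) (ψ w) (hhalf h1) ((hc _ h1).1.trans_lt hε1)
    rwa [h2, dist_eq_norm] at this
  intro h hh u hu
  have hsub : closure (Metric.ball (φ x) τ) ⊆ Metric.closedBall (φ x) τ :=
    Metric.closure_ball_subset_closedBall
  have hcl : ContinuousOn (fun w => φ (c (ψ w)) - φ u) (closure (Metric.ball (φ x) τ)) :=
    (hfc.mono hsub).sub continuousOn_const
  have hdeg : deg (fun w => φ (c (ψ w)) - φ u) (Metric.ball (φ x) τ) = 1 := by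
    have hu2 : φ u ∈ Metric.ball (φ x) (τ / 2) := hu.2
    rw [← deg_sub_const Metric.isOpen_ball Metric.isBounded_ball
      (Metric.ball_subset_ball (by linarith) hu2 : φ u ∈ Metric.ball (φ x) τ)]
    symm
    refine deg_close (m := τ / 2) Metric.isOpen_ball Metric.isBounded_ball
      (continuous_id.sub continuous_const).continuousOn (hcl.mono frontier_subset_closure)
      (fun w hw => ?_) (fun w hw => ?_)
    · have h1 : dist w (φ x) = τ := Metric.frontier_ball_subset_sphere hw
      have h2 := dist_triangle w (φ u) (φ x)
      rw [Metric.mem_ball] at hu2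
      change τ / 2 ≤ ‖w - φ u‖
      rw [← dist_eq_norm]
      linarith
    · rw [sub_sub_sub_cancel_right]
      exact hfd w (hsub (frontier_subset_closure hw))
  obtain ⟨w, hw, hw0⟩ := deg_exists_zero Metric.isOpen_ball Metric.isBounded_ball hcl
    (by rw [hdeg]; exact one_ne_zero)
  have h1 := (hψs w (hsub hw)).1
  have : c (ψ w) = u := hφi (hcs _ h1) hu.1 (sub_eq_zero.1 hw0)
  rw [← this]
  exact (hc _ h1).2 h hh

end PartB

open MeasureTheory Topology Filter
open scoped ContDiff
set_option linter.unusedSectionVars false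

section PartC
variable {E : Type*} [NormedAddCommGroup E] [InnerProductSpace ℝ E] [FiniteDimensional ℝ E]
  [MeasurableSpace E] [BorelSpace E]

/-- periodic homeomorphism of a connected open set which is the identity somewhere. -/
structure PerMap (t : E → E) (Ω W : Set E) (p : ℕ) : Prop where
  isOpen : IsOpen Ω
  conn : IsPreconnected Ω
  cont : ContinuousOn t Ω
  maps : Set.MapsTo t Ω Ω
  per : ∀ x ∈ Ω, t^[p] x = x
  pos : 0 < p
  openW : IsOpen W
  subW : W ⊆ Ω
  neW : W.Nonempty
  idW : ∀ x ∈ W, t x = x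

variable {t : E → E} {Ω W : Set E} {p : ℕ}

theorem PerMap.maps_iter (T : PerMap t Ω W p) (j : ℕ) : Set.MapsTo t^[j] Ω Ω := T.maps.iterate j

theorem PerMap.cont_iter (T : PerMap t Ω W p) (j : ℕ) : ContinuousOn t^[j] Ω :=
  T.cont.iterate T.maps j

theorem PerMap.inj (T : PerMap t Ω W p) (j : ℕ) : Set.InjOn t^[j] Ω := by
  have h1 : Set.InjOn t Ω := by
    intro x hx y hy h
    rw [← T.per x hx, ← T.per y hy]
    obtain ⟨k, hk⟩ := Nat.exists_eq_succ_of_ne_zero T.pos.ne'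
    rw [hk, Function.iterate_succ_apply, Function.iterate_succ_apply, h]
  induction j with
  | zero => exact Set.injOn_id Ω
  | succ j ih => 
    rw [Function.iterate_succ]
    exact ih.comp h1 T.maps

theorem PerMap.iter_id (T : PerMap t Ω W p) (j : ℕ) : ∀ x ∈ W, t^[j] x = x := fun x hx =>
  Function.iterate_fixed (T.idW x hx) j

theorem PerMap.iter_mod (T : PerMap t Ω W p) {x : E} (hx : x ∈ Ω) (j : ℕ) :
    t^[j % p] x = t^[j] x := by
  have : Function.IsPeriodicPt t p x := T.per x hx
  exact this.iterate_mod_apply j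

theorem deg_iUnion {ι : Type*} {f : E → E} (V : ι → Set E) (S : Finset ι) :
    ∀ {D : Set E} (_ : IsOpen D) (_ : Bornology.IsBounded D) (_ : ContinuousOn f (closure D))
    (_ : ∀ i ∈ S, IsOpen (V i)) (_ : ∀ i ∈ S, V i ⊆ D)
    (_ : ∀ i ∈ S, ∀ j ∈ S, i ≠ j → Disjoint (V i) (V j))
    (_ : ∀ x ∈ closure D, f x = 0 → ∃ i ∈ S, x ∈ V i), deg f D = ∑ i ∈ S, deg f (V i) := by
  classical
  induction S using Finset.induction_on with
  | empty =>
    intro D hD hDb hf _ _ _ h0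
    simp only [Finset.sum_empty]
    by_contra h
    obtain ⟨x, hx, hx0⟩ := deg_exists_zero hD hDb hf h
    simpa using h0 x hx hx0
  | insert a S ha ih =>
    intro D hD hDb hf ho hsub hdis h0
    rw [Finset.sum_insert ha]
    have hD' : IsOpen (⋃ i ∈ S, V i) := isOpen_biUnion fun i hi => ho i (Finset.mem_insert_of_mem hi)
    have hD's : (⋃ i ∈ S, V i) ⊆ D := Set.iUnion₂_subset fun i hi => hsub i (by simp [hi])
    have hd : Disjoint (V a) (⋃ i ∈ S, V i) := by
      rw [Set.disjoint_iUnion₂_right]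
      intro i hi
      exact hdis a (by simp) i (by simp [hi]) (fun h => ha (h ▸ hi))
    rw [deg_add hD hDb (ho a (by simp)) hD' (hsub a (by simp)) hD's hd hf]
    · congr 1
      refine ih hD' (hDb.subset hD's) (hf.mono (closure_mono hD's)) (fun i hi => ho i (by simp [hi]))
        (fun i hi => Set.subset_biUnion_of_mem (u := V) hi)
        (fun i hi j hj => hdis i (by simp [hi]) j (by simp [hj])) (fun x hx hx0 => ?_)
      obtain ⟨i, hi, hxi⟩ := h0 x (closure_mono hD's hx) hx0
      rcases Finset.mem_insert.1 hi with rfl | hi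
      · exfalso
        exact Set.disjoint_left.1 (hd.closure_right (ho i (by simp))) hxi hx
      · exact ⟨i, hi, hxi⟩
    · intro x hx h1 h2 hx0
      obtain ⟨i, hi, hxi⟩ := h0 x hx hx0
      rcases Finset.mem_insert.1 hi with rfl | hi
      · exact h1 hxi
      · exact h2 (Set.mem_biUnion (t := V) hi hxi)

theorem dg_approx_sphere {K : Set E} (hK : IsCompact K) {f : E → E} (hf : ContinuousOn f K) {ε : ℝ}
    (hε : 0 < ε) (a : E) {r : ℝ} (hr : 0 < r) : ∃ g : E → E, Continuous g ∧
      (∀ x ∈ K, ‖g x - f x‖ < ε) ∧ ∀ x ∈ Metric.sphere a r, g x ≠ 0 := by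
  obtain ⟨g, hg, hgf⟩ := dg_approx hK hf (half_pos hε)
  have h0 : volume (g '' Metric.sphere a r) = 0 :=
    addHaar_image_eq_zero_of_differentiableOn_of_addHaar_eq_zero volume
      (hg.differentiable (by simp)).differentiableOn
      (Measure.addHaar_sphere_of_ne_zero volume a hr.ne')
  have h1 : ¬ Metric.ball (0 : E) (ε / 2) ⊆ g '' Metric.sphere a r := fun h =>
    (Metric.measure_ball_pos (volume : Measure E) 0 (half_pos hε)).ne' (measure_mono_null h h0)
  obtain ⟨c, hc, hc'⟩ := Set.not_subset.1 h1
  refine ⟨fun x => g x - c, hg.continuous.sub continuous_const, fun x hx => ?_, fun x hx h => ?_⟩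
  · have := hgf x hx
    have hc2 : ‖c‖ < ε / 2 := by simpa using hc
    calc ‖g x - c - f x‖ = ‖(g x - f x) - c‖ := by congr 1; abel
      _ ≤ ‖g x - f x‖ + ‖c‖ := norm_sub_le _ _
      _ < ε := by linarith
  · exact hc' ⟨x, hx, sub_eq_zero.1 h⟩

/-- the cutoff -/
noncomputable def cutL (a : E) (r : ℝ) (x : E) : ℝ := max 0 (min 1 (2 - ‖x - a‖ / r))

theorem cutL_cont (a : E) (r : ℝ) : Continuous (cutL a r) := by
  unfold cutL; fun_prop

theorem cutL_one {a : E} {r : ℝ} (hr : 0 < r) {x : E} (hx : ‖x - a‖ = r) : cutL a r x = 1 := by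
  unfold cutL; rw [hx, div_self hr.ne']; norm_num

theorem cutL_zero {a : E} {r : ℝ} (hr : 0 < r) {x : E} (hx : 2 * r ≤ ‖x - a‖) : cutL a r x = 0 := by
  unfold cutL
  have : 2 ≤ ‖x - a‖ / r := by rw [le_div_iff₀ hr]; exact hx
  exact max_eq_left ((min_le_right _ _).trans (by linarith))

theorem cutL_nonneg (a : E) (r : ℝ) (x : E) : 0 ≤ cutL a r x := le_max_left _ _
theorem cutL_le (a : E) (r : ℝ) (x : E) : cutL a r x ≤ 1 := max_le zero_le_one (min_le_left _ _)

theorem newman_perturb (T : PerMap t Ω W p) {D : Set E} {f : E → E} (hDb : Bornology.IsBounded D)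
    (hDΩ : closure D ⊆ Ω) (hDt : Set.MapsTo t (closure D) (closure D))
    (hf : ContinuousOn f (closure D))
    (hft : ∀ x ∈ closure D, f (t x) = f x) {a : E} {r δ : ℝ} (hr : 0 < r) (hδ : 0 < δ)
    (hdis : ∀ x ∈ Metric.closedBall a (2 * r), ∀ j, 0 < j → j < p →
      t^[j] x ∉ Metric.closedBall a (2 * r)) :
    ∃ f' : E → E, ContinuousOn f' (closure D) ∧ (∀ x ∈ closure D, f' (t x) = f' x) ∧
      (∀ x ∈ closure D, ‖f' x - f x‖ < δ) ∧ ∀ x ∈ closure D, x ∈ Metric.sphere a r → f' x ≠ 0 := by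
  have hp : (0 : ℝ) < p := by exact_mod_cast T.pos
  obtain ⟨h, hh, hhf, hh0⟩ := dg_approx_sphere hDb.isCompact_closure hf
    (show (0 : ℝ) < δ / (p + 1) by positivity) a hr
  have hiter : ∀ j, Set.MapsTo t^[j] (closure D) (closure D) := fun j => hDt.iterate j
  have hitc : ∀ j, ContinuousOn t^[j] (closure D) := fun j => (T.cont_iter j).mono hDΩ
  let e : E → E := fun x => cutL a r x • (h x - f x)
  have hec : ContinuousOn e (closure D) :=
    (cutL_cont a r).continuousOn.smul (hh.continuousOn.sub hf)
  have hen : ∀ x ∈ closure D, ‖e x‖ ≤ δ / (p + 1) := by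
    intro x hx
    simp only [e]
    rw [norm_smul, Real.norm_of_nonneg (cutL_nonneg _ _ _)]
    calc cutL a r x * ‖h x - f x‖ ≤ 1 * (δ / (p + 1)) := by
          gcongr
          · exact cutL_le _ _ _
          · exact (hhf x hx).le
      _ = _ := one_mul _
  refine ⟨fun x => f x + ∑ j ∈ Finset.range p, e (t^[j] x), ?_, ?_, ?_, ?_⟩
  · refine hf.add (continuousOn_finsetSum _ fun j _ => hec.comp (hitc j) (hiter j))
  · intro x hx
    simp only
    rw [hft x hx]
    congr 1
    simp only [← Function.iterate_succ_apply]
    have h1 := Finset.sum_range_succ (fun j => e (t^[j] x)) p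
    have h2 := Finset.sum_range_succ' (fun j => e (t^[j] x)) p
    rw [T.per x (hDΩ hx)] at h1
    rw [h1] at h2
    simpa using h2.symm
  · intro x hx
    simp only [add_sub_cancel_left]
    calc ‖∑ j ∈ Finset.range p, e (t^[j] x)‖ ≤ ∑ j ∈ Finset.range p, δ / (p + 1) :=
          norm_sum_le_of_le _ fun j _ => hen _ (hiter j hx)
      _ = p * (δ / (p + 1)) := by simp
      _ < δ := by
        rw [mul_div_assoc', div_lt_iff₀ (by positivity)]
        nlinarith
  · intro x hx hxs
    have hxs' : ‖x - a‖ = r := by rw [← dist_eq_norm]; exact hxs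
    have hxc : x ∈ Metric.closedBall a (2 * r) := by
      rw [Metric.mem_closedBall, dist_eq_norm, hxs']; linarith
    have h1 : ∑ j ∈ Finset.range p, e (t^[j] x) = e (t^[0] x) := by
      refine Finset.sum_eq_single 0 (fun j hj hj0 => ?_) (fun h => ?_)
      · have := hdis x hxc j (Nat.pos_of_ne_zero hj0) (Finset.mem_range.1 hj)
        rw [Metric.mem_closedBall, dist_eq_norm, not_le] at this
        simp only [e]
        rw [cutL_zero hr this.le, zero_smul]
      · exact absurd (Finset.mem_range.2 T.pos) h
    simp only [h1, Function.iterate_zero, id, e]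
    rw [cutL_one hr hxs', one_smul, add_sub_cancel]
    exact hh0 x hxs

theorem newman_div (T : PerMap t Ω W p) (r : E → ℝ) (S : Finset E) :
    ∀ {D : Set E} {f : E → E} (_ : IsOpen D) (_ : Bornology.IsBounded D) (_ : closure D ⊆ Ω)
    (_ : Set.MapsTo t D D) (_ : ContinuousOn f (closure D))
    (_ : ∀ x ∈ closure D, f (t x) = f x)
    (_ : ∀ a ∈ S, 0 < r a ∧ ∀ x ∈ Metric.closedBall a (2 * r a), ∀ j, 0 < j → j < p →
      t^[j] x ∉ Metric.closedBall a (2 * r a))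
    (_ : ∀ x ∈ closure D, f x = 0 → x ∈ D ∧ ∃ a ∈ S, ∃ j, t^[j] x ∈ Metric.ball a (r a)),
    ∃ n : ℤ, deg f D = p * n := by
  classical
  induction S using Finset.induction_on with
  | empty =>
    intro D f hD hDb hDΩ hDt hf hft _ h0
    refine ⟨0, ?_⟩
    simp only [Int.cast_zero, mul_zero]
    by_contra h
    obtain ⟨x, hx, hx0⟩ := deg_exists_zero hD hDb hf h
    simpa using h0 x hx hx0
  | insert a S ha ih =>
    intro D f hD hDb hDΩ hDt hf hft hball h0
    have hclt : Set.MapsTo t (closure D) (closure D) :=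
      hDt.closure_of_continuousOn (T.cont.mono hDΩ)
    have hDsub : D ⊆ Ω := subset_closure.trans hDΩ
    obtain ⟨hr, hdis⟩ := hball a (by simp)
    -- the open set containing zeros
    let V : Set E := D ∩ ⋃ b ∈ insert a S, ⋃ j ∈ Finset.range p, (Ω ∩ t^[j] ⁻¹' Metric.ball b (r b))
    have hVo : IsOpen V := hD.inter (isOpen_biUnion fun b _ => isOpen_biUnion fun j _ =>
      (T.cont_iter j).isOpen_inter_preimage T.isOpen Metric.isOpen_ball)
    have hVz : ∀ x ∈ closure D, f x = 0 → x ∈ V := by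
      intro x hx hx0
      obtain ⟨hxD, b, hb, j, hj⟩ := h0 x hx hx0
      refine ⟨hxD, Set.mem_biUnion hb (Set.mem_biUnion (x := j % p)
        (Finset.mem_coe.2 (Finset.mem_range.2 (Nat.mod_lt _ T.pos))) ⟨hDsub hxD, ?_⟩)⟩
      rw [Set.mem_preimage]
      rwa [T.iter_mod (hDsub hxD)]
    obtain ⟨δ, hδ, hδl⟩ := dg_lower (hDb.isCompact_closure.diff hVo) (hf.mono Set.sdiff_subset)
      (fun x hx hx0 => hx.2 (hVz x hx.1 hx0))
    obtain ⟨f', hf'c, hf't, hf'f, hf's⟩ := newman_perturb T hDb hDΩ hclt hf hft hr hδ hdis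
    have hfrV : ∀ x ∈ frontier D, x ∈ closure D \ V := fun x hx =>
      ⟨frontier_subset_closure hx, fun h => by rw [hD.frontier_eq] at hx; exact hx.2 h.1⟩
    rw [deg_close hD hDb (hf.mono frontier_subset_closure) (hf'c.mono frontier_subset_closure)
      (fun x hx => hδl x (hfrV x hx)) (fun x hx => hf'f x (frontier_subset_closure hx))]
    have hz' : ∀ x ∈ closure D, f' x = 0 → x ∈ V := by
      intro x hx hx0
      by_contra hxV
      have h1 := hδl x ⟨hx, hxV⟩
      have h2 := hf'f x hx
      rw [hx0, zero_sub, norm_neg] at h2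
      linarith
    have hf'i : ∀ j, ∀ x ∈ closure D, f' (t^[j] x) = f' x := by
      intro j
      induction j with
      | zero => intro x _; rfl
      | succ j ihj =>
        intro x hx
        rw [Function.iterate_succ_apply, ihj _ (hclt hx), hf't x hx]
    have hDi : ∀ j, Set.MapsTo t^[j] D D := fun j => hDt.iterate j
    have hcli : ∀ j, Set.MapsTo t^[j] (closure D) (closure D) := fun j => hclt.iterate j
    -- pieces
    let B0 : Set E := D ∩ Metric.ball a (r a)
    have hB0 : IsOpen B0 := hD.inter Metric.isOpen_ball
    have hB0D : closure B0 ⊆ closure D := closure_mono Set.inter_subset_left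
    have himg : ∀ j, j ≤ p → t^[j] '' B0 = D ∩ t^[p - j] ⁻¹' Metric.ball a (r a) := by
      intro j hj
      ext y
      constructor
      · rintro ⟨x, hx, rfl⟩
        refine ⟨hDi j hx.1, ?_⟩
        rw [Set.mem_preimage, ← Function.iterate_add_apply, Nat.sub_add_cancel hj, T.per x (hDsub hx.1)]
        exact hx.2
      · rintro ⟨hy, hy'⟩
        refine ⟨t^[p - j] y, ⟨hDi _ hy, hy'⟩, ?_⟩
        rw [← Function.iterate_add_apply, Nat.add_sub_cancel' hj, T.per y (hDsub hy)]
    have hVjo : ∀ j ∈ Finset.range p, IsOpen (t^[j] '' B0) := by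
      intro j hj
      rw [himg j (Finset.mem_range.1 hj).le]
      exact ((T.cont_iter _).mono hDsub).isOpen_inter_preimage hD Metric.isOpen_ball
    let D1 : Set E := ⋃ j ∈ Finset.range p, t^[j] '' B0
    have hD1o : IsOpen D1 := isOpen_biUnion hVjo
    have hVjD : ∀ j ∈ Finset.range p, t^[j] '' B0 ⊆ D := by
      intro j _
      rintro _ ⟨x, hx, rfl⟩
      exact hDi j hx.1
    have hD1D : D1 ⊆ D := Set.iUnion₂_subset hVjD
    have hD1m : ∀ x ∈ D, ∀ j, t^[j] x ∈ Metric.ball a (r a) → x ∈ D1 := by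
      intro x hx j hj
      rw [← T.iter_mod (hDsub hx)] at hj
      have hlt := Nat.mod_lt j T.pos
      rcases Nat.eq_zero_or_pos (j % p) with h | h
      · rw [h] at hj
        exact Set.mem_biUnion (x := 0) (Finset.mem_coe.2 (Finset.mem_range.2 T.pos))
          ⟨x, ⟨hx, hj⟩, rfl⟩
      · refine Set.mem_biUnion (x := p - j % p) (Finset.mem_coe.2 (Finset.mem_range.2 (by omega))) ?_
        rw [himg _ (by omega)]
        refine ⟨hx, ?_⟩
        rw [Nat.sub_sub_self hlt.le]
        exact hj
    let D2 : Set E := D ∩ ⋂ j ∈ Finset.range p, (D ∩ t^[j] ⁻¹' (Metric.closedBall a (r a))ᶜ)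
    have hD2o : IsOpen D2 := hD.inter (isOpen_biInter_finset fun j _ =>
      ((T.cont_iter _).mono hDsub).isOpen_inter_preimage hD Metric.isClosed_closedBall.isOpen_compl)
    have hD2D : D2 ⊆ D := Set.inter_subset_left
    have hD2m : ∀ x, x ∈ D2 ↔ x ∈ D ∧ ∀ j, t^[j] x ∉ Metric.closedBall a (r a) := by
      intro x
      simp only [D2, Set.mem_inter_iff, Set.mem_iInter, Set.mem_preimage, Set.mem_compl_iff]
      constructor
      · rintro ⟨h1, h2⟩
        refine ⟨h1, fun j => ?_⟩
        rw [← T.iter_mod (hDsub h1)]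
        exact (h2 _ (Finset.mem_range.2 (Nat.mod_lt _ T.pos))).2
      · rintro ⟨h1, h2⟩
        exact ⟨h1, fun j _ => ⟨h1, h2 j⟩⟩
    have hD12 : Disjoint D1 D2 := by
      rw [Set.disjoint_left]
      intro x hx1 hx2
      obtain ⟨j, hj, hxj⟩ := Set.mem_iUnion₂.1 hx1
      rw [himg j (Finset.mem_range.1 hj).le] at hxj
      exact ((hD2m x).1 hx2).2 _ (Metric.ball_subset_closedBall hxj.2)
    have hcover : ∀ x ∈ closure D, f' x = 0 → x ∉ D1 → x ∈ D2 := by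
      intro x hx hx0 hx1
      have hxD : x ∈ D := (hz' x hx hx0).1
      rw [hD2m]
      refine ⟨hxD, fun j hj => ?_⟩
      by_cases hb : t^[j] x ∈ Metric.ball a (r a)
      · exact hx1 (hD1m x hxD j hb)
      · refine hf's (t^[j] x) (hcli j hx) ?_ (by rw [hf'i j x hx, hx0])
        exact le_antisymm hj (not_lt.1 hb)
    rw [deg_add hD hDb hD1o hD2o hD1D hD2D hD12 hf'c
      (fun x hx h1 h2 hx0 => h2 (hcover x hx hx0 h1))]
    -- first piece
    have hfr0 : ∀ x ∈ frontier B0, f' x ≠ 0 := by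
      intro x hx hx0
      rw [hB0.frontier_eq] at hx
      have hxD := (hz' x (hB0D hx.1) hx0).1
      have hxc : x ∈ Metric.closedBall a (r a) :=
        Metric.closure_ball_subset_closedBall (closure_mono Set.inter_subset_right hx.1)
      refine hf's x (hB0D hx.1) ?_ hx0
      exact le_antisymm hxc (not_lt.1 fun h => hx.2 ⟨hxD, h⟩)
    have hB0b : Bornology.IsBounded B0 := hDb.subset Set.inter_subset_left
    have hpiece : ∀ j ∈ Finset.range p, ∃ n : ℤ, deg f' B0 = n ∧ deg f' (t^[j] '' B0) = n := by
      intro j hj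
      obtain ⟨n, hn1, hn2⟩ := deg_comp (F := f') T.isOpen T.conn (T.cont_iter j) (T.inj j) T.openW
        T.subW T.neW (T.iter_id j) hB0 hB0b (hB0D.trans hDΩ) (hVjo j hj)
        (hf'c.mono (by rintro _ ⟨x, hx, rfl⟩; exact hcli j (hB0D hx)))
        (fun x hx => by
          rw [hf'i j x (hB0D (frontier_subset_closure hx))]; exact hfr0 x hx)
      refine ⟨n, ?_, hn2⟩
      rw [← hn1]
      exact deg_congr hB0 hB0b (hf'c.mono (frontier_subset_closure.trans hB0D)) hfr0
        (fun x hx => (hf'i j x (hB0D (frontier_subset_closure hx))).symm)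
    obtain ⟨n, hn, -⟩ := hpiece 0 (Finset.mem_range.2 T.pos)
    have hsum : deg f' D1 = p * n := by
      rw [deg_iUnion (fun j => t^[j] '' B0) (Finset.range p) hD1o (hDb.subset hD1D)
        (hf'c.mono (closure_mono hD1D)) hVjo (fun j hj => Set.subset_biUnion_of_mem
          (u := fun j => t^[j] '' B0) (Finset.mem_coe.2 hj))]
      · rw [Finset.sum_congr rfl (g := fun _ => (n : ℝ))]
        · simp
        · intro j hj
          obtain ⟨m, hm1, hm2⟩ := hpiece j hj
          rw [hm2, ← hm1, hn]
      · intro i hi j hj hij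
        rw [Set.disjoint_left]
        have key : ∀ i j, i < j → j < p → ∀ y, y ∈ t^[i] '' B0 → y ∈ t^[j] '' B0 → False := by
          rintro i j hij hjp _ ⟨x, hx, rfl⟩ ⟨z, hz, hzx⟩
          have h1 : t^[j - i] z = x := by
            apply T.inj i (T.maps_iter _ (hDsub hz.1)) (hDsub hx.1)
            rw [← Function.iterate_add_apply, Nat.add_sub_cancel' hij.le, hzx]
          have hsub : Metric.ball a (r a) ⊆ Metric.closedBall a (2 * r a) :=
            Metric.ball_subset_closedBall.trans (Metric.closedBall_subset_closedBall (by linarith))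
          refine hdis z (hsub hz.2) (j - i) (by omega) (by omega) ?_
          rw [h1]; exact hsub hx.2
        intro y hyi hyj
        rcases lt_or_gt_of_ne hij with h | h
        · exact key i j h (Finset.mem_range.1 hj) y hyi hyj
        · exact key j i h (Finset.mem_range.1 hi) y hyj hyi
      · intro x hx hx0
        by_contra hcon
        have hx1 : x ∉ D1 := by
          intro h
          obtain ⟨j, hj, hxj⟩ := Set.mem_iUnion₂.1 h
          exact hcon ⟨j, hj, hxj⟩
        have hx2 := hcover x (closure_mono hD1D hx) hx0 hx1
        exact Set.disjoint_left.1 (hD12.closure_left hD2o) hx hx2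
    -- second piece
    obtain ⟨n', hn'⟩ := ih (D := D2) (f := f') hD2o (hDb.subset hD2D) ((closure_mono hD2D).trans hDΩ)
      (fun x hx => by
        rw [hD2m] at hx ⊢
        refine ⟨hDt hx.1, fun j => ?_⟩
        rw [← Function.iterate_succ_apply]
        exact hx.2 _)
      (hf'c.mono (closure_mono hD2D)) (fun x hx => hf't x (closure_mono hD2D hx))
      (fun b hb => hball b (by simp [hb])) (fun x hx hx0 => by
        have hxD1 : x ∉ D1 := fun h => Set.disjoint_left.1 (hD12.closure_right hD1o) h hx
        have hxD := closure_mono hD2D hx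
        refine ⟨hcover x hxD hx0 hxD1, ?_⟩
        obtain ⟨h1, h2⟩ := hz' x hxD hx0
        obtain ⟨b, hb, h3⟩ := Set.mem_iUnion₂.1 h2
        obtain ⟨j, hj, h4⟩ := Set.mem_iUnion₂.1 h3
        rcases Finset.mem_insert.1 hb with rfl | hb
        · exact absurd (hD1m x h1 j h4.2) hxD1
        · exact ⟨b, hb, j, h4.2⟩)
    refine ⟨n + n', ?_⟩
    rw [hsum, hn']
    push_cast
    ring

end PartC

open MeasureTheory Topology Filter
open scoped ContDiff
set_option linter.unusedSectionVars false

section PartC2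
variable {E : Type*} [NormedAddCommGroup E] [InnerProductSpace ℝ E] [FiniteDimensional ℝ E]
  [MeasurableSpace E] [BorelSpace E]

/-- curved chart. -/
noncomputable def nwPsi (q e : E) (ρ : ℝ) (y : E) : E := (y - q) + (‖y - q‖ ^ 2 / ρ) • e

/-- height. -/
noncomputable def nwH (q e : E) (ρ : ℝ) (y : E) : ℝ := inner ℝ (y - q) e + ‖y - q‖ ^ 2 / ρ

theorem nwPsi_cont (q e : E) (ρ : ℝ) : Continuous (nwPsi q e ρ) := by
  unfold nwPsi; fun_prop

theorem nwH_cont (q e : E) (ρ : ℝ) : Continuous (nwH q e ρ) := by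
  unfold nwH; fun_prop

theorem nwPsi_height (q : E) {e : E} (he : ‖e‖ = 1) (ρ : ℝ) (y : E) :
    inner ℝ (nwPsi q e ρ y) e = nwH q e ρ y := by
  unfold nwPsi nwH
  rw [inner_add_left, inner_smul_left, real_inner_self_eq_norm_sq, he]
  simp

theorem nwPsi_q (q e : E) (ρ : ℝ) : nwPsi q e ρ q = 0 := by simp [nwPsi]

theorem nwPsi_close {q e : E} (he : ‖e‖ = 1) {ρ s : ℝ} (hρ : 0 < ρ) (hs : s ≤ ρ / 4)
    {y z : E} (hy : ‖y - q‖ ≤ s) (hz : ‖z - q‖ ≤ s) :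
    ‖(nwPsi q e ρ y - nwPsi q e ρ z) - (y - z)‖ ≤ ‖y - z‖ / 2 := by
  have h1 : (nwPsi q e ρ y - nwPsi q e ρ z) - (y - z) =
      ((‖y - q‖ ^ 2 - ‖z - q‖ ^ 2) / ρ) • e := by
    unfold nwPsi; rw [sub_div, sub_smul]; abel
  rw [h1, norm_smul, he, mul_one, Real.norm_eq_abs, abs_div, abs_of_pos hρ, div_le_iff₀ hρ]
  have h2 : |‖y - q‖ - ‖z - q‖| ≤ ‖y - z‖ := by
    have := abs_norm_sub_norm_le (y - q) (z - q)
    rwa [sub_sub_sub_cancel_right] at this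
  have h3 : ‖y - q‖ ^ 2 - ‖z - q‖ ^ 2 = (‖y - q‖ - ‖z - q‖) * (‖y - q‖ + ‖z - q‖) := by ring
  rw [h3, abs_mul, abs_of_nonneg (by positivity : 0 ≤ ‖y - q‖ + ‖z - q‖)]
  calc |‖y - q‖ - ‖z - q‖| * (‖y - q‖ + ‖z - q‖) ≤ ‖y - z‖ * (s + s) := by gcongr
    _ ≤ ‖y - z‖ * (ρ / 2) := by gcongr; linarith
    _ = _ := by ring

theorem nwH_nonpos {a q : E} {ρ : ℝ} (hρ : 0 < ρ) (haq : ‖q - a‖ = ρ) {y : E}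
    (hy : nwH q (ρ⁻¹ • (q - a)) ρ y ≤ 0) (hyq : y ≠ q) : ‖y - a‖ < ρ := by
  unfold nwH at hy
  rw [inner_smul_right] at hy
  have h1 : ‖y - a‖ ^ 2 = ‖y - q‖ ^ 2 + 2 * inner ℝ (y - q) (q - a) + ‖q - a‖ ^ 2 := by
    rw [← norm_add_sq_real]; simp
  have h2 : inner ℝ (y - q) (q - a) + ‖y - q‖ ^ 2 ≤ 0 := by
    have := mul_le_mul_of_nonneg_left hy hρ.le
    rw [mul_zero] at this
    have e : ρ * (ρ⁻¹ * inner ℝ (y - q) (q - a) + ‖y - q‖ ^ 2 / ρ) =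
      inner ℝ (y - q) (q - a) + ‖y - q‖ ^ 2 := by field_simp
    rwa [e] at this
  have h3 : 0 < ‖y - q‖ := norm_pos_iff.2 (sub_ne_zero.2 hyq)
  refine lt_of_pow_lt_pow_left₀ 2 hρ.le ?_
  rw [h1, haq]
  nlinarith

theorem prime_not_fixed {t : E → E} {p : ℕ} (hp : p.Prime) {z : E} (hz : t^[p] z = z)
    (hnf : t z ≠ z) {j : ℕ} (hj0 : 0 < j) (hj : j < p) : t^[j] z ≠ z := by
  intro h
  have h1 : Function.IsPeriodicPt t j z := h
  have h2 : Function.IsPeriodicPt t p z := hz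
  have h3 := h1.gcd h2
  have : Nat.gcd j p = 1 := ((Nat.Prime.coprime_iff_not_dvd hp).2 (Nat.not_dvd_of_pos_of_lt hj0 hj)).symm
  rw [this] at h3
  exact hnf h3

/-- Core contradiction in Newman's theorem. -/
theorem newman_core {t : E → E} {Ω W : Set E} {p : ℕ} (T : PerMap t Ω W p) (hp : p.Prime)
    {a q : E} {ρ : ℝ} (hρ : 0 < ρ) (haq : ‖q - a‖ = ρ) (hq : q ∈ Ω) (htq : t q = q)
    (hfix : ∀ y ∈ Ω, ‖y - a‖ < ρ → t y = y) (hnf : ∃ᶠ y in 𝓝 q, t y ≠ y) : False := by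
  classical
  set e : E := ρ⁻¹ • (q - a) with hedef
  have he : ‖e‖ = 1 := by
    rw [hedef, norm_smul, haq, norm_inv, Real.norm_of_nonneg hρ.le, inv_mul_cancel₀ hρ.ne']
  set H := nwH q e ρ with hH
  set Ψ := nwPsi q e ρ with hΨ
  have hHc : Continuous H := nwH_cont q e ρ
  have hΨc : Continuous Ψ := nwPsi_cont q e ρ
  have hΨh : ∀ y, inner ℝ (Ψ y) e = H y := nwPsi_height q he ρ
  have hHfix : ∀ y ∈ Ω, H y ≤ 0 → t y = y := by
    intro y hy h
    by_cases hyq : y = q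
    · rw [hyq, htq]
    · exact hfix y hy (nwH_nonpos hρ haq h hyq)
  have hHt : ∀ y ∈ Ω, 0 < H y → 0 < H (t y) := by
    intro y hy h
    by_contra hneg
    have h1 := hHfix (t y) (T.maps hy) (not_lt.1 hneg)
    have h2 : t y = y := by
      have := T.inj 1 (T.maps hy) hy (by simpa using h1)
      exact this
    rw [h2] at hneg
    exact hneg h
  have hHti : ∀ j, ∀ y ∈ Ω, 0 < H y → 0 < H (t^[j] y) := by
    intro j
    induction j with
    | zero => intro y _ h; exact h
    | succ j ih =>
      intro y hy h
      rw [Function.iterate_succ_apply]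
      exact ih _ (T.maps hy) (hHt y hy h)
  have hp0 : (0 : ℝ) < p := by exact_mod_cast T.pos
  have htqi : ∀ j, t^[j] q = q := fun j => Function.iterate_fixed htq j
  obtain ⟨s₀, hs₀, hs₀Ω⟩ := Metric.nhds_basis_closedBall.mem_iff.1 (T.isOpen.mem_nhds hq)
  set s := min s₀ (ρ / 4) with hsdef
  have hs : 0 < s := by positivity
  have hsρ : s ≤ ρ / 4 := min_le_right _ _
  have hsΩ : Metric.closedBall q s ⊆ Ω :=
    (Metric.closedBall_subset_closedBall (min_le_left _ _)).trans hs₀Ω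
  have hsn : ∀ y, y ∈ Metric.closedBall q s ↔ ‖y - q‖ ≤ s := fun y => by
    rw [Metric.mem_closedBall, dist_eq_norm]
  let f : E → E := fun y => (p : ℝ)⁻¹ • ∑ j ∈ Finset.range p, Ψ (t^[j] y)
  have hfc : ContinuousOn f Ω :=
    continuousOn_const.smul (continuousOn_finsetSum _ fun j _ =>
      hΨc.comp_continuousOn (T.cont_iter j))
  have hft : ∀ y ∈ Ω, f (t y) = f y := by
    intro y hy
    simp only [f]
    congr 1
    simp only [← Function.iterate_succ_apply]
    have h1 := Finset.sum_range_succ (fun j => Ψ (t^[j] y)) p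
    have h2 := Finset.sum_range_succ' (fun j => Ψ (t^[j] y)) p
    rw [T.per y hy] at h1
    rw [h1] at h2
    simpa using h2.symm
  have hffix : ∀ y, t y = y → f y = Ψ y := by
    intro y hy
    simp only [f, Function.iterate_fixed hy, Finset.sum_const, Finset.card_range]
    rw [← Nat.cast_smul_eq_nsmul ℝ, smul_smul, inv_mul_cancel₀ hp0.ne', one_smul]
  have hfh : ∀ y ∈ Ω, 0 < H y → 0 < inner ℝ (f y) e := by
    intro y hy h
    simp only [f]
    rw [inner_smul_left, sum_inner]
    refine mul_pos (by simpa using hp0) (Finset.sum_pos (fun j _ => ?_)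
      ⟨0, Finset.mem_range.2 T.pos⟩)
    rw [hΨh]
    exact hHti j y hy h
  have hGh : ∀ τ ∈ Set.Icc (0 : ℝ) 1, ∀ y ∈ Ω, 0 < H y →
      0 < inner ℝ (Ψ y + τ • (f y - Ψ y)) e := by
    intro τ hτ y hy h
    have h1 := hfh y hy h
    have h2 : inner ℝ (Ψ y + τ • (f y - Ψ y)) e = (1 - τ) * H y + τ * inner ℝ (f y) e := by
      rw [inner_add_left, inner_smul_left, inner_sub_left, hΨh]
      simp only [conj_trivial]; ring
    rw [h2]
    rcases lt_or_ge τ 1 with h3 | h3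
    · have := mul_pos (sub_pos.2 h3) h
      have := mul_nonneg hτ.1 h1.le
      linarith
    · have : τ = 1 := le_antisymm hτ.2 h3
      rw [this]; simpa using h1
  -- compact outer boundary
  let K : Set E := ⋃ j ∈ Finset.range p, ((Metric.closedBall q s ∩ (fun y => ‖t^[j] y - q‖) ⁻¹' {s}) ∩
    H ⁻¹' Set.Ici 0)
  have hKΩ : K ⊆ Ω := Set.iUnion₂_subset fun j _ y hy => hsΩ hy.1.1
  have hK : IsCompact K := by
    refine (Finset.range p).isCompact_biUnion fun j _ => ?_
    refine IsCompact.inter_right ?_ (isClosed_Ici.preimage hHc)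
    refine (isCompact_closedBall q s).of_isClosed_subset ?_ Set.inter_subset_left
    refine ContinuousOn.preimage_isClosed_of_isClosed ?_ Metric.isClosed_closedBall
      isClosed_singleton
    exact (((T.cont_iter j).mono hsΩ).sub continuousOn_const).norm
  have hK0 : ∀ τ ∈ Set.Icc (0 : ℝ) 1, ∀ y ∈ K, Ψ y + τ • (f y - Ψ y) ≠ 0 := by
    intro τ hτ y hy h0
    obtain ⟨j, hj, ⟨hy1, hy2⟩, hy3⟩ := Set.mem_iUnion₂.1 hy
    have hy3' : 0 ≤ H y := hy3
    rcases hy3'.lt_or_eq with h | h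
    · have := hGh τ hτ y (hsΩ hy1) h
      rw [h0, inner_zero_left] at this
      exact lt_irrefl _ this
    · have hty := hHfix y (hsΩ hy1) h.ge
      have hy2' : ‖t^[j] y - q‖ = s := hy2
      rw [Function.iterate_fixed hty] at hy2'
      rw [hffix y hty, sub_self, smul_zero, add_zero] at h0
      have h4 := nwPsi_close he hρ hsρ hy2'.le (by simpa using hs.le : ‖q - q‖ ≤ s)
      rw [← hΨ, h0, hΨ, nwPsi_q, sub_zero, zero_sub, norm_neg, hy2'] at h4
      linarith
  obtain ⟨c, hc, hcl⟩ : ∃ c > 0, ∀ τ ∈ Set.Icc (0 : ℝ) 1, ∀ y ∈ K,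
      c ≤ ‖Ψ y + τ • (f y - Ψ y)‖ := by
    have hcont : ContinuousOn (fun z : ℝ × E => ‖Ψ z.2 + z.1 • (f z.2 - Ψ z.2)‖)
        (Set.Icc (0 : ℝ) 1 ×ˢ K) := by
      have hf2 : ContinuousOn (fun z : ℝ × E => f z.2) (Set.Icc (0 : ℝ) 1 ×ˢ K) :=
        hfc.comp continuousOn_snd fun z hz => hKΩ hz.2
      have hΨ2 : ContinuousOn (fun z : ℝ × E => Ψ z.2) (Set.Icc (0 : ℝ) 1 ×ˢ K) :=
        hΨc.comp_continuousOn continuousOn_snd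
      exact (hΨ2.add (continuousOn_fst.smul (hf2.sub hΨ2))).norm
    rcases (Set.Icc (0 : ℝ) 1 ×ˢ K).eq_empty_or_nonempty with hem | hne
    · refine ⟨1, one_pos, fun τ hτ y hy => ?_⟩
      have : (τ, y) ∈ Set.Icc (0 : ℝ) 1 ×ˢ K := ⟨hτ, hy⟩
      rw [hem] at this; exact absurd this (Set.notMem_empty _)
    · obtain ⟨z, hz, hmin⟩ := (isCompact_Icc.prod hK).exists_isMinOn hne hcont
      refine ⟨_, norm_pos_iff.2 (hK0 z.1 hz.1 z.2 hz.2), fun τ hτ y hy => ?_⟩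
      exact hmin (show (τ, y) ∈ Set.Icc (0 : ℝ) 1 ×ˢ K from ⟨hτ, hy⟩)
  -- domain
  let D : Set E := (Ω ∩ H ⁻¹' Set.Ioi 0) ∩ ⋂ j ∈ Finset.range p, (Ω ∩ t^[j] ⁻¹' Metric.ball q s)
  have hDo : IsOpen D := (T.isOpen.inter (isOpen_Ioi.preimage hHc)).inter
    (isOpen_biInter_finset fun j _ => (T.cont_iter j).isOpen_inter_preimage T.isOpen
      Metric.isOpen_ball)
  have hDm : ∀ y, y ∈ D ↔ y ∈ Ω ∧ 0 < H y ∧ ∀ j, t^[j] y ∈ Metric.ball q s := by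
    intro y
    simp only [D, Set.mem_inter_iff, Set.mem_iInter, Set.mem_preimage, Set.mem_Ioi]
    constructor
    · rintro ⟨⟨h1, h2⟩, h3⟩
      refine ⟨h1, h2, fun j => ?_⟩
      rw [← T.iter_mod h1]
      exact (h3 _ (Finset.mem_range.2 (Nat.mod_lt _ T.pos))).2
    · rintro ⟨h1, h2, h3⟩
      exact ⟨⟨h1, h2⟩, fun j _ => ⟨h1, h3 j⟩⟩
  have hDball : D ⊆ Metric.ball q s := fun y hy => ((hDm y).1 hy).2.2 0
  have hDb : Bornology.IsBounded D := Metric.isBounded_ball.subset hDball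
  have hDcl : closure D ⊆ Metric.closedBall q s :=
    (closure_mono hDball).trans Metric.closure_ball_subset_closedBall
  have hDΩ : closure D ⊆ Ω := hDcl.trans hsΩ
  have hDt : Set.MapsTo t D D := by
    intro y hy
    rw [hDm] at hy ⊢
    refine ⟨T.maps hy.1, hHt y hy.1 hy.2.1, fun j => ?_⟩
    rw [← Function.iterate_succ_apply]
    exact hy.2.2 _
  have hDH : ∀ y ∈ closure D, 0 ≤ H y := by
    intro y hy
    exact closure_minimal (fun z hz => ((hDm z).1 hz).2.1.le) (isClosed_Ici.preimage hHc) hy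
  have hDit : ∀ j, ∀ y ∈ closure D, ‖t^[j] y - q‖ ≤ s := by
    intro j y hy
    have h1 : Set.MapsTo t^[j] D (Metric.closedBall q s) := fun z hz =>
      Metric.ball_subset_closedBall (((hDm z).1 hz).2.2 j)
    have h2 := h1.closure_of_continuousOn ((T.cont_iter j).mono hDΩ) hy
    rw [Metric.isClosed_closedBall.closure_eq, hsn] at h2
    exact h2
  have hfront : ∀ y ∈ frontier D, H y = 0 ∨ y ∈ K := by
    intro y hy
    rw [hDo.frontier_eq] at hy
    by_contra hcon
    push Not at hcon
    apply hy.2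
    rw [hDm]
    refine ⟨hDΩ hy.1, lt_of_le_of_ne (hDH y hy.1) (Ne.symm hcon.1), fun j => ?_⟩
    rw [← T.iter_mod (hDΩ hy.1)]
    rw [Metric.mem_ball, dist_eq_norm]
    refine lt_of_le_of_ne (hDit _ y hy.1) fun heq => hcon.2 ?_
    exact Set.mem_biUnion (Finset.mem_coe.2 (Finset.mem_range.2 (Nat.mod_lt j T.pos)))
      ⟨⟨hDcl hy.1, heq⟩, hDH y hy.1⟩
  -- the point u₀
  obtain ⟨u₀, hu₀nf, hu₀Ω, hu₀c, hu₀s⟩ : ∃ u₀, t u₀ ≠ u₀ ∧ u₀ ∈ Ω ∧ ‖Ψ u₀‖ < c ∧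
      ∀ j ∈ Finset.range p, t^[j] u₀ ∈ Metric.ball q s := by
    have h1 : ∀ᶠ y in 𝓝 q, ‖Ψ y‖ < c := by
      have : Tendsto (fun y => ‖Ψ y‖) (𝓝 q) (𝓝 0) := by
        have h := hΨc.norm.tendsto q
        rwa [show Ψ q = 0 from nwPsi_q q e ρ, norm_zero] at h
      exact this.eventually_lt_const hc
    have h2 : ∀ᶠ y in 𝓝 q, ∀ j ∈ Finset.range p, t^[j] y ∈ Metric.ball q s := by
      rw [Filter.eventually_all_finset]
      intro j _
      have := (T.cont_iter j).continuousAt (T.isOpen.mem_nhds hq)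
      refine this.eventually_mem ?_
      rw [htqi]
      exact Metric.ball_mem_nhds q hs
    have h3 : ∀ᶠ y in 𝓝 q, y ∈ Ω := T.isOpen.mem_nhds hq
    obtain ⟨u, hu, hu1, hu2, hu3⟩ := (hnf.and_eventually (h3.and (h1.and h2))).exists
    exact ⟨u, hu, hu1, hu2, hu3⟩
  have hu₀H : 0 < H u₀ := by
    by_contra h
    exact hu₀nf (hHfix u₀ hu₀Ω (not_lt.1 h))
  have hu₀D : u₀ ∈ D := by
    rw [hDm]
    refine ⟨hu₀Ω, hu₀H, fun j => ?_⟩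
    rw [← T.iter_mod hu₀Ω]
    exact hu₀s _ (Finset.mem_range.2 (Nat.mod_lt _ T.pos))
  set w := Ψ u₀ with hw
  have hwh : 0 < inner ℝ w e := by rw [hw, hΨh]; exact hu₀H
  have hgap : ∀ τ ∈ Set.Icc (0 : ℝ) 1, ∀ y ∈ frontier D, Ψ y + τ • (f y - Ψ y) ≠ w := by
    intro τ hτ y hy h
    rcases hfront y hy with h1 | h1
    · have hty := hHfix y (hDΩ (frontier_subset_closure hy)) h1.le
      rw [hffix y hty, sub_self, smul_zero, add_zero] at h
      rw [← h, hΨh, h1] at hwh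
      exact lt_irrefl _ hwh
    · have := hcl τ hτ y h1
      rw [h] at this
      linarith
  have hΨdeg : deg (fun y => Ψ y - w) D = 1 := by
    rw [← deg_sub_const hDo hDb hu₀D]
    symm
    refine deg_homotopy hDo hDb (continuous_id.sub continuous_const).continuousOn
      (hΨc.sub continuous_const).continuousOn fun τ hτ y hy h0 => ?_
    have hyu : y ≠ u₀ := by
      rintro rfl
      rw [hDo.frontier_eq] at hy
      exact hy.2 hu₀D
    have hpos : 0 < ‖y - u₀‖ := norm_pos_iff.2 (sub_ne_zero.2 hyu)
    have h4 := nwPsi_close he hρ hsρ (hDit 0 y (frontier_subset_closure hy))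
      (hDit 0 u₀ (subset_closure hu₀D))
    simp only [Function.iterate_zero, id] at h4
    rw [← hΨ, ← hw] at h4
    have h5 : y - u₀ = -(τ • (Ψ y - w - (y - u₀))) := eq_neg_of_add_eq_zero_left h0
    have h6 : ‖y - u₀‖ ≤ ‖y - u₀‖ / 2 := by
      calc ‖y - u₀‖ = τ * ‖Ψ y - w - (y - u₀)‖ := by
            conv_lhs => rw [h5]
            rw [norm_neg, norm_smul, Real.norm_of_nonneg hτ.1]
        _ ≤ 1 * (‖y - u₀‖ / 2) := by gcongr; exact hτ.2
        _ = _ := one_mul _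
    linarith
  have hfdeg : deg (fun y => f y - w) D = 1 := by
    rw [← hΨdeg]
    symm
    refine deg_homotopy hDo hDb (hΨc.sub continuous_const).continuousOn
      ((hfc.mono (frontier_subset_closure.trans hDΩ)).sub continuousOn_const)
      fun τ hτ y hy h0 => hgap τ hτ y hy ?_
    rw [← sub_eq_zero, ← h0]
    simp only [smul_sub]; abel
  -- zeros
  have hzD : ∀ y ∈ closure D, f y - w = 0 → y ∈ D ∧ t y ≠ y := by
    intro y hy hy0
    refine ⟨?_, fun hty => ?_⟩
    · by_contra hyD
      have hyf : y ∈ frontier D := by rw [hDo.frontier_eq]; exact ⟨hy, hyD⟩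
      exact hgap 1 (by simp) y hyf (by rw [one_smul, add_sub_cancel]; exact sub_eq_zero.1 hy0)
    · rw [hffix y hty] at hy0
      have h4 := nwPsi_close he hρ hsρ (hDit 0 y hy) (hDit 0 u₀ (subset_closure hu₀D))
      simp only [Function.iterate_zero, id] at h4
      rw [← hΨ, ← hw, hy0, zero_sub, norm_neg] at h4
      have : ‖y - u₀‖ = 0 := le_antisymm (by linarith [norm_nonneg (y - u₀)]) (norm_nonneg _)
      rw [norm_eq_zero, sub_eq_zero] at this
      rw [this] at hty
      exact hu₀nf hty
  have hrad : ∀ z ∈ {y ∈ closure D | f y - w = 0}, ∃ r > 0, ∀ x ∈ Metric.closedBall z (2 * r),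
      ∀ j, 0 < j → j < p → t^[j] x ∉ Metric.closedBall z (2 * r) := by
    rintro z ⟨hz, hz0⟩
    obtain ⟨hzD', hzt⟩ := hzD z hz hz0
    have hev : ∀ᶠ r in 𝓝[>] (0 : ℝ), ∀ j ∈ Finset.range p, 0 < j →
        ∀ x ∈ Metric.closedBall z (2 * r), t^[j] x ∉ Metric.closedBall z (2 * r) := by
      rw [Filter.eventually_all_finset]
      intro j hj
      by_cases hj0 : 0 < j
      swap
      · exact Eventually.of_forall fun _ h => absurd h hj0
      have hne := prime_not_fixed hp (T.per z (hDΩ hz)) hzt hj0 (Finset.mem_range.1 hj)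
      have hdpos : 0 < dist (t^[j] z) z := dist_pos.2 hne
      have hcz := (T.cont_iter j).continuousAt (T.isOpen.mem_nhds (hDΩ hz))
      obtain ⟨δ, hδ, hδ'⟩ := Metric.continuousAt_iff.1 hcz (dist (t^[j] z) z / 2) (half_pos hdpos)
      filter_upwards [Ioo_mem_nhdsGT (show (0 : ℝ) < min (δ / 2) (dist (t^[j] z) z / 4) by
        positivity)] with r hr _ x hx hx'
      have hr1 : r < δ / 2 := hr.2.trans_le (min_le_left _ _)
      have hr2 : r < dist (t^[j] z) z / 4 := hr.2.trans_le (min_le_right _ _)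
      have h1 := hδ' (show dist x z < δ by rw [Metric.mem_closedBall] at hx; linarith)
      rw [Metric.mem_closedBall] at hx'
      have h2 := dist_triangle_left (t^[j] z) z (t^[j] x)
      linarith
    obtain ⟨r, hr, hr0⟩ := (hev.and self_mem_nhdsWithin).exists
    exact ⟨r, hr0, fun x hx j hj0 hj => hr j (Finset.mem_range.2 hj) hj0 x hx⟩
  choose! r hr0 hr using hrad
  have hfcc : ContinuousOn (fun y => f y - w) (closure D) := (hfc.mono hDΩ).sub continuousOn_const
  have hZc : IsCompact {y ∈ closure D | f y - w = 0} := by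
    refine hDb.isCompact_closure.of_isClosed_subset ?_ (fun y hy => hy.1)
    exact hfcc.preimage_isClosed_of_isClosed isClosed_closure (isClosed_singleton (x := (0 : E)))
  obtain ⟨S, hS, hScov⟩ := hZc.elim_nhds_subcover (fun z => Metric.ball z (r z))
    (fun z hz => Metric.ball_mem_nhds z (hr0 z hz))
  obtain ⟨n, hn⟩ := newman_div T r S (f := fun y => f y - w) hDo hDb hDΩ hDt hfcc
    (fun y hy => by simp only [hft y (hDΩ hy)]) (fun z hz => ⟨hr0 z (hS z hz), hr z (hS z hz)⟩)
    (fun y hy hy0 => by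
      refine ⟨(hzD y hy hy0).1, ?_⟩
      obtain ⟨z, hz, hyz⟩ := Set.mem_iUnion₂.1 (hScov ⟨hy, hy0⟩)
      exact ⟨z, hz, 0, hyz⟩)
  rw [hfdeg] at hn
  have h1 : (p : ℤ) * n = 1 := by exact_mod_cast hn.symm
  have h2 : (p : ℤ) ∣ 1 := ⟨n, h1.symm⟩
  have h3 : p ∣ 1 := by exact_mod_cast h2
  exact hp.one_lt.ne' (Nat.dvd_one.1 h3)

theorem newman {t : E → E} {Ω W : Set E} {p : ℕ} (T : PerMap t Ω W p) (hp : p.Prime) :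
    ∀ x ∈ Ω, t x = x := by
  let A : Set E := Ω ∩ interior {x | t x = x}
  have hA : IsOpen A := T.isOpen.inter isOpen_interior
  have hAt : ∀ y ∈ A, t y = y := fun y hy => by
    have h : y ∈ {x | t x = x} := interior_subset hy.2
    exact h
  have hsub : Ω ⊆ A := by
    refine T.conn.subset_of_closure_inter_subset hA ?_ ?_
    · obtain ⟨w, hw⟩ := T.neW
      exact ⟨w, T.subW hw, T.subW hw, mem_interior.2 ⟨W, T.idW, T.openW, hw⟩⟩
    rintro q₀ ⟨hq₀, hq₀Ω⟩
    by_contra hq₀A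
    obtain ⟨R, hR, hRΩ⟩ := Metric.isOpen_iff.1 T.isOpen q₀ hq₀Ω
    obtain ⟨a, haA, haq₀⟩ := Metric.mem_closure_iff.1 hq₀ (R / 2) (half_pos hR)
    have hne : (Aᶜ).Nonempty := ⟨q₀, hq₀A⟩
    obtain ⟨q, hqA, hqd⟩ := hA.isClosed_compl.exists_infDist_eq_dist hne a
    have hρle : dist a q ≤ dist a q₀ := by
      rw [← hqd]; exact Metric.infDist_le_dist_of_mem hq₀A
    have hqΩ : q ∈ Ω := by
      apply hRΩ
      rw [Metric.mem_ball]
      have := dist_triangle_left q q₀ a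
      rw [dist_comm q₀ a] at haq₀
      linarith
    have hρ : 0 < dist a q := dist_pos.2 fun h => hqA (h ▸ haA)
    have hball : ∀ y, ‖y - a‖ < dist a q → y ∈ A := by
      intro y hy
      by_contra hyA
      have := Metric.infDist_le_dist_of_mem (x := a) (show y ∈ Aᶜ from hyA)
      rw [hqd, dist_comm a y, dist_eq_norm y a] at this
      linarith
    have hqcl : q ∈ closure (Metric.ball a (dist a q)) := by
      rw [closure_ball a hρ.ne', Metric.mem_closedBall, dist_comm]
    have htq : t q = q := by
      have hcq := T.cont.continuousAt (T.isOpen.mem_nhds hqΩ)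
      haveI : NeBot (𝓝[Metric.ball a (dist a q)] q) := mem_closure_iff_nhdsWithin_neBot.1 hqcl
      refine tendsto_nhds_unique (hcq.tendsto.mono_left nhdsWithin_le_nhds) ?_
        (l := 𝓝[Metric.ball a (dist a q)] q)
      refine (tendsto_id.mono_left nhdsWithin_le_nhds).congr' ?_
      filter_upwards [self_mem_nhdsWithin] with y hy
      rw [Metric.mem_ball, dist_eq_norm] at hy
      exact (hAt y (hball y hy)).symm
    refine newman_core T hp hρ (by rw [← dist_eq_norm, dist_comm]) hqΩ htq
      (fun y _ hy => hAt y (hball y hy)) ?_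
    intro hcon
    apply hqA
    refine ⟨hqΩ, mem_interior_iff_mem_nhds.2 ?_⟩
    filter_upwards [hcon] with y hy using not_not.1 hy
  intro x hx
  exact hAt x (hsub hx)

end PartC2

open MeasureTheory Topology Filter
set_option linter.unusedSectionVars false
section
variable {H : Type*} [NormedAddCommGroup H] [InnerProductSpace ℂ H]
variable {K : Type*} [CommGroup K]

theorem common_eigenvector (U : K →* (H →L[ℂ] H)) (n : ℕ) :
    ∀ W : Submodule ℂ H, FiniteDimensional ℂ W → Module.finrank ℂ W ≤ n → W ≠ ⊥ →
    (∀ k, ∀ f ∈ W, U k f ∈ W) → ∃ f ∈ W, f ≠ 0 ∧ ∀ k, ∃ c : ℂ, U k f = c • f := by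
  induction n with
  | zero =>
    intro W hW hr hb _
    exact absurd (Submodule.finrank_eq_zero.1 (Nat.le_zero.1 hr)) hb
  | succ n ih =>
    intro W hW hr hb hi
    by_cases hall : ∀ k, ∃ c : ℂ, ∀ f ∈ W, U k f = c • f
    · obtain ⟨f, hf, hf0⟩ := Submodule.exists_mem_ne_zero_of_ne_bot hb
      exact ⟨f, hf, hf0, fun k => (hall k).imp fun c h => h f hf⟩
    · push Not at hall
      obtain ⟨k, hk⟩ := hall
      have : Nontrivial W := (Submodule.nontrivial_iff_ne_bot).2 hb
      let T : Module.End ℂ W := (U k : H →ₗ[ℂ] H).restrict (hi k)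
      obtain ⟨c, hc⟩ := Module.End.exists_eigenvalue T
      obtain ⟨v, hv⟩ := hc.exists_hasEigenvector
      let W' : Submodule ℂ H := W ⊓ LinearMap.ker ((U k : H →ₗ[ℂ] H) - c • LinearMap.id)
      have hmem : ∀ f, f ∈ W' ↔ f ∈ W ∧ U k f = c • f := by
        intro f
        simp [W', sub_eq_zero]
      have hle : W' ≤ W := inf_le_left
      have hlt : W' < W := by
        refine lt_of_le_of_ne hle fun h => ?_
        obtain ⟨f, hf, hne⟩ := hk c
        exact hne ((hmem f).1 (h ▸ hf)).2
      have hfr := Submodule.finrank_lt_finrank_of_lt hlt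
      obtain ⟨f, hf, h0, h1⟩ := ih W' (Submodule.finiteDimensional_of_le hle) (by omega) (by
        intro h
        have h1 : (v : H) ∈ W' := by
          refine (hmem _).2 ⟨v.2, ?_⟩
          have := congrArg Subtype.val hv.apply_eq_smul
          simpa [T] using this
        rw [h, Submodule.mem_bot] at h1
        exact hv.2 (Subtype.ext h1)) (by
        intro j f hf
        have h2 := (hmem f).1 hf
        refine (hmem _).2 ⟨hi j f h2.1, ?_⟩
        have : U k (U j f) = U j (U k f) := by
          rw [← mul_apply_eq_comp, ← mul_apply_eq_comp, ← map_mul,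
            ← map_mul, mul_comm]
        rw [this, h2.2, map_smul])
      exact ⟨f, hle hf, h0, h1⟩

variable [CompleteSpace H]
variable [TopologicalSpace K] [IsTopologicalGroup K] [CompactSpace K] [MeasurableSpace K]
  [BorelSpace K]

theorem exists_common_eigen (μ : Measure K) [IsProbabilityMeasure μ] [μ.IsMulLeftInvariant]
    [μ.IsOpenPosMeasure] (U : K →* (H →L[ℂ] H)) (hn : ∀ k f g, inner ℂ (U k f) (U k g) = inner ℂ f g)
    (hc : ∀ f, Continuous fun k => U k f) (H1 : Submodule ℂ H) (hcl : IsClosed (H1 : Set H))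
    (hi : ∀ k, ∀ f ∈ H1, U k f ∈ H1) (hne : H1 ≠ ⊥) :
    ∃ f ∈ H1, f ≠ 0 ∧ ∀ k, ∃ c : ℂ, U k f = c • f := by
  obtain ⟨w, hw, hw0⟩ := Submodule.exists_mem_ne_zero_of_ne_bot hne
  let R : K → (H →L[ℂ] H) := fun x => InnerProductSpace.rankOne ℂ (U x w) (U x w)
  have hR : Continuous R := by
    have := hc w
    have h2 : R = fun x => (ContinuousLinearMap.smulRightL ℂ H H (innerSL ℂ (U x w))) (U x w) := by
      funext x; ext f; simp [R]
    rw [h2]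
    exact ((ContinuousLinearMap.smulRightL ℂ H H).continuous.comp ((innerSL ℂ).continuous.comp this)).clm_apply this
  have hRi : Integrable R μ := hR.integrable_of_hasCompactSupport (HasCompactSupport.of_compactSpace _)
  have hRa : ∀ x f, R x f = inner ℂ (U x w) f • U x w := by
    intro x f; simp [R]
  let T := ∫ x, R x ∂μ
  have hTc : IsCompactOperator T := by
    have hcl : IsClosed ((compactOperator (RingHom.id ℂ) H H : Submodule ℂ (H →L[ℂ] H)) : Set (H →L[ℂ] H)) :=
      isClosed_setOfPred_isCompactOperator
    have hcv : Convex ℝ ((compactOperator (RingHom.id ℂ) H H : Submodule ℂ (H →L[ℂ] H)) : Set (H →L[ℂ] H)) :=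
      ((compactOperator (RingHom.id ℂ) H H).restrictScalars ℝ).convex
    refine hcv.integral_mem hcl (Eventually.of_forall fun x => ?_) hRi
    show IsCompactOperator (R x)
    have : (R x : H → H) = (fun c : ℂ => c • U x w) ∘ (innerSL ℂ (U x w)) := by
      ext f; simp [hRa]
    rw [this]
    have h1 : IsCompactOperator (innerSL ℂ (U x w) : H → ℂ) :=
      isCompactOperator_of_locallyCompactSpace_dom _ 
    exact h1.continuous_comp (by fun_prop)
  have hTs : IsSelfAdjoint T := by
    have hcl : IsClosed ((selfAdjoint.submodule ℝ (H →L[ℂ] H) : Set (H →L[ℂ] H))) := by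
      exact isClosed_eq continuous_star continuous_id
    refine (selfAdjoint.submodule ℝ (H →L[ℂ] H)).convex.integral_mem hcl (Eventually.of_forall fun x => ?_) hRi
    show IsSelfAdjoint (R x)
    exact InnerProductSpace.adjoint_rankOne _ _
  have hTr : ∀ f, T f ∈ H1 := by
    intro f
    have : T f = ∫ x, R x f ∂μ := ContinuousLinearMap.integral_apply hRi f
    rw [this]
    refine (H1.restrictScalars ℝ).convex.integral_mem hcl (Eventually.of_forall fun x => ?_) (hRi.apply_continuousLinearMap f)
    show R x f ∈ H1
    rw [hRa]
    exact H1.smul_mem _ (hi x w hw)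
  have hTU : ∀ k, U k * T = T * U k := by
    intro k
    have h1 : U k * T = ∫ x, U k * R x ∂μ := (integral_const_mul_of_integrable hRi).symm
    have h2 : ∀ x, U k * R x = R (k * x) * U k := by
      intro x
      ext f
      simp only [mul_apply_eq_comp, hRa, map_mul, map_smul, hn]
    have h3 : Integrable (fun x => R (k * x)) μ :=
      (hR.comp (continuous_const_mul k)).integrable_of_hasCompactSupport (HasCompactSupport.of_compactSpace _)
    rw [h1]
    simp_rw [h2]
    rw [integral_mul_const_of_integrable h3, integral_mul_left_eq_self]
  have hT0 : T ≠ 0 := by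
    intro h0
    have h1 : inner ℂ w (T w) = ∫ x, inner ℂ w (R x w) ∂μ := by
      have : T w = ∫ x, R x w ∂μ := ContinuousLinearMap.integral_apply hRi w
      rw [this, integral_inner (hRi.apply_continuousLinearMap w)]
    have h2 : ∀ x, inner ℂ w (R x w) = ((‖inner ℂ (U x w) w‖ ^ 2 : ℝ) : ℂ) := by
      intro x
      rw [hRa, inner_smul_right, ← inner_conj_symm w, Complex.mul_conj, Complex.normSq_eq_norm_sq]
    rw [h0] at h1
    simp_rw [h2] at h1
    rw [integral_complex_ofReal] at h1
    simp only [zero_apply, inner_zero_right] at h1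
    have h3 : ∫ x, ‖inner ℂ (U x w) w‖ ^ 2 ∂μ = 0 := by exact_mod_cast h1.symm
    have hcf : Continuous fun x => ‖inner ℂ (U x w) w‖ ^ 2 :=
      (((hc w).inner continuous_const).norm).pow 2
    have := hcf.integral_pos_of_hasCompactSupport_nonneg_nonzero (μ := μ) (HasCompactSupport.of_compactSpace _)
      (fun x => by positivity) (x := 1) (by simp [hw0])
    exact this.ne' h3
  have hsym : (T : H →ₗ[ℂ] H).IsSymmetric := hTs.isSymmetric
  have hev : ∃ c : ℂ, Module.End.HasEigenvalue (T : Module.End ℂ H) c ∧ c ≠ 0 := by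
    by_contra hcon
    push Not at hcon
    exact hT0 ((ContinuousLinearMap.eq_zero_of_forall_hasEigenvalue_eq_zero hTc hsym).1 hcon)
  obtain ⟨c, hcv, hc0⟩ := hev
  have hfd := ContinuousLinearMap.finite_dimensional_eigenspace hTc c hc0
  obtain ⟨f, hf, hf0, hfc⟩ := common_eigenvector U _ _ hfd le_rfl hcv (by
    intro k f hf
    rw [Module.End.mem_eigenspace_iff] at hf ⊢
    have h1 : T (U k f) = U k (T f) := by
      rw [← mul_apply_eq_comp, ← mul_apply_eq_comp, hTU]
    have h2 : T f = c • f := hf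
    show T (U k f) = c • U k f
    rw [h1, h2, map_smul])
  refine ⟨f, ?_, hf0, hfc⟩
  rw [Module.End.mem_eigenspace_iff] at hf
  have h2 : T f = c • f := hf
  have : f = c⁻¹ • T f := by rw [h2, smul_smul, inv_mul_cancel₀ hc0, one_smul]
  rw [this]
  exact H1.smul_mem _ (hTr f)
end

open MeasureTheory Topology Filter
set_option linter.unusedSectionVars false
section
variable {H : Type*} [NormedAddCommGroup H] [InnerProductSpace ℂ H]
variable {K : Type*} [CommGroup K] [TopologicalSpace K]

theorem char_of_eigen (U : K →* (H →L[ℂ] H)) (hn : ∀ k f g, inner ℂ (U k f) (U k g) = inner ℂ f g)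
    (hc : ∀ f, Continuous fun k => U k f) {f : H} (hf : f ≠ 0)
    (he : ∀ k, ∃ c : ℂ, U k f = c • f) :
    ∃ χ : K →ₜ* Circle, ∀ k, U k f = (χ k : ℂ) • f := by
  choose c hcc using he
  have hnorm : ∀ k, ‖c k‖ = 1 := by
    intro k
    have h1 := hn k f f
    rw [inner_self_eq_norm_sq_to_K, inner_self_eq_norm_sq_to_K] at h1
    have h2 : ‖U k f‖ ^ 2 = ‖f‖ ^ 2 := by exact_mod_cast h1
    have h3 : ‖U k f‖ = ‖f‖ := by
      exact (pow_left_inj₀ (norm_nonneg _) (norm_nonneg _) two_ne_zero).1 h2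
    rw [hcc, norm_smul] at h3
    exact mul_right_cancel₀ (norm_ne_zero_iff.2 hf) (by simpa using h3)
  have hmul : ∀ a b, c (a * b) = c a * c b := by
    intro a b
    have h1 : U (a * b) f = (c a * c b) • f := by
      rw [map_mul, mul_apply_eq_comp, hcc b, map_smul, hcc a, smul_smul, mul_comm]
    rw [hcc] at h1
    exact smul_left_injective ℂ hf h1
  have hone : c 1 = 1 := by
    have h1 := hcc 1
    rw [map_one] at h1
    exact (smul_left_injective ℂ hf (by simpa using h1)).symm
  have hcon : Continuous c := by
    have h1 : c = fun k => inner ℂ f (U k f) / inner ℂ f f := by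
      funext k
      rw [hcc, inner_smul_right, mul_div_cancel_right₀ _ (inner_self_ne_zero.2 hf)]
    rw [h1]
    exact (continuous_const.inner (hc f)).div_const _
  refine ⟨⟨⟨⟨fun k => ⟨c k, by simp [Submonoid.unitSphere, hnorm]⟩, ?_⟩, ?_⟩, ?_⟩, fun k => hcc k⟩
  · exact Subtype.ext hone
  · intro a b
    exact Subtype.ext (hmul a b)
  · exact hcon.subtype_mk _

variable [IsTopologicalGroup K] [CompactSpace K] [T2Space K]

/-- Normalized Haar measure facts packaged. -/
theorem exists_haar (K : Type*) [CommGroup K] [TopologicalSpace K] [IsTopologicalGroup K] [CompactSpace K]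
    [T2Space K] [MeasurableSpace K] [BorelSpace K] :
    ∃ μ : Measure K, IsProbabilityMeasure μ ∧ μ.IsHaarMeasure ∧ μ.Regular := by
  refine ⟨Measure.haarMeasure ⊤, ⟨?_⟩, inferInstance, inferInstance⟩
  have := Measure.haarMeasure_self (K₀ := (⊤ : TopologicalSpace.PositiveCompacts K))
  simpa using this

theorem regular_rep (K : Type*) [CommGroup K] [TopologicalSpace K] [IsTopologicalGroup K] [CompactSpace K]
    [T2Space K] [MeasurableSpace K] [BorelSpace K] (μ : Measure K) [IsProbabilityMeasure μ]
    [μ.IsHaarMeasure] [μ.Regular] :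
    ∃ U : K →* (Lp ℂ 2 μ →L[ℂ] Lp ℂ 2 μ), (∀ k f g, inner ℂ (U k f) (U k g) = inner ℂ f g) ∧
      (∀ f, Continuous fun k => U k f) ∧ ∀ k, U k = 1 → k = 1 := by
  let V : K → (Lp ℂ 2 μ →ₗᵢ[ℂ] Lp ℂ 2 μ) := fun k =>
    { toFun := fun f => DomMulAct.mk k • f
      map_add' := fun f g => smul_add _ f g
      map_smul' := fun c f => smul_comm _ c f
      norm_map' := fun f => DomMulAct.norm_smul_Lp _ f }
  have hV : ∀ k f, V k f = DomMulAct.mk k • f := fun _ _ => rfl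
  let U : K →* (Lp ℂ 2 μ →L[ℂ] Lp ℂ 2 μ) :=
    { toFun := fun k => (V k).toContinuousLinearMap
      map_one' := by
        refine ContinuousLinearMap.ext fun f => ?_
        show DomMulAct.mk (1 : K) • f = f
        rw [DomMulAct.mk_one, one_smul]
      map_mul' := by
        intro a b
        refine ContinuousLinearMap.ext fun f => ?_
        show DomMulAct.mk (a * b) • f = DomMulAct.mk a • DomMulAct.mk b • f
        rw [mul_comm, DomMulAct.mk_mul, mul_smul] }
  have hU : ∀ k f, U k f = DomMulAct.mk k • f := fun _ _ => rfl
  refine ⟨U, fun k f g => (V k).inner_map_map f g, fun f => ?_, fun k hk => ?_⟩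
  · simp_rw [hU]
    have h1 : Continuous fun k : K => (DomMulAct.mk k : Kᵈᵐᵃ) := DomMulAct.continuous_mk
    have : Fact ((2 : ENNReal) ≠ ⊤) := ⟨by simp⟩
    exact h1.smul continuous_const
  · by_contra hne
    obtain ⟨F, hF0, hF1, -⟩ := exists_continuous_zero_one_of_isClosed (isClosed_singleton (x := (1 : K)))
      (isClosed_singleton (x := k)) (by simpa using Ne.symm hne)
    let G : C(K, ℂ) := ⟨fun x => (F x : ℂ), by fun_prop⟩
    let G' : C(K, ℂ) := ⟨fun x => (F (k * x) : ℂ), by fun_prop⟩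
    have h1 : ContinuousMap.toLp (E := ℂ) 2 μ ℂ G' = ContinuousMap.toLp (E := ℂ) 2 μ ℂ G := by
      have h2 : U k (ContinuousMap.toLp (E := ℂ) 2 μ ℂ G) = ContinuousMap.toLp (E := ℂ) 2 μ ℂ G := by
        rw [hk]; rfl
      rw [← h2, hU]
      apply Lp.ext
      have h3 := DomMulAct.smul_Lp_ae_eq (DomMulAct.mk k) (ContinuousMap.toLp (E := ℂ) 2 μ ℂ G)
      have h4 := ContinuousMap.coeFn_toLp (𝕜 := ℂ) (p := 2) μ G'
      have h5 := ContinuousMap.coeFn_toLp (𝕜 := ℂ) (p := 2) μ G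
      have h6 := (measurePreserving_mul_left μ k).quasiMeasurePreserving.ae_eq_comp h5
      filter_upwards [h3, h4, h6] with x h3 h4 h6
      rw [h3, h4]
      exact h6.symm
    have h2 := ContinuousMap.toLp_injective μ h1
    have h3 := congrArg (fun f : C(K, ℂ) => f 1) h2
    simp only [G, G', ContinuousMap.coe_mk, mul_one] at h3
    rw [hF0 (Set.mem_singleton _), hF1 (Set.mem_singleton _)] at h3
    simp at h3

theorem peter_weyl {k : K} (hk : k ≠ 1) : ∃ χ : K →ₜ* Circle, χ k ≠ 1 := by
  by_contra hcon
  push Not at hcon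
  borelize K
  obtain ⟨μ, i1, i2, i3⟩ := exists_haar K
  obtain ⟨U, hn, hc, hfa⟩ := regular_rep K μ
  let F : Submodule ℂ (Lp ℂ 2 μ) := LinearMap.ker ((U k - 1 : Lp ℂ 2 μ →L[ℂ] Lp ℂ 2 μ) : Lp ℂ 2 μ →ₗ[ℂ] Lp ℂ 2 μ)
  have hF : ∀ f, f ∈ F ↔ U k f = f := by
    intro f
    simp [F, sub_eq_zero]
  have hFc : IsClosed (F : Set (Lp ℂ 2 μ)) := ContinuousLinearMap.isClosed_ker _
  have : CompleteSpace F := hFc.completeSpace_coe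
  have hcomm : ∀ i j f, U i (U j f) = U j (U i f) := by
    intro i j f
    rw [← mul_apply_eq_comp, ← mul_apply_eq_comp, ← map_mul, ← map_mul, mul_comm]
  obtain ⟨f, hf, hf0, he⟩ := exists_common_eigen μ U hn hc Fᗮ (Submodule.isClosed_orthogonal F) (by
    intro j f hf
    rw [Submodule.mem_orthogonal] at hf ⊢
    intro u hu
    rw [← hn j⁻¹, ← mul_apply_eq_comp, ← map_mul, inv_mul_cancel, map_one]
    refine hf _ ((hF _).2 ?_)
    rw [hcomm, (hF _).1 hu]) (by
    intro h
    rw [Submodule.orthogonal_eq_bot_iff] at h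
    refine hk (hfa k (ContinuousLinearMap.ext fun f => ?_))
    exact (hF f).1 (h ▸ Submodule.mem_top))
  obtain ⟨χ, hχ⟩ := char_of_eigen U hn hc hf0 he
  have h1 : f ∈ F := by
    rw [hF, hχ, hcon χ]
    simp
  have := Submodule.mem_orthogonal F f |>.1 hf f h1
  exact hf0 (inner_self_eq_zero.1 this)
end

open MeasureTheory Topology Filter
set_option linter.unusedSectionVars false
section
variable {K : Type*} [CommGroup K] [TopologicalSpace K]

/-- A character as a continuous function. -/
noncomputable def chFun (χ : K →ₜ* Circle) : C(K, ℂ) := ⟨fun x => (χ x : ℂ), by fun_prop⟩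

theorem chFun_apply (χ : K →ₜ* Circle) (x : K) : chFun χ x = (χ x : ℂ) := rfl

theorem char_pow_apply (χ : K →ₜ* Circle) (p : ℕ) (x : K) : (χ ^ p) x = χ x ^ p := by
  induction p with
  | zero => rw [pow_zero, pow_zero]; rfl
  | succ p ih => rw [pow_succ, pow_succ, ← ih]; rfl

variable [IsTopologicalGroup K] [CompactSpace K] [T2Space K]

theorem integral_char [MeasurableSpace K] [BorelSpace K] (μ : Measure K) [IsProbabilityMeasure μ]
    [μ.IsMulLeftInvariant] (χ : K →ₜ* Circle) (hχ : χ ≠ 1) : ∫ x, (χ x : ℂ) ∂μ = 0 := by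
  have : ∃ y, χ y ≠ 1 := by
    by_contra h
    push Not at h
    exact hχ (ContinuousMonoidHom.ext h)
  obtain ⟨y, hy⟩ := this
  have h1 : ∫ x, (χ (y * x) : ℂ) ∂μ = ∫ x, (χ x : ℂ) ∂μ :=
    integral_mul_left_eq_self (fun x => (χ x : ℂ)) y
  have h2 : ∫ x, (χ (y * x) : ℂ) ∂μ = (χ y : ℂ) * ∫ x, (χ x : ℂ) ∂μ := by
    rw [← integral_const_mul]
    simp
  have h3 : ((χ y : ℂ) - 1) * ∫ x, (χ x : ℂ) ∂μ = 0 := by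
    rw [sub_mul, ← h2, h1]; ring
  rcases mul_eq_zero.1 h3 with h | h
  · exact absurd (Subtype.ext (by simpa using sub_eq_zero.1 h)) hy
  · exact h

theorem chars_eq_top (Γ : Subgroup (K →ₜ* Circle)) (hsep : ∀ x : K, x ≠ 1 → ∃ χ ∈ Γ, χ x ≠ 1)
    (ξ : K →ₜ* Circle) : ξ ∈ Γ := by
  by_contra hξ
  borelize K
  obtain ⟨μ, i1, i2, i3⟩ := exists_haar K
  let S : Submonoid C(K, ℂ) :=
    { carrier := {f | ∃ χ ∈ Γ, f = chFun χ}
      one_mem' := ⟨1, Γ.one_mem, by ext x; simp [chFun_apply]⟩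
      mul_mem' := by
        rintro _ _ ⟨a, ha, rfl⟩ ⟨b, hb, rfl⟩
        exact ⟨a * b, Γ.mul_mem ha hb, by ext x; simp [chFun_apply]⟩ }
  have hstar : star (S : Set C(K, ℂ)) ⊆ S := by
    intro f hf
    obtain ⟨a, ha, h⟩ := hf
    refine ⟨a⁻¹, Γ.inv_mem ha, ?_⟩
    rw [← star_star f, h]
    ext x
    show (starRingEnd ℂ) (a x : ℂ) = (((a x)⁻¹ : Circle) : ℂ)
    rw [Circle.coe_inv_eq_conj]
  let A : StarSubalgebra ℂ C(K, ℂ) := StarAlgebra.adjoin ℂ (S : Set C(K, ℂ))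
  have hA : ∀ f ∈ A, f ∈ Submodule.span ℂ (S : Set C(K, ℂ)) := by
    intro f hf
    have h1 : f ∈ A.toSubalgebra := hf
    rw [StarAlgebra.adjoin_toSubalgebra, Set.union_eq_self_of_subset_right hstar] at h1
    have h2 : f ∈ (Algebra.adjoin ℂ (S : Set C(K, ℂ))).toSubmodule := h1
    rwa [Algebra.adjoin_eq_span, Submonoid.closure_eq] at h2
  have hAs : A.SeparatesPoints := by
    intro x y hxy
    obtain ⟨χ, hχ, h⟩ := hsep (x * y⁻¹) (by rwa [Ne, mul_inv_eq_one])
    refine ⟨chFun χ, ⟨chFun χ, StarAlgebra.subset_adjoin ℂ _ ⟨χ, hχ, rfl⟩, rfl⟩, ?_⟩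
    intro heq
    rw [chFun_apply, chFun_apply] at heq
    apply h
    rw [map_mul, map_inv, mul_inv_eq_one]
    exact Subtype.ext heq
  have htop := ContinuousMap.starSubalgebra_topologicalClosure_eq_top_of_separatesPoints A hAs
  have hmem : chFun ξ ∈ closure (A : Set C(K, ℂ)) := by
    rw [← StarSubalgebra.topologicalClosure_coe, htop]
    trivial
  obtain ⟨f, hf, hd⟩ := Metric.mem_closure_iff.1 hmem 1 one_pos
  have hint : ∀ f : C(K, ℂ), Integrable (fun x => f x * (ξ⁻¹ x : ℂ)) μ := by
    intro f
    exact Continuous.integrable_of_hasCompactSupport (by fun_prop) (HasCompactSupport.of_compactSpace _)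
  have hzero : ∫ x, f x * (ξ⁻¹ x : ℂ) ∂μ = 0 := by
    have := hA f hf
    clear hd hf
    induction this using Submodule.span_induction with
    | mem f hf =>
      obtain ⟨χ, hχ, rfl⟩ := hf
      have h1 := integral_char μ (χ * ξ⁻¹) (by
        intro h
        rw [mul_inv_eq_one] at h
        exact hξ (h ▸ hχ))
      rw [← h1]
      congr 1
    | zero => simp
    | add f g _ _ h1 h2 =>
      simp only [ContinuousMap.add_apply, add_mul]
      rw [integral_add (hint f) (hint g), h1, h2, add_zero]
    | smul c f _ h =>
      simp only [ContinuousMap.smul_apply, smul_eq_mul, mul_assoc]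
      rw [integral_const_mul, h, mul_zero]
  have hone : ∫ x, (chFun ξ) x * (ξ⁻¹ x : ℂ) ∂μ = 1 := by
    have : ∀ x, (chFun ξ) x * (ξ⁻¹ x : ℂ) = 1 := by
      intro x
      have h0 : ξ x * ξ⁻¹ x = 1 := mul_inv_cancel (ξ x)
      rw [chFun_apply, ← Circle.coe_mul, h0, Circle.coe_one]
    simp [this]
  have h1 : ‖∫ x, (chFun ξ - f) x * (ξ⁻¹ x : ℂ) ∂μ‖ ≤ dist (chFun ξ) f := by
    have := norm_integral_le_of_norm_le_const (μ := μ) (f := fun x => (chFun ξ - f) x * (ξ⁻¹ x : ℂ))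
      (C := dist (chFun ξ) f) (Eventually.of_forall fun x => by
        rw [norm_mul, Circle.norm_coe, mul_one, dist_eq_norm]
        exact ContinuousMap.norm_coe_le_norm _ x)
    simpa using this
  have h2 : ∫ x, (chFun ξ - f) x * (ξ⁻¹ x : ℂ) ∂μ = 1 := by
    simp only [ContinuousMap.sub_apply, sub_mul]
    rw [integral_sub (hint _) (hint _), hone, hzero, sub_zero]
  rw [h2, norm_one] at h1
  linarith

/-- If `ξ` is trivial on the common kernel of `Γ` then `ξ ∈ Γ`. -/
theorem mem_chars_of_ker (Γ : Subgroup (K →ₜ* Circle)) (ξ : K →ₜ* Circle)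
    (h : ∀ x : K, (∀ χ ∈ Γ, χ x = 1) → ξ x = 1) : ξ ∈ Γ := by
  let N : Subgroup K :=
    { carrier := {x | ∀ χ ∈ Γ, χ x = 1}
      one_mem' := fun χ _ => map_one χ
      mul_mem' := fun ha hb χ hχ => by rw [map_mul, ha χ hχ, hb χ hχ, one_mul]
      inv_mem' := fun ha χ hχ => by rw [map_inv, ha χ hχ, inv_one] }
  have hNc : IsClosed (N : Set K) := by
    have : (N : Set K) = ⋂ χ ∈ Γ, {x | χ x = 1} := by
      ext x; simp [N]
    rw [this]
    exact isClosed_biInter fun χ _ => isClosed_eq χ.continuous_toFun continuous_const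
  have hlift : ∀ χ : K →ₜ* Circle, (∀ x ∈ N, χ x = 1) → ∃ χ' : (K ⧸ N) →ₜ* Circle, ∀ x : K, χ' x = χ x := by
    intro χ hχ
    refine ⟨⟨QuotientGroup.lift N χ.toMonoidHom hχ, ?_⟩, fun x => rfl⟩
    exact Continuous.quotient_lift χ.continuous_toFun _
  let pb : ((K ⧸ N) →ₜ* Circle) →* (K →ₜ* Circle) :=
    { toFun := fun χ => χ.comp ⟨QuotientGroup.mk' N, QuotientGroup.continuous_mk⟩
      map_one' := rfl
      map_mul' := fun _ _ => rfl }
  have hpb : ∀ χ (x : K), pb χ x = χ (x : K ⧸ N) := fun _ _ => rfl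
  obtain ⟨ξ', hξ'⟩ := hlift ξ h
  have : IsClosed (N : Set K) := hNc
  have h1 := chars_eq_top (Γ.comap pb) (by
    intro q hq
    obtain ⟨x, rfl⟩ := QuotientGroup.mk_surjective q
    have hx : x ∉ N := fun hx => hq ((QuotientGroup.eq_one_iff x).2 hx)
    have : ∃ χ ∈ Γ, χ x ≠ 1 := by
      by_contra hc
      push Not at hc
      exact hx hc
    obtain ⟨χ, hχ, hne⟩ := this
    obtain ⟨χ', hχ'⟩ := hlift χ fun y hy => hy χ hχ
    refine ⟨χ', ?_, by rw [hχ']; exact hne⟩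
    show pb χ' ∈ Γ
    have : pb χ' = χ := ContinuousMonoidHom.ext fun y => hχ' y
    rw [this]; exact hχ) ξ'
  have : pb ξ' = ξ := ContinuousMonoidHom.ext fun y => hξ' y
  rw [← this]; exact h1

/-- Characters trivial on a closed subgroup separate points from it. -/
theorem peter_weyl_rel (N : Subgroup K) (hN : IsClosed (N : Set K)) {k : K} (hk : k ∉ N) :
    ∃ χ : K →ₜ* Circle, (∀ x ∈ N, χ x = 1) ∧ χ k ≠ 1 := by
  have : IsClosed (N : Set K) := hN
  obtain ⟨χ, hχ⟩ := peter_weyl (K := K ⧸ N) (k := (k : K ⧸ N)) (fun h => hk ((QuotientGroup.eq_one_iff k).1 h))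
  refine ⟨χ.comp ⟨QuotientGroup.mk' N, QuotientGroup.continuous_mk⟩, fun x hx => ?_, hχ⟩
  show χ (x : K ⧸ N) = 1
  rw [(QuotientGroup.eq_one_iff x).2 hx, map_one]

theorem fg_divisible_trivial {A : Type*} [AddCommGroup A] [hfg : Module.Finite ℤ A]
    (hd : ∀ p : ℕ, 0 < p → ∀ a : A, ∃ b, p • b = a) (a : A) : a = 0 := by
  obtain ⟨r, hr, hk⟩ := Submodule.exists_sub_one_mem_and_smul_eq_zero_of_fg_of_le_smul
    (Ideal.span {(2 : ℤ)}) (⊤ : Submodule ℤ A) hfg.fg_top (by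
      intro x _
      obtain ⟨b, rfl⟩ := hd 2 two_pos x
      rw [← natCast_zsmul]
      exact Submodule.smul_mem_smul (Ideal.mem_span_singleton_self _) trivial)
  have hr0 : r ≠ 0 := by
    rintro rfl
    rw [Ideal.mem_span_singleton] at hr
    omega
  obtain ⟨b, hb⟩ := hd r.natAbs (Int.natAbs_pos.2 hr0) a
  have h1 := hk b trivial
  rw [← hb]
  rcases Int.natAbs_eq r with h | h
  · rw [← natCast_zsmul, ← h, h1]
  · rw [h, neg_smul, neg_eq_zero] at h1
    rw [← natCast_zsmul, h1]

theorem compact_abelian_trivial (N : Subgroup K) (hN : IsClosed (N : Set K)) (P : Set K) (hP : P ∈ 𝓝 (1 : K))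
    (hsm : ∀ H : Subgroup K, (H : Set K) ⊆ P → H ≤ N)
    (htf : ∀ m : ℕ, 0 < m → ∀ k, k ^ m ∈ N → k ∈ N) : N = ⊤ := by
  -- finitely many characters with common kernel in P
  obtain ⟨O, hOP, hO, h1O⟩ := mem_nhds_iff.1 hP
  have hcomp : IsCompact Oᶜ := hO.isClosed_compl.isCompact
  obtain ⟨t, ht⟩ := hcomp.elim_finite_subcover (fun χ : K →ₜ* Circle => {x | χ x ≠ 1})
    (fun χ => isOpen_ne_fun χ.continuous_toFun continuous_const) (by
      intro x hx
      obtain ⟨χ, hχ⟩ := peter_weyl (k := x) (fun h => hx (h ▸ h1O))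
      exact Set.mem_iUnion.2 ⟨χ, hχ⟩)
  let Γ : Subgroup (K →ₜ* Circle) := Subgroup.closure (t : Set (K →ₜ* Circle))
  let H0 : Subgroup K :=
    { carrier := {x | ∀ χ ∈ Γ, χ x = 1}
      one_mem' := fun χ _ => map_one χ
      mul_mem' := fun ha hb χ hχ => by rw [map_mul, ha χ hχ, hb χ hχ, one_mul]
      inv_mem' := fun ha χ hχ => by rw [map_inv, ha χ hχ, inv_one] }
  have hH0 : H0 ≤ N := by
    refine hsm H0 fun x hx => hOP ?_
    by_contra hxO
    obtain ⟨χ, hχ, hne⟩ := Set.mem_iUnion₂.1 (ht hxO)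
    exact hne (hx χ (Subgroup.subset_closure hχ))
  let D : Subgroup (K →ₜ* Circle) :=
    { carrier := {χ | ∀ x ∈ N, χ x = 1}
      one_mem' := fun _ _ => rfl
      mul_mem' := fun {a b} ha hb x hx => by
        show a x * b x = 1
        rw [ha x hx, hb x hx, one_mul]
      inv_mem' := fun {a} ha x hx => by
        show (a x)⁻¹ = 1
        rw [ha x hx, inv_one] }
  have hDΓ : D ≤ Γ := fun ξ hξ => mem_chars_of_ker Γ ξ fun x hx => hξ x (hH0 hx)
  have hdiv : ∀ p : ℕ, 0 < p → ∀ ξ ∈ D, ∃ τ ∈ D, τ ^ p = ξ := by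
    intro p hp ξ hξ
    have : ξ ∈ D.map (powMonoidHom p) := by
      refine mem_chars_of_ker _ ξ fun x hx => hξ x (htf p hp x ?_)
      by_contra hn
      obtain ⟨χ, h1, h2⟩ := peter_weyl_rel N hN hn
      have := hx (χ ^ p) ⟨χ, h1, rfl⟩
      apply h2
      rw [map_pow, ← char_pow_apply]
      exact this
    obtain ⟨τ, h1, h2⟩ := this
    exact ⟨τ, h1, h2⟩
  have hfgΓ : Group.FG Γ := (Group.fg_iff_subgroup_fg Γ).2 ⟨t, rfl⟩
  have hfin : Module.Finite ℤ (Additive Γ) := Module.Finite.iff_addGroup_fg.2 inferInstance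
  let j : Additive D →ₗ[ℤ] Additive Γ := (MonoidHom.toAdditive (Subgroup.inclusion hDΓ)).toIntLinearMap
  have hj : Function.Injective j := Subgroup.inclusion_injective hDΓ
  have hfinD : Module.Finite ℤ (Additive D) := Module.Finite.of_injective j hj
  have htriv : ∀ ξ ∈ D, ξ = 1 := by
    intro ξ hξ
    have := fg_divisible_trivial (A := Additive D) (by
      intro p hp a
      obtain ⟨τ, h1, h2⟩ := hdiv p hp (a.toMul : K →ₜ* Circle) a.toMul.2
      exact ⟨Additive.ofMul ⟨τ, h1⟩, Additive.toMul.injective (Subtype.ext h2)⟩) (Additive.ofMul ⟨ξ, hξ⟩)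
    exact congrArg Subtype.val (congrArg Additive.toMul this)
  rw [eq_top_iff]
  intro k _
  by_contra hk
  obtain ⟨χ, h1, h2⟩ := peter_weyl_rel N hN hk
  rw [htriv χ h1] at h2
  exact h2 rfl
end

open MeasureTheory Topology Filter
set_option linter.unusedSectionVars false
section
variable {X : Type*} [MetricSpace X]

theorem isom_inducing : IsInducing (fun g : X ≃ᵢ X => (⇑g : X → X)) := ⟨rfl⟩

theorem isom_continuous_eval (x : X) : Continuous fun g : X ≃ᵢ X => g x :=
  (continuous_apply x).comp isom_inducing.continuous

theorem isom_continuous_iff {Z : Type*} [TopologicalSpace Z] {F : Z → X ≃ᵢ X} :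
    Continuous F ↔ ∀ x, Continuous fun z => F z x := by
  rw [isom_inducing.continuous_iff, continuous_pi_iff]
  rfl

theorem isom_topGroup (X : Type*) [MetricSpace X] : IsTopologicalGroup (X ≃ᵢ X) where
  continuous_mul := by
    rw [isom_continuous_iff]
    intro x
    rw [continuous_iff_continuousAt]
    rintro ⟨g, h⟩
    rw [ContinuousAt, tendsto_iff_dist_tendsto_zero]
    have h1 : Continuous fun q : (X ≃ᵢ X) × (X ≃ᵢ X) => dist (q.2 x) (h x) + dist (q.1 (h x)) (g (h x)) :=
      (((isom_continuous_eval x).comp continuous_snd).dist continuous_const).add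
        (((isom_continuous_eval (h x)).comp continuous_fst).dist continuous_const)
    have h2 := h1.tendsto (g, h)
    simp only [dist_self, add_zero] at h2
    refine squeeze_zero (fun _ => dist_nonneg) (fun q => ?_) h2
    have h3 : dist (q.1 (q.2 x)) (q.1 (h x)) = dist (q.2 x) (h x) := q.1.dist_eq _ _
    show dist (q.1 (q.2 x)) (g (h x)) ≤ _
    rw [← h3]
    exact dist_triangle _ _ _
  continuous_inv := by
    rw [isom_continuous_iff]
    intro x
    rw [continuous_iff_continuousAt]
    intro g
    rw [ContinuousAt, tendsto_iff_dist_tendsto_zero]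
    have h1 : Continuous fun q : X ≃ᵢ X => dist x (q (g⁻¹ x)) :=
      continuous_const.dist (isom_continuous_eval _)
    have h2 := h1.tendsto g
    have h4 : g (g⁻¹ x) = x := g.apply_symm_apply x
    rw [h4, dist_self] at h2
    refine h2.congr fun q => ?_
    have h3 : dist (q (q⁻¹ x)) (q (g⁻¹ x)) = dist (q⁻¹ x) (g⁻¹ x) := q.dist_eq _ _
    have h5 : q (q⁻¹ x) = x := q.apply_symm_apply x
    rw [← h3, h5]

theorem isom_t2 (X : Type*) [MetricSpace X] : T2Space (X ≃ᵢ X) :=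
  T2Space.of_injective_continuous (f := fun g : X ≃ᵢ X => (⇑g : X → X)) DFunLike.coe_injective
    isom_inducing.continuous

theorem isom_compact (Y : Type*) [MetricSpace Y] [CompactSpace Y] : CompactSpace (Y ≃ᵢ Y) := by
  have := isom_topGroup Y
  let F : (Y ≃ᵢ Y) → (Y → Y) × (Y → Y) := fun g => (⇑g, ⇑g⁻¹)
  have hFc : Continuous F := isom_inducing.continuous.prodMk (isom_inducing.continuous.comp continuous_inv)
  have hF : IsInducing F := by
    refine IsInducing.of_comp hFc continuous_fst ?_
    exact isom_inducing
  have hr : Set.range F = ⋂ (x : Y), ⋂ (y : Y), {q : (Y → Y) × (Y → Y) | dist (q.1 x) y = dist x (q.2 y) ∧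
      dist (q.1 x) (q.1 y) = dist x y} := by
    ext q
    simp only [Set.mem_iInter, Set.mem_ofPred_eq, Set.mem_range]
    constructor
    · rintro ⟨g, rfl⟩ x y
      refine ⟨?_, g.dist_eq x y⟩
      have h3 : dist (g x) (g (g⁻¹ y)) = dist x (g⁻¹ y) := g.dist_eq _ _
      have h5 : g (g⁻¹ y) = y := g.apply_symm_apply y
      rw [h5] at h3
      exact h3
    · intro h
      have h1 : ∀ y, q.1 (q.2 y) = y := fun y => by
        have := (h (q.2 y) y).1
        rw [dist_self] at this
        exact dist_eq_zero.1 this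
      have h2 : ∀ x, q.2 (q.1 x) = x := fun x => by
        have := (h x (q.1 x)).1
        rw [dist_self] at this
        exact (dist_eq_zero.1 this.symm).symm
      exact ⟨⟨⟨q.1, q.2, h2, h1⟩, Isometry.of_dist_eq fun x y => (h x y).2⟩, rfl⟩
  have hcl : IsClosed (Set.range F) := by
    rw [hr]
    refine isClosed_iInter fun x => isClosed_iInter fun y => ?_
    refine IsClosed.inter (isClosed_eq ?_ ?_) (isClosed_eq ?_ ?_) <;> fun_prop
  refine ⟨?_⟩
  rw [hF.isCompact_iff, Set.image_univ]
  exact hcl.isCompact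

/-- Control of the displacement on a compact set. -/
theorem isom_nhds_one {C : Set X} (hC : IsCompact C) {ε : ℝ} (hε : 0 < ε) :
    {g : X ≃ᵢ X | ∀ u ∈ C, dist (g u) u ≤ ε} ∈ 𝓝 (1 : X ≃ᵢ X) := by
  obtain ⟨t, -, htf, htC⟩ := hC.finite_cover_balls (e := ε / 3) (by positivity)
  have h1 : ∀ᶠ g : X ≃ᵢ X in 𝓝 1, ∀ y ∈ t, dist (g y) y < ε / 3 := by
    rw [htf.eventually_all]
    intro y _
    have h2 : Continuous fun g : X ≃ᵢ X => dist (g y) y := (isom_continuous_eval y).dist continuous_const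
    have h3 := h2.tendsto 1
    refine h3.eventually_lt_const ?_
    show dist y y < ε / 3
    rw [dist_self]; positivity
  filter_upwards [h1] with g hg u hu
  obtain ⟨y, hy, hyu⟩ := Set.mem_iUnion₂.1 (htC hu)
  rw [Metric.mem_ball] at hyu
  have h2 := hg y hy
  have h3 : dist (g u) (g y) = dist u y := g.dist_eq u y
  have h4 := dist_triangle4 (g u) (g y) y u
  rw [dist_comm y u] at h4
  linarith

theorem compact_abelian_sub {G : Type*} [Group G] [TopologicalSpace G] [IsTopologicalGroup G]
    [CompactSpace G] [T2Space G] (g : G) (F : Subgroup G) (hF : IsClosed (F : Set G)) (P : Set G)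
    (hP : P ∈ 𝓝 (1 : G))
    (hsm : ∀ H : Subgroup G, H ≤ (Subgroup.zpowers g).topologicalClosure → (H : Set G) ⊆ P → H ≤ F)
    (htf : ∀ m : ℕ, 0 < m → ∀ k ∈ (Subgroup.zpowers g).topologicalClosure, k ^ m ∈ F → k ∈ F) : g ∈ F := by
  let K := (Subgroup.zpowers g).topologicalClosure
  let _ : CommGroup K := Subgroup.commGroupTopologicalClosure _ (by
    rintro ⟨_, i, rfl⟩ ⟨_, j, rfl⟩
    exact Subtype.ext (zpow_mul_comm g i j))
  have hKc : IsClosed (K : Set G) := Subgroup.isClosed_topologicalClosure _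
  have : CompactSpace K := isCompact_iff_compactSpace.1 hKc.isCompact
  have key := compact_abelian_trivial (K := K) (F.comap K.subtype) (hF.preimage continuous_subtype_val)
    (Subtype.val ⁻¹' P) (continuous_subtype_val.continuousAt.preimage_mem_nhds hP) (by
      intro H hH k hk
      refine hsm (H.map K.subtype) ?_ ?_ ⟨k, hk, rfl⟩
      · rintro _ ⟨a, _, rfl⟩
        exact a.2
      · rintro _ ⟨a, ha, rfl⟩
        exact hH ha) (by
      intro m hm k hk
      exact htf m hm k.1 k.2 hk)
  have hg : g ∈ K := Subgroup.le_topologicalClosure _ (Subgroup.mem_zpowers g)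
  have : (⟨g, hg⟩ : K) ∈ F.comap K.subtype := by rw [key]; trivial
  exact this
end

open MeasureTheory Topology Filter
set_option linter.unusedSectionVars false
section
variable {E : Type*} [NormedAddCommGroup E] [InnerProductSpace ℝ E] [FiniteDimensional ℝ E]
  [MeasurableSpace E] [BorelSpace E]

theorem isom_pow_apply {Y : Type*} [MetricSpace Y] (k : Y ≃ᵢ Y) (n : ℕ) (z : Y) :
    (k ^ n) z = (⇑k)^[n] z := by
  induction n with
  | zero => rfl
  | succ n ih =>
    rw [pow_succ', Function.iterate_succ_apply', ← ih]; rfl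

theorem local_fix {Y : Type*} [MetricSpace Y] [CompactSpace Y] (hY : IsCAT0 Y) (x : Y) {s : ℝ}
    (hs : 0 < s) (φ : Y → E) (hφ : Continuous φ) (hφi : Function.Injective φ)
    (hφo : ∀ O : Set Y, IsOpen O → O ⊆ Metric.ball x s → IsOpen (φ '' O))
    (g : Y ≃ᵢ Y) (hgx : g x = x) (A : Set Y) (hA : IsOpen A) (hgA : ∀ a ∈ A, g a = a)
    (hxA : x ∈ closure A) : ∃ O ∈ 𝓝 x, ∀ u ∈ O, g u = u := by
  have i1 := isom_topGroup Y
  have i2 := isom_t2 Y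
  have i3 := isom_compact Y
  obtain ⟨ε, hε, O, hO, hsmall⟩ := small_group_fix hY hs (x := x) (Metric.isClosed_closedBall.isCompact)
    hφ.continuousOn hφi.injOn (by
      refine Filter.mem_of_superset ((hφo _ Metric.isOpen_ball (Metric.ball_subset_ball (by linarith : s / 2 ≤ s))).mem_nhds
        ⟨x, Metric.mem_ball_self (by positivity), rfl⟩) (Set.image_mono Metric.ball_subset_closedBall))
  obtain ⟨r0, hr0, hrO⟩ := Metric.mem_nhds_iff.1 hO
  obtain ⟨r, hr, hrO, hrs⟩ : ∃ r > 0, Metric.ball x r ⊆ O ∧ r ≤ s :=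
    ⟨min r0 s, lt_min hr0 hs, (Metric.ball_subset_ball (min_le_left _ _)).trans hrO, min_le_right _ _⟩
  let B := Metric.ball x r
  have hBs : B ⊆ Metric.ball x s := Metric.ball_subset_ball hrs
  have hxB : x ∈ B := Metric.mem_ball_self hr
  let Ω := connectedComponentIn (φ '' B) (φ x)
  have hΩo : IsOpen Ω := (hφo B Metric.isOpen_ball hBs).connectedComponentIn
  have hΩp : IsPreconnected Ω := isPreconnected_connectedComponentIn
  have hxΩ : φ x ∈ Ω := mem_connectedComponentIn ⟨x, hxB, rfl⟩
  have hΩB : Ω ⊆ φ '' B := connectedComponentIn_subset _ _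
  let Z := φ ⁻¹' Ω
  have hZo : IsOpen Z := hΩo.preimage hφ
  have hxZ : x ∈ Z := hxΩ
  have hZB : Z ⊆ B := by
    intro z hz
    obtain ⟨y, hy, h⟩ := hΩB hz
    exact hφi h ▸ hy
  -- elements of the closure fix `x` and `A`
  have hK : ∀ k ∈ (Subgroup.zpowers g).topologicalClosure, ∀ a, g a = a → k a = a := by
    intro k hk a ha
    have hcl : IsClosed {k : Y ≃ᵢ Y | k a = a} := isClosed_eq (isom_continuous_eval a) continuous_const
    have hsub : ((Subgroup.zpowers g : Subgroup (Y ≃ᵢ Y)) : Set (Y ≃ᵢ Y)) ⊆ {k : Y ≃ᵢ Y | k a = a} := by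
      let S : Subgroup (Y ≃ᵢ Y) :=
        { carrier := {k | k a = a}
          one_mem' := rfl
          mul_mem' := fun {b c} hb hc => by
            have hb' : b a = a := hb
            have hc' : c a = a := hc
            show b (c a) = a
            rw [hc', hb']
          inv_mem' := fun {b} hb => by
            have hb' : b a = a := hb
            have h1 : b.symm (b a) = a := b.symm_apply_apply a
            rw [hb'] at h1
            exact h1 }
      have h1 : Subgroup.zpowers g ≤ S := by
        rw [Subgroup.zpowers_le]
        exact ha
      intro k hk
      exact h1 hk
    exact closure_minimal hsub hcl hk
  have hne : Nonempty Y := ⟨x⟩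
  let ψ := Function.invFun φ
  have hψ : ∀ y, ψ (φ y) = y := Function.leftInverse_invFun hφi
  have hψc : ContinuousOn ψ (Set.range φ) := by
    have h1 := continuousOn_invFunOn_compact (isCompact_univ (X := Y)) hφ.continuousOn (hφi.injOn)
    rw [Set.image_univ] at h1
    refine h1.congr ?_
    rintro _ ⟨y, rfl⟩
    rw [hψ]
    refine hφi ?_
    rw [Function.invFunOn_eq (f := φ) (s := Set.univ) (b := φ y) ⟨y, Set.mem_univ y, rfl⟩]
  have hΩr : Ω ⊆ Set.range φ := hΩB.trans (Set.image_subset_range _ _)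
  let F : Subgroup (Y ≃ᵢ Y) :=
    { carrier := {k | ∀ z ∈ Z, k z = z}
      one_mem' := fun _ _ => rfl
      mul_mem' := fun {a b} ha hb z hz => by
        show a (b z) = z
        rw [hb z hz, ha z hz]
      inv_mem' := fun {a} ha z hz => by
        have h1 : a.symm (a z) = z := a.symm_apply_apply z
        rw [ha z hz] at h1
        exact h1 }
  have hFm : ∀ k, k ∈ F ↔ ∀ z ∈ Z, k z = z := fun _ => Iff.rfl
  have hFc : IsClosed (F : Set (Y ≃ᵢ Y)) := by
    have : (F : Set (Y ≃ᵢ Y)) = ⋂ z ∈ Z, {k | k z = z} := by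
      ext k
      simp [hFm]
    rw [this]
    exact isClosed_biInter fun z _ => isClosed_eq (isom_continuous_eval z) continuous_const
  have hprime : ∀ p : ℕ, p.Prime → ∀ k ∈ (Subgroup.zpowers g).topologicalClosure, k ^ p ∈ F → k ∈ F := by
    intro p hp k hk hkp
    let t : E → E := fun e => φ (k (ψ e))
    have ht : ∀ y, t (φ y) = φ (k y) := fun y => by simp only [t, hψ]
    have htc : ContinuousOn t Ω := (hφ.comp k.continuous).comp_continuousOn (hψc.mono hΩr)
    have hkx : k x = x := hK k hk x hgx
    have htm : Set.MapsTo t Ω Ω := by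
      have h1 : t '' Ω ⊆ Ω := by
        refine IsPreconnected.subset_connectedComponentIn (hΩp.image t htc) ⟨φ x, hxΩ, by rw [ht, hkx]⟩ ?_
        rintro _ ⟨e, he, rfl⟩
        obtain ⟨y, hy, rfl⟩ := hΩB he
        rw [ht]
        refine ⟨k y, ?_, rfl⟩
        rw [Metric.mem_ball] at hy ⊢
        have h2 : dist (k y) (k x) = dist y x := k.dist_eq y x
        rw [hkx] at h2
        rw [h2]; exact hy
      exact fun e he => h1 ⟨e, he, rfl⟩
    have hit : ∀ n y, t^[n] (φ y) = φ ((k ^ n) y) := by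
      intro n
      induction n with
      | zero => intro y; rfl
      | succ n ih =>
        intro y
        rw [Function.iterate_succ_apply, ht, ih, pow_succ]
        rfl
    have T : PerMap t Ω (φ '' (Z ∩ A)) p :=
      { isOpen := hΩo
        conn := hΩp
        cont := htc
        maps := htm
        per := by
          intro e he
          obtain ⟨y, hy, rfl⟩ := hΩB he
          rw [hit, hkp y he]
        pos := hp.pos
        openW := hφo _ (hZo.inter hA) (Set.inter_subset_left.trans (hZB.trans hBs))
        subW := by
          rintro _ ⟨z, hz, rfl⟩
          exact hz.1
        neW := by
          obtain ⟨z, hz⟩ := mem_closure_iff.1 hxA Z hZo hxZ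
          exact ⟨φ z, z, hz, rfl⟩
        idW := by
          rintro _ ⟨z, hz, rfl⟩
          rw [ht, hK k hk z (hgA z hz.2)] }
    have h1 := newman T hp
    intro z hz
    have h2 := h1 (φ z) hz
    rw [ht] at h2
    exact hφi h2
  have hgF : g ∈ F := by
    refine compact_abelian_sub g F hFc _ (isom_nhds_one ((Metric.isClosed_closedBall (x := x) (ε := s)).isCompact) hε) ?_ ?_
    · intro H _ hH k hk z hz
      exact hsmall H (fun h hh => hH hh) k hk z (hrO (hZB hz))
    · intro m
      induction m using Nat.recOnMul with
      | zero => intro h; exact absurd h (lt_irrefl _)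
      | one => intro _ k _ h; rwa [pow_one] at h
      | prime p hp => intro _; exact hprime p hp
      | mul a b ha hb =>
        intro hab k hk h
        have ha0 : 0 < a := Nat.pos_of_mul_pos_right hab
        have hb0 : 0 < b := Nat.pos_of_mul_pos_left hab
        refine ha ha0 k hk (hb hb0 (k ^ a) (pow_mem hk a) ?_)
        rwa [← pow_mul]
  exact ⟨Z, hZo.mem_nhds hxZ, hgF⟩
end

open MeasureTheory Topology Filter
set_option linter.unusedSectionVars false
section
variable {X : Type*} [MetricSpace X]

section
variable {E : Type*} [NormedAddCommGroup E] [InnerProductSpace ℝ E] [FiniteDimensional ℝ E]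
  [MeasurableSpace E] [BorelSpace E]

theorem local_fix_ball (hX : IsCAT0 X) (x : X) {s : ℝ}
    (hs : 0 < s) (hK : IsCompact (Metric.closedBall x s)) (φ : X → E)
    (hφ : ContinuousOn φ (Metric.closedBall x s)) (hφi : Set.InjOn φ (Metric.closedBall x s))
    (hφo : ∀ O : Set X, IsOpen O → O ⊆ Metric.ball x s → IsOpen (φ '' O))
    (g : X ≃ᵢ X) (hgx : g x = x) (A : Set X) (hA : IsOpen A) (hgA : ∀ a ∈ A, g a = a)
    (hxA : x ∈ closure A) : ∃ O ∈ 𝓝 x, ∀ u ∈ O, g u = u := by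
  let Y := Metric.closedBall x s
  have hYc : CompactSpace Y := isCompact_iff_compactSpace.1 hK
  have hY : IsCAT0 Y := by
    refine ⟨fun a b => ?_, fun a b c m h1 h2 => hX.2 a b c m h1 h2⟩
    obtain ⟨m, h1, h2⟩ := hX.1 a b
    exact ⟨⟨m, cat_ball_mid hX a.2 b.2 h1 h2⟩, h1, h2⟩
  have hgsx : g.symm x = x := by
    have := g.symm_apply_apply x
    rwa [hgx] at this
  have hm : ∀ h : X ≃ᵢ X, h x = x → ∀ y : Y, h y ∈ Metric.closedBall x s := by
    intro h hx y
    have h2 : dist (h y) (h x) = dist (y : X) x := h.dist_eq _ _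
    rw [hx] at h2
    rw [Metric.mem_closedBall, h2]
    exact y.2
  let gY : Y ≃ᵢ Y :=
    { toFun := fun y => ⟨g y, hm g hgx y⟩
      invFun := fun y => ⟨g.symm y, hm g.symm hgsx y⟩
      left_inv := fun y => Subtype.ext (g.symm_apply_apply y)
      right_inv := fun y => Subtype.ext (g.apply_symm_apply y)
      isometry_toFun := Isometry.of_dist_eq fun a b => g.dist_eq a b }
  have hgY : ∀ y, ((gY y : Y) : X) = g y := fun _ => rfl
  let x' : Y := ⟨x, Metric.mem_closedBall_self hs.le⟩
  obtain ⟨O, hO, hOf⟩ := local_fix hY x' hs (fun y : Y => φ y) (hφ.comp_continuous continuous_subtype_val fun y => y.2)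
    (fun a b h => Subtype.ext (hφi a.2 b.2 h)) (by
      intro O hO hOs
      obtain ⟨O', hO', rfl⟩ := isOpen_induced_iff.1 hO
      have h1 : (fun y : Y => φ y) '' (Subtype.val ⁻¹' O') = φ '' (O' ∩ Metric.ball x s) := by
        ext e
        constructor
        · rintro ⟨y, hy, rfl⟩
          exact ⟨y, ⟨hy, hOs hy⟩, rfl⟩
        · rintro ⟨y, hy, rfl⟩
          exact ⟨⟨y, Metric.ball_subset_closedBall hy.2⟩, hy.1, rfl⟩
      rw [h1]
      exact hφo _ (hO'.inter Metric.isOpen_ball) Set.inter_subset_right)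
    gY (Subtype.ext hgx) (Subtype.val ⁻¹' A) (hA.preimage continuous_subtype_val)
    (fun a ha => Subtype.ext (hgA a ha)) (by
      rw [Metric.mem_closure_iff]
      intro δ hδ
      obtain ⟨a, ha, hd⟩ := Metric.mem_closure_iff.1 hxA (min δ s) (lt_min hδ hs)
      refine ⟨⟨a, ?_⟩, ha, hd.trans_le (min_le_left _ _)⟩
      rw [Metric.mem_closedBall, dist_comm]
      exact (hd.trans_le (min_le_right _ _)).le)
  obtain ⟨δ, hδ, hδO⟩ := Metric.mem_nhds_iff.1 hO
  refine ⟨Metric.ball x (min δ s), Metric.ball_mem_nhds _ (lt_min hδ hs), fun u hu => ?_⟩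
  have hu' : dist u x < min δ s := hu
  have h1 : u ∈ Metric.closedBall x s := (hu'.trans_le (min_le_right _ _)).le
  have h2 : (⟨u, h1⟩ : Y) ∈ O := hδO (hu'.trans_le (min_le_left _ _))
  exact congrArg Subtype.val (hOf _ h2)
end

theorem exists_chart [LocallyCompactSpace X] {E : Type*} [NormedAddCommGroup E] {x : X} {U : Set X}
    (hU : IsOpen U) (hx : x ∈ U) {V : Set E} (hV : IsOpen V) (e : U ≃ₜ V) :
    ∃ s > 0, IsCompact (Metric.closedBall x s) ∧ Metric.closedBall x s ⊆ U ∧ ∃ φ : X → E,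
      ContinuousOn φ (Metric.closedBall x s) ∧ Set.InjOn φ (Metric.closedBall x s) ∧
      ∀ O : Set X, IsOpen O → O ⊆ Metric.ball x s → IsOpen (φ '' O) := by
  classical
  obtain ⟨C, hCn, hCU, hC⟩ := local_compact_nhds (hU.mem_nhds hx)
  obtain ⟨s, hs, hsC⟩ := Metric.nhds_basis_closedBall.mem_iff.1 hCn
  let φ : X → E := fun y => if hy : y ∈ U then (e ⟨y, hy⟩ : E) else 0
  have hφ : ∀ y : U, φ y = e y := fun y => by simp [φ]
  have hsU := hsC.trans hCU
  refine ⟨s, hs, hC.of_isClosed_subset Metric.isClosed_closedBall hsC, hsU, φ, ?_, ?_, ?_⟩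
  · refine ContinuousOn.mono ?_ hsU
    rw [continuousOn_iff_continuous_restrict]
    have : U.domRestrict φ = fun y => (e y : E) := funext hφ
    rw [this]
    exact continuous_subtype_val.comp e.continuous
  · intro a ha b hb h
    have h1 := hφ ⟨a, hsU ha⟩
    have h2 := hφ ⟨b, hsU hb⟩
    have h3 : (e ⟨a, hsU ha⟩ : E) = e ⟨b, hsU hb⟩ := by rw [← h1, ← h2]; exact h
    exact congrArg Subtype.val (e.injective (Subtype.ext h3))
  · intro O hO hOs
    have h1 : φ '' O = Subtype.val '' (e '' (Subtype.val ⁻¹' O)) := by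
      ext z
      constructor
      · rintro ⟨y, hy, rfl⟩
        have hyU := hsU (Metric.ball_subset_closedBall (hOs hy))
        exact ⟨e ⟨y, hyU⟩, ⟨⟨y, hyU⟩, hy, rfl⟩, (hφ ⟨y, hyU⟩).symm⟩
      · rintro ⟨_, ⟨y, hy, rfl⟩, rfl⟩
        exact ⟨y, hy, hφ y⟩
    rw [h1]
    exact hV.isOpenMap_subtype_val _ (e.isOpenMap _ (hO.preimage continuous_subtype_val))

/-- The main data: every point of `M` has a chart ball. -/
def HasCharts (M : Set X) (E : Type*) [NormedAddCommGroup E] : Prop :=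
  ∀ x ∈ M, ∃ s > 0, IsCompact (Metric.closedBall x s) ∧ Metric.closedBall x s ⊆ M ∧ ∃ φ : X → E,
      ContinuousOn φ (Metric.closedBall x s) ∧ Set.InjOn φ (Metric.closedBall x s) ∧
      ∀ O : Set X, IsOpen O → O ⊆ Metric.ball x s → IsOpen (φ '' O)

variable {E : Type*} [NormedAddCommGroup E] [InnerProductSpace ℝ E] [FiniteDimensional ℝ E]
  [MeasurableSpace E] [BorelSpace E]

theorem isom_unique (hX : IsCAT0 X) {M : Set X} (hM : HasCharts M E) (hconn : IsConnected M)
    (hdense : Dense M) (g : X ≃ᵢ X) {x0 : X} (hx0 : x0 ∈ M) {O : Set X} (hO : O ∈ 𝓝 x0)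
    (hgO : ∀ u ∈ O, g u = u) : g = 1 := by
  let A : Set X := interior {x | g x = x}
  have hAo : IsOpen A := isOpen_interior
  have hgA : ∀ a ∈ A, g a = a := fun a ha => by
    have h : a ∈ {x | g x = x} := interior_subset ha
    exact h
  have hfix : IsClosed {x | g x = x} := isClosed_eq g.continuous continuous_id
  have hsub : M ⊆ A := by
    refine hconn.isPreconnected.subset_of_closure_inter_subset hAo ⟨x0, hx0, ?_⟩ ?_
    · exact mem_interior_iff_mem_nhds.2 (Filter.mem_of_superset hO hgO)
    · rintro x ⟨hxA, hxM⟩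
      obtain ⟨s, hs, hK, -, φ, h1, h2, h3⟩ := hM x hxM
      have hgx : g x = x := by
        have h : x ∈ {x | g x = x} := closure_minimal interior_subset hfix hxA
        exact h
      obtain ⟨O', hO', h4⟩ := local_fix_ball hX x hs hK φ h1 h2 h3 g hgx A hAo hgA hxA
      exact mem_interior_iff_mem_nhds.2 (Filter.mem_of_superset hO' h4)
  have hall : ∀ x, g x = x := by
    intro x
    have h : x ∈ {x | g x = x} := closure_minimal (hsub.trans interior_subset) hfix (hdense x)
    exact h
  exact IsometryEquiv.ext hall

theorem isom_nss (hX : IsCAT0 X) {M : Set X} (hM : HasCharts M E) (hconn : IsConnected M)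
    (hdense : Dense M) : HasNoSmallSubgroups (X ≃ᵢ X) := by
  obtain ⟨x, hx⟩ := hconn.nonempty
  obtain ⟨s, hs, hK, -, φ, h1, h2, h3⟩ := hM x hx
  obtain ⟨ε, hε, O, hO, hsmall⟩ := small_group_fix hX hs hK h1 h2 (by
      refine Filter.mem_of_superset ((h3 _ Metric.isOpen_ball (Metric.ball_subset_ball (by linarith : s / 2 ≤ s))).mem_nhds
        ⟨x, Metric.mem_ball_self (by positivity), rfl⟩) (Set.image_mono Metric.ball_subset_closedBall))
  refine ⟨_, isom_nhds_one hK hε, fun H hH => ?_⟩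
  rw [Subgroup.eq_bot_iff_forall]
  intro h hh
  exact isom_unique hX hM hconn hdense h hx hO (hsmall H (fun k hk => hH hk) h hh)

theorem no_padic_of_nss {G : Type*} [Group G] [TopologicalSpace G] (hG : HasNoSmallSubgroups G)
    (p : ℕ) [Fact p.Prime] : ¬ ∃ φ : Multiplicative ℤ_[p] →* G, Function.Injective φ ∧ Continuous φ := by
  rintro ⟨φ, hi, hc⟩
  obtain ⟨U, hU, hH⟩ := hG
  let f : ℤ_[p] → G := fun z => φ (Multiplicative.ofAdd z)
  have hf : Continuous f := hc.comp continuous_ofAdd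
  have hf0 : f 0 = 1 := map_one φ
  have h1 : f ⁻¹' U ∈ 𝓝 (0 : ℤ_[p]) := hf.continuousAt.preimage_mem_nhds (by rw [hf0]; exact hU)
  obtain ⟨δ, hδ, hδU⟩ := Metric.mem_nhds_iff.1 h1
  have hp1 : ‖(p : ℤ_[p])‖ < 1 := by
    rw [PadicInt.norm_p]
    exact inv_lt_one_of_one_lt₀ (by exact_mod_cast (Fact.out : p.Prime).one_lt)
  obtain ⟨k, hk⟩ := exists_pow_lt_of_lt_one hδ hp1
  let Z : AddSubgroup ℤ_[p] := (Ideal.span {(p : ℤ_[p]) ^ k}).toAddSubgroup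
  have hZ : ∀ z ∈ Z, z ∈ f ⁻¹' U := by
    intro z hz
    obtain ⟨c, rfl⟩ := Ideal.mem_span_singleton'.1 (show z ∈ Ideal.span {(p : ℤ_[p]) ^ k} from hz)
    apply hδU
    rw [mem_ball_zero_iff, norm_mul, norm_pow]
    calc ‖c‖ * ‖(p : ℤ_[p])‖ ^ k ≤ 1 * ‖(p : ℤ_[p])‖ ^ k := by
          gcongr
          exact PadicInt.norm_le_one c
      _ < δ := by rw [one_mul]; exact hk
  have h2 := hH ((AddSubgroup.toSubgroup Z).map φ) (by
    rintro _ ⟨z, hz, rfl⟩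
    exact hZ z.toAdd hz)
  have h3 : φ (Multiplicative.ofAdd ((p : ℤ_[p]) ^ k)) = 1 := by
    have : φ (Multiplicative.ofAdd ((p : ℤ_[p]) ^ k)) ∈ (AddSubgroup.toSubgroup Z).map φ :=
      ⟨_, (Ideal.mem_span_singleton_self _ : (p : ℤ_[p]) ^ k ∈ Ideal.span {(p : ℤ_[p]) ^ k}), rfl⟩
    rw [h2] at this
    exact this
  have h4 : Multiplicative.ofAdd ((p : ℤ_[p]) ^ k) = 1 := hi (h3.trans (map_one φ).symm)
  have h5 : (p : ℤ_[p]) ^ k = 0 := h4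
  exact pow_ne_zero k (by exact_mod_cast (Fact.out : p.Prime).ne_zero) h5

theorem dense_compl_of_lf (hX : IsCAT0 X) (E : Set X) (hlf : ∀ x : X, ∃ U ∈ nhds x, (U ∩ E).Finite)
    (hne : (Eᶜ : Set X).Nonempty) : Dense (Eᶜ : Set X) := by
  intro x
  by_contra hx
  have hxE : x ∈ E := by
    by_contra h
    exact hx (subset_closure h)
  obtain ⟨y, hy⟩ := hne
  -- points arbitrarily close to `x`, distinct from `x`
  have hnear : ∀ n : ℕ, ∃ z, z ≠ x ∧ dist x z = dist x y / 2 ^ n := by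
    have hxy : x ≠ y := fun h => hy (h ▸ hxE)
    intro n
    induction n with
    | zero => exact ⟨y, hxy.symm, by simp⟩
    | succ n ih =>
      obtain ⟨z, hz, hd⟩ := ih
      obtain ⟨m, h1, h2⟩ := hX.1 x z
      refine ⟨m, ?_, ?_⟩
      · rintro rfl
        rw [dist_self] at h1
        have := dist_pos.2 (Ne.symm hz)
        linarith
      · rw [h1, hd, pow_succ]
        field_simp
  have hacc : (𝓝[≠] x).NeBot := by
    rw [← mem_closure_iff_nhdsWithin_neBot, Metric.mem_closure_iff]
    intro δ hδ
    have ht : Tendsto (fun n : ℕ => dist x y / 2 ^ n) atTop (𝓝 0) :=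
      tendsto_const_nhds.div_atTop (tendsto_pow_atTop_atTop_of_one_lt (by norm_num))
    obtain ⟨n, hn⟩ := (ht.eventually_lt_const hδ).exists
    obtain ⟨z, hz, hd⟩ := hnear n
    exact ⟨z, hz, by rw [hd]; exact hn⟩
  obtain ⟨U, hU, hfin⟩ := hlf x
  have h1 : (closure (Eᶜ : Set X))ᶜ ∈ 𝓝 x := isClosed_closure.isOpen_compl.mem_nhds hx
  have h2 : (closure (Eᶜ : Set X))ᶜ ⊆ E := by
    intro z hz
    by_contra h
    exact hz (subset_closure h)
  have h3 : U ∩ E ∈ 𝓝 x := Filter.inter_mem hU (Filter.mem_of_superset h1 h2)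
  exact (infinite_of_mem_nhds x h3) hfin
end

theorem stmt15_aux {X : Type*} [MetricSpace X] [LocallyCompactSpace X]
    (hcat : IsCAT0 X) {n : ℕ}
    (E : Set X) (hlf : ∀ x : X, ∃ U ∈ nhds x, (U ∩ E).Finite)
    (hconn : IsConnected (Eᶜ : Set X))
    (hman : ∀ x ∈ (Eᶜ : Set X), ∃ U : Set X, IsOpen U ∧ x ∈ U ∧ U ⊆ Eᶜ ∧
      ∃ V : Set (EuclideanSpace ℝ (Fin n)), IsOpen V ∧ Nonempty (↥U ≃ₜ ↥V)) :
    HasNoSmallSubgroups (X ≃ᵢ X) := by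
  refine isom_nss (E := EuclideanSpace ℝ (Fin n)) hcat (M := Eᶜ) ?_ hconn (dense_compl_of_lf hcat E hlf hconn.nonempty)
  intro x hx
  obtain ⟨U, hU, hxU, hUE, V, hV, ⟨e⟩⟩ := hman x hx
  obtain ⟨s, hs, hK, hsU, h⟩ := exists_chart hU hxU hV e
  exact ⟨s, hs, hK, hsU.trans hUE, h⟩

/-- Let `X` be a locally compact CAT(0) homology manifold of dimension
`n ≥ 3` (so `HD(X) = n`), and `E ⊂ X` a locally finite `Isom(X)`-invariant subset with
`X \ E` a connected topological `n`-manifold.  Then no `p`-adic group `ℤ_p` acts effectively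
(continuously and injectively) by isometries on `X` — otherwise `HD(X \ E) ≥ n + 2`, which
contradicts `HD(X \ E) ≤ HD(X) = n` — and therefore `Isom(X)` is a Lie group (has no small
subgroups). -/
theorem stmt15 {X : Type*} [MetricSpace X] [LocallyCompactSpace X]
    (hcat : IsCAT0 X) {n : ℕ} (hn : 3 ≤ n)
    (hdim : dimH (univ : Set X) = n)
    (E : Set X) (hlf : ∀ x : X, ∃ U ∈ nhds x, (U ∩ E).Finite)
    (hinv : ∀ g : X ≃ᵢ X, (fun x : X => g x) '' E = E)
    (hconn : IsConnected (Eᶜ : Set X))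
    (hman : ∀ x ∈ (Eᶜ : Set X), ∃ U : Set X, IsOpen U ∧ x ∈ U ∧ U ⊆ Eᶜ ∧
      ∃ V : Set (EuclideanSpace ℝ (Fin n)), IsOpen V ∧ Nonempty (↥U ≃ₜ ↥V)) :
    (∀ (p : ℕ) [Fact p.Prime],
      ¬ ∃ φ : Multiplicative ℤ_[p] →* (X ≃ᵢ X),
        Function.Injective φ ∧ Continuous φ) ∧
    HasNoSmallSubgroups (X ≃ᵢ X) := by
  have hG := stmt15_aux hcat E hlf hconn hman
  exact ⟨fun p _ => no_padic_of_nss hG p, hG⟩
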